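/- Let g: ℕ → ℝ be additive such that 𝓑 := {n : g(n) < g(n−1)} has natural density zero, i.e. |𝓑 ∩ [1,X]| = o(X). Then there exist functions λ(X), η(X) such that g(n) = λ(X) log n − η(X) + o(B_g(X)) holds for all but o(X) integers n ≤ X. -/

import Mathlib

open Finset

/-- The set of prime powers `p^k ≤ Y` (as natural numbers `≥ 2`). -/
noncomputable def ppows (Y : ℝ) : Finset ℕ :=
  (Finset.Icc 2 ⌊Y⌋₊).filter IsPrimePow

/-- `A_g(Y) = ∑_{p^k ≤ Y} g(p^k) p^{-k} (1 - 1/p)` for real-valued `g`. -/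
noncomputable def AgR (g : ℕ → ℝ) (Y : ℝ) : ℝ :=
  ∑ q ∈ ppows Y, g q * (1 / (q : ℝ)) * (1 - 1 / ((q.minFac : ℝ)))

/-- `B_g(Y) = (∑_{p^k ≤ Y} g(p^k)² p^{-k})^{1/2}` for real-valued `g`. -/
noncomputable def BgR (g : ℕ → ℝ) (Y : ℝ) : ℝ :=
  Real.sqrt (∑ q ∈ ppows Y, (g q) ^ 2 / (q : ℝ))

/-- `g` is additive: `g(mn) = g(m) + g(n)` whenever `gcd(m,n) = 1`. -/
def IsAdditiveR (g : ℕ → ℝ) : Prop :=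
  ∀ m n : ℕ, Nat.Coprime m n → g (m * n) = g m + g n

/-- The indicator function of divisibility by `d`. -/
noncomputable def divInd (d n : ℕ) : ℝ := if d ∣ n then 1 else 0

/-- The indicator function of divisibility by `p`, centred at its density. -/
noncomputable def xi (p n : ℕ) : ℝ := divInd p n - 1 / (p : ℝ)

/-- The weighted sum of centred divisibility indicators over the moduli in `P`. -/
noncomputable def xiSum (P : Finset ℕ) (a : ℕ → ℝ) (n : ℕ) : ℝ := ∑ p ∈ P, a p * xi p n

/-- The quadratic weight `∑ a(p)² / p`, the approximate variance of `xiSum P a`. -/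
noncomputable def sqWt (P : Finset ℕ) (a : ℕ → ℝ) : ℝ := ∑ p ∈ P, a p ^ 2 / (p : ℝ)

lemma divInd_nonneg (d n : ℕ) : 0 ≤ divInd d n := by
  unfold divInd; split_ifs <;> norm_num

lemma divInd_le_one (d n : ℕ) : divInd d n ≤ 1 := by
  unfold divInd; split_ifs <;> norm_num

lemma divInd_mul_self (d n : ℕ) : divInd d n * divInd d n = divInd d n := by
  unfold divInd; split_ifs <;> norm_num

lemma divInd_mul (d e n : ℕ) : divInd d n * divInd e n = divInd (d.lcm e) n := by
  unfold divInd
  by_cases h1 : d ∣ n <;> by_cases h2 : e ∣ n <;> simp [Nat.lcm_dvd_iff, h1, h2]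

lemma sqWt_nonneg (P : Finset ℕ) (a : ℕ → ℝ) : 0 ≤ sqWt P a :=
  Finset.sum_nonneg fun p _ => by positivity

lemma sqWt_mono {P Q : Finset ℕ} (h : P ⊆ Q) (a : ℕ → ℝ) : sqWt P a ≤ sqWt Q a :=
  Finset.sum_le_sum_of_subset_of_nonneg h fun p _ _ => by positivity

lemma abs_xi_le_one {p : ℕ} (hp : p ≠ 0) (n : ℕ) : |xi p n| ≤ 1 := by
  have h1 : (1 : ℝ) ≤ p := by exact_mod_cast Nat.one_le_iff_ne_zero.2 hp
  have h2 : 1 / (p : ℝ) ≤ 1 := by rw [div_le_one (by linarith)]; exact h1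
  have h3 : 0 ≤ 1 / (p : ℝ) := by positivity
  have := divInd_nonneg p n
  have := divInd_le_one p n
  unfold xi
  rw [abs_le]; constructor <;> linarith

lemma sum_divInd (d N : ℕ) : ∑ n ∈ Ioc 0 N, divInd d n = ((N / d : ℕ) : ℝ) := by
  rw [← Nat.Ioc_filter_dvd_card_eq_div, Finset.card_filter]
  push_cast
  rfl

lemma abs_card_modEq_sub_le {r : ℕ} (hr : 0 < r) (v N : ℕ) :
    |(((Ioc 0 N).filter (fun n => n ≡ v [MOD r])).card : ℝ) - (N : ℝ) / r| ≤ 1 := by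
  have h := Nat.Ioc_filter_modEq_card 0 N hr v
  have hr' : (0 : ℝ) < r := by exact_mod_cast hr
  set x : ℚ := ((N : ℚ) - v) / r with hx
  set y : ℚ := (((0 : ℕ) : ℚ) - v) / r with hy
  have hxy : y ≤ x := by
    rw [hx, hy]; gcongr; exact_mod_cast Nat.zero_le N
  have hfl : ⌊y⌋ ≤ ⌊x⌋ := Int.floor_le_floor hxy
  rw [max_eq_left (by linarith)] at h
  have hc : ((((Ioc 0 N).filter (fun n => n ≡ v [MOD r])).card : ℤ) : ℚ) = ⌊x⌋ - ⌊y⌋ := by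
    rw [h]; push_cast; rfl
  have e : x - y = (N : ℚ) / r := by rw [hx, hy]; push_cast; ring
  have a1 := Int.floor_le x
  have a2 := Int.lt_floor_add_one x
  have a3 := Int.floor_le y
  have a4 := Int.lt_floor_add_one y
  have : |((((Ioc 0 N).filter (fun n => n ≡ v [MOD r])).card : ℤ) : ℚ) - (N : ℚ) / r| ≤ 1 := by
    rw [hc, ← e, abs_le]; constructor <;> linarith
  have h2 := (Rat.cast_le (K := ℝ)).2 this
  push_cast at h2
  simpa using h2

lemma exists_modEq_of_dvd_add {r : ℕ} (hr : 0 < r) (i : ℕ) :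
    ∃ v, ∀ n, r ∣ n + i ↔ n ≡ v [MOD r] := by
  refine ⟨(r - 1) * i, fun n => ?_⟩
  have key : (r - 1) * i + i = r * i := by
    conv_lhs => rw [← Nat.succ_mul]
    congr 1; omega
  constructor
  · intro h
    apply Nat.ModEq.add_right_cancel' i
    rw [key]
    exact ((Nat.modEq_zero_iff_dvd).2 h).trans
      ((Nat.modEq_zero_iff_dvd).2 (dvd_mul_right r i)).symm
  · intro h
    rw [← Nat.modEq_zero_iff_dvd]
    have := h.add_right i
    rw [key] at this
    exact this.trans ((Nat.modEq_zero_iff_dvd).2 (dvd_mul_right r i))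

lemma abs_sum_divInd_add_sub_le {r : ℕ} (hr : 0 < r) (i N : ℕ) :
    |∑ n ∈ Ioc 0 N, divInd r (n + i) - (N : ℝ) / r| ≤ 1 := by
  obtain ⟨v, hv⟩ := exists_modEq_of_dvd_add hr i
  have := abs_card_modEq_sub_le hr v N
  rw [Finset.card_filter] at this
  push_cast at this
  simpa [divInd, hv] using this

lemma abs_sum_divInd_add_mul_divInd_add_sub_le {p q : ℕ} (hp : 0 < p) (hq : 0 < q)
    (h : p.Coprime q) (i j N : ℕ) :
    |∑ n ∈ Ioc 0 N, divInd p (n + i) * divInd q (n + j) - (N : ℝ) / (p * q)| ≤ 1 := by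
  obtain ⟨u, hu⟩ := exists_modEq_of_dvd_add hp i
  obtain ⟨v, hv⟩ := exists_modEq_of_dvd_add hq j
  obtain ⟨k, hk1, hk2⟩ := Nat.chineseRemainder h u v
  have key : ∀ n, (p ∣ n + i ∧ q ∣ n + j) ↔ n ≡ k [MOD p * q] := by
    intro n
    rw [hu, hv, ← Nat.modEq_and_modEq_iff_modEq_mul h]
    exact ⟨fun ⟨a, b⟩ => ⟨a.trans hk1.symm, b.trans hk2.symm⟩,
      fun ⟨a, b⟩ => ⟨a.trans hk1, b.trans hk2⟩⟩
  have := abs_card_modEq_sub_le (Nat.mul_pos hp hq) k N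
  rw [Finset.card_filter] at this
  push_cast at this
  have e : ∀ n, divInd p (n + i) * divInd q (n + j) = if n ≡ k [MOD p * q] then 1 else 0 := by
    intro n
    rw [← if_congr (key n) rfl rfl]
    unfold divInd
    by_cases h1 : p ∣ n + i <;> by_cases h2 : q ∣ n + j <;> simp [h1, h2]
  simpa only [e] using this

lemma abs_sum_xi_add_mul_xi_add_le {p q : ℕ} (hp : 2 ≤ p) (hq : 2 ≤ q)
    (h : p.Coprime q) (i j N : ℕ) :
    |∑ n ∈ Ioc 0 N, xi p (n + i) * xi q (n + j)| ≤ 2 := by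
  have hp' : (2 : ℝ) ≤ p := by exact_mod_cast hp
  have hq' : (2 : ℝ) ≤ q := by exact_mod_cast hq
  have e : ∑ n ∈ Ioc 0 N, xi p (n + i) * xi q (n + j) =
      (∑ n ∈ Ioc 0 N, divInd p (n + i) * divInd q (n + j) - (N : ℝ) / (p * q))
      - (1 / (q : ℝ)) * (∑ n ∈ Ioc 0 N, divInd p (n + i) - (N : ℝ) / p)
      - (1 / (p : ℝ)) * (∑ n ∈ Ioc 0 N, divInd q (n + j) - (N : ℝ) / q) := by
    have : ∀ n, xi p (n + i) * xi q (n + j) = divInd p (n + i) * divInd q (n + j)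
        - (1 / (q : ℝ)) * divInd p (n + i) - (1 / (p : ℝ)) * divInd q (n + j)
        + 1 / ((p : ℝ) * q) := by
      intro n; unfold xi; field_simp; ring
    simp only [this, Finset.sum_add_distrib, Finset.sum_sub_distrib, ← Finset.mul_sum,
      Finset.sum_const, Nat.card_Ioc, nsmul_eq_mul]
    field_simp
    simp
    ring
  have h1 := abs_sum_divInd_add_mul_divInd_add_sub_le (by omega) (by omega) h i j N
  have h2 := abs_sum_divInd_add_sub_le (r := p) (by omega) i N
  have h3 := abs_sum_divInd_add_sub_le (r := q) (by omega) j N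
  have i1 : 1 / (p : ℝ) ≤ 1 / 2 := one_div_le_one_div_of_le (by norm_num) hp'
  have i2 : 1 / (q : ℝ) ≤ 1 / 2 := one_div_le_one_div_of_le (by norm_num) hq'
  have j1 : 0 ≤ 1 / (p : ℝ) := by positivity
  have j2 : 0 ≤ 1 / (q : ℝ) := by positivity
  rw [e]
  generalize (∑ n ∈ Ioc 0 N, divInd p (n + i) * divInd q (n + j) - (N : ℝ) / (p * q)) = A at *
  generalize (∑ n ∈ Ioc 0 N, divInd p (n + i) - (N : ℝ) / p) = B at *
  generalize (∑ n ∈ Ioc 0 N, divInd q (n + j) - (N : ℝ) / q) = C at *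
  calc |A - 1 / (q : ℝ) * B - 1 / (p : ℝ) * C|
      ≤ |A| + |1 / (q : ℝ) * B| + |1 / (p : ℝ) * C| := by
        refine (abs_sub _ _).trans (add_le_add_left (abs_sub _ _) _)
    _ = |A| + 1 / (q : ℝ) * |B| + 1 / (p : ℝ) * |C| := by
        rw [abs_mul, abs_mul, abs_of_nonneg j1, abs_of_nonneg j2]
    _ ≤ 1 + 1 / 2 * 1 + 1 / 2 * 1 := by gcongr
    _ = 2 := by norm_num

lemma sum_xi_add_mul_xi_add_le {p : ℕ} (hp : 2 ≤ p) {i j : ℕ} (h : ¬ i ≡ j [MOD p]) (N : ℕ) :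
    ∑ n ∈ Ioc 0 N, xi p (n + i) * xi p (n + j) ≤ 2 := by
  have hp' : (2 : ℝ) ≤ p := by exact_mod_cast hp
  have hz : ∀ n, divInd p (n + i) * divInd p (n + j) = 0 := by
    intro n
    unfold divInd
    by_cases h1 : p ∣ n + i <;> by_cases h2 : p ∣ n + j <;> simp [h1, h2]
    exact h (Nat.ModEq.add_left_cancel' n
      (((Nat.modEq_zero_iff_dvd).2 h1).trans ((Nat.modEq_zero_iff_dvd).2 h2).symm))
  have e : ∑ n ∈ Ioc 0 N, xi p (n + i) * xi p (n + j) =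
      - (1 / (p : ℝ)) * (∑ n ∈ Ioc 0 N, divInd p (n + i) - (N : ℝ) / p)
      - (1 / (p : ℝ)) * (∑ n ∈ Ioc 0 N, divInd p (n + j) - (N : ℝ) / p)
      - (N : ℝ) / p ^ 2 := by
    have : ∀ n, xi p (n + i) * xi p (n + j) = divInd p (n + i) * divInd p (n + j)
        - (1 / (p : ℝ)) * divInd p (n + i) - (1 / (p : ℝ)) * divInd p (n + j)
        + 1 / ((p : ℝ) * p) := by
      intro n; unfold xi; field_simp; ring
    simp only [this, hz, Finset.sum_add_distrib, Finset.sum_sub_distrib, ← Finset.mul_sum,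
      Finset.sum_const, Nat.card_Ioc, nsmul_eq_mul]
    field_simp
    simp
    ring
  have h2 := (abs_le.1 (abs_sum_divInd_add_sub_le (r := p) (by omega) i N)).1
  have h3 := (abs_le.1 (abs_sum_divInd_add_sub_le (r := p) (by omega) j N)).1
  have i1 : 1 / (p : ℝ) ≤ 1 := by rw [div_le_one (by linarith)]; linarith
  have j1 : 0 ≤ 1 / (p : ℝ) := by positivity
  have k : 0 ≤ (N : ℝ) / p ^ 2 := by positivity
  rw [e]
  nlinarith

lemma sum_xi_add_sq {p : ℕ} (hp : 2 ≤ p) (i N : ℕ) :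
    ∑ n ∈ Ioc 0 N, xi p (n + i) * xi p (n + i) =
      (1 - 2 / (p : ℝ)) * (∑ n ∈ Ioc 0 N, divInd p (n + i) - (N : ℝ) / p)
      + (N : ℝ) / p - (N : ℝ) / p ^ 2 := by
  have hp' : (2 : ℝ) ≤ p := by exact_mod_cast hp
  have : ∀ n, xi p (n + i) * xi p (n + i) = (1 - 2 / (p : ℝ)) * divInd p (n + i)
      + 1 / ((p : ℝ) * p) := by
    intro n
    have := divInd_mul_self p (n + i)
    unfold xi
    linear_combination this
  simp only [this, Finset.sum_add_distrib, ← Finset.mul_sum,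
    Finset.sum_const, Nat.card_Ioc, nsmul_eq_mul]
  field_simp
  simp
  ring

lemma sum_xi_add_sq_le {p : ℕ} (hp : 2 ≤ p) (i N : ℕ) :
    ∑ n ∈ Ioc 0 N, xi p (n + i) * xi p (n + i) ≤ N / p + 2 := by
  have hp' : (2 : ℝ) ≤ p := by exact_mod_cast hp
  rw [sum_xi_add_sq hp]
  have h2 := (abs_le.1 (abs_sum_divInd_add_sub_le (r := p) (by omega) i N)).2
  have i1 : 2 / (p : ℝ) ≤ 1 := by rw [div_le_one (by linarith)]; linarith
  have j1 : 0 ≤ 2 / (p : ℝ) := by positivity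
  have k : 0 ≤ (N : ℝ) / p ^ 2 := by positivity
  nlinarith

lemma le_sum_xi_sq {p : ℕ} (hp : 2 ≤ p) (N : ℕ) :
    (N : ℝ) / p * (1 / 2) - 2 ≤ ∑ n ∈ Ioc 0 N, xi p n * xi p n := by
  have hp' : (2 : ℝ) ≤ p := by exact_mod_cast hp
  have e := sum_xi_add_sq hp 0 N
  simp only [add_zero] at e
  rw [e]
  have h2 := (abs_le.1 (abs_sum_divInd_add_sub_le (r := p) (by omega) 0 N)).1
  simp only [add_zero] at h2
  have i1 : 2 / (p : ℝ) ≤ 1 := by rw [div_le_one (by linarith)]; linarith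
  have j1 : 0 ≤ 2 / (p : ℝ) := by positivity
  have k : (N : ℝ) / p ^ 2 ≤ N / p * (1 / 2) := by
    rw [pow_two, ← div_div, div_eq_mul_one_div ((N : ℝ) / p)]
    gcongr
  nlinarith

lemma sum_abs_sq_le {P : Finset ℕ} {N : ℕ} (hP : ∀ p ∈ P, p.Prime) (hN : ∀ p ∈ P, p ^ 4 ≤ N)
    (a : ℕ → ℝ) : (∑ p ∈ P, |a p|) ^ 2 ≤ √(N : ℝ) * sqWt P a := by
  set z := Nat.sqrt (Nat.sqrt N) with hz
  have hsub : P ⊆ Icc 1 z := by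
    intro p hp
    rw [mem_Icc]
    refine ⟨(hP p hp).one_le, ?_⟩
    rw [hz, Nat.le_sqrt, Nat.le_sqrt]
    calc p * p * (p * p) = p ^ 4 := by ring
      _ ≤ N := hN p hp
  have h1 : ∑ p ∈ P, (p : ℝ) ≤ √(N : ℝ) := by
    calc ∑ p ∈ P, (p : ℝ) ≤ ∑ p ∈ P, (z : ℝ) :=
          Finset.sum_le_sum fun p hp => by exact_mod_cast (mem_Icc.1 (hsub hp)).2
      _ = (P.card : ℝ) * z := by simp
      _ ≤ z * z := by
          gcongr
          simpa using Finset.card_le_card hsub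
      _ ≤ √(N : ℝ) := by
          have : z * z ≤ Nat.sqrt N := Nat.sqrt_le _
          have h2 : ((z * z : ℕ) : ℝ) ≤ (Nat.sqrt N : ℝ) := by exact_mod_cast this
          push_cast at h2
          exact h2.trans Real.nat_sqrt_le_real_sqrt
  have h2 : (∑ p ∈ P, |a p|) ^ 2 ≤ (∑ p ∈ P, a p ^ 2 / (p : ℝ)) * ∑ p ∈ P, (p : ℝ) := by
    apply Finset.sum_sq_le_sum_mul_sum_of_sq_le_mul
    · intro p _; positivity
    · intro p _; positivity
    · intro p hp
      have : (0 : ℝ) < p := by exact_mod_cast (hP p hp).pos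
      rw [sq_abs]
      field_simp
      exact le_rfl
  calc _ ≤ _ := h2
    _ ≤ sqWt P a * √(N : ℝ) := mul_le_mul_of_nonneg_left h1 (sqWt_nonneg P a)
    _ = _ := mul_comm _ _

lemma abs_xiSum_le {P : Finset ℕ} (hP : ∀ p ∈ P, p.Prime) (a : ℕ → ℝ) (n : ℕ) :
    |xiSum P a n| ≤ ∑ p ∈ P, |a p| := by
  refine (Finset.abs_sum_le_sum_abs _ _).trans (Finset.sum_le_sum fun p hp => ?_)
  rw [abs_mul]
  exact mul_le_of_le_one_right (abs_nonneg _) (abs_xi_le_one (hP p hp).ne_zero n)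

lemma sum_xiSum_mul_xiSum (P Q : Finset ℕ) (a b : ℕ → ℝ) (i j N : ℕ) :
    ∑ n ∈ Ioc 0 N, xiSum P a (n + i) * xiSum Q b (n + j) =
      ∑ p ∈ P, ∑ q ∈ Q, a p * b q * ∑ n ∈ Ioc 0 N, xi p (n + i) * xi q (n + j) := by
  simp only [xiSum, Finset.sum_mul_sum]
  rw [Finset.sum_comm]
  refine Finset.sum_congr rfl fun p _ => ?_
  rw [Finset.sum_comm]
  refine Finset.sum_congr rfl fun q _ => ?_
  rw [Finset.mul_sum]
  exact Finset.sum_congr rfl fun n _ => by ring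

lemma abs_sum_xiSum_mul_xiSum_le_of_disjoint {P Q : Finset ℕ} (hP : ∀ p ∈ P, p.Prime)
    (hQ : ∀ p ∈ Q, p.Prime) (h : Disjoint P Q) (a b : ℕ → ℝ) (N : ℕ) :
    |∑ n ∈ Ioc 0 N, xiSum P a n * xiSum Q b n| ≤ 2 * (∑ p ∈ P, |a p|) * ∑ p ∈ Q, |b p| := by
  have e := sum_xiSum_mul_xiSum P Q a b 0 0 N
  simp only [add_zero] at e
  rw [e]
  calc _ ≤ ∑ p ∈ P, ∑ q ∈ Q, |a p| * |b q| * 2 := by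
        refine (Finset.abs_sum_le_sum_abs _ _).trans (Finset.sum_le_sum fun p hp => ?_)
        refine (Finset.abs_sum_le_sum_abs _ _).trans (Finset.sum_le_sum fun q hq => ?_)
        rw [abs_mul, abs_mul]
        gcongr
        refine abs_sum_xi_add_mul_xi_add_le (hP p hp).two_le (hQ q hq).two_le ?_ 0 0 N
        refine (Nat.coprime_primes (hP p hp) (hQ q hq)).2 ?_
        rintro rfl
        exact Finset.disjoint_left.1 h hp hq
    _ = _ := by
        rw [mul_assoc, Finset.sum_mul_sum, Finset.mul_sum]
        refine Finset.sum_congr rfl fun p _ => ?_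
        rw [Finset.mul_sum]
        exact Finset.sum_congr rfl fun q _ => by ring

lemma sum_xiSum_add_mul_xiSum_add_le {P : Finset ℕ} (hP : ∀ p ∈ P, p.Prime) (a : ℕ → ℝ)
    {i j : ℕ} (h : ∀ p ∈ P, ¬ i ≡ j [MOD p]) (N : ℕ) :
    ∑ n ∈ Ioc 0 N, xiSum P a (n + i) * xiSum P a (n + j) ≤ 2 * (∑ p ∈ P, |a p|) ^ 2 := by
  rw [sum_xiSum_mul_xiSum, pow_two, Finset.sum_mul_sum, Finset.mul_sum]
  refine Finset.sum_le_sum fun p hp => ?_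
  rw [Finset.mul_sum]
  refine Finset.sum_le_sum fun q hq => ?_
  by_cases hpq : p = q
  · subst hpq
    rw [← abs_mul, abs_of_nonneg (mul_self_nonneg _), mul_comm (2 : ℝ)]
    exact mul_le_mul_of_nonneg_left (sum_xi_add_mul_xi_add_le (hP p hp).two_le (h p hp) N)
      (mul_self_nonneg _)
  · refine (le_abs_self _).trans ?_
    rw [abs_mul, abs_mul, mul_comm (2 : ℝ)]
    gcongr
    exact abs_sum_xi_add_mul_xi_add_le (hP p hp).two_le (hP q hq).two_le
      ((Nat.coprime_primes (hP p hp) (hP q hq)).2 hpq) i j N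

lemma sum_xiSum_add_sq_le {P : Finset ℕ} (hP : ∀ p ∈ P, p.Prime) (a : ℕ → ℝ) (i N : ℕ) :
    ∑ n ∈ Ioc 0 N, xiSum P a (n + i) ^ 2 ≤ N * sqWt P a + 2 * (∑ p ∈ P, |a p|) ^ 2 := by
  simp only [pow_two (xiSum P a _)]
  rw [sum_xiSum_mul_xiSum, pow_two, Finset.sum_mul_sum, sqWt, Finset.mul_sum, Finset.mul_sum,
    ← Finset.sum_add_distrib]
  refine Finset.sum_le_sum fun p hp => ?_
  rw [← Finset.add_sum_erase _ _ hp,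
    ← Finset.add_sum_erase P (fun j => |a p| * |a j|) hp, mul_add, ← add_assoc]
  refine add_le_add ?_ ?_
  · have := mul_le_mul_of_nonneg_left (sum_xi_add_sq_le (hP p hp).two_le i N)
      (mul_self_nonneg (a p))
    refine this.trans (le_of_eq ?_)
    rw [← abs_mul, abs_of_nonneg (mul_self_nonneg _)]
    ring
  · rw [Finset.mul_sum]
    refine Finset.sum_le_sum fun q hq => ?_
    refine (le_abs_self _).trans ?_
    rw [abs_mul, abs_mul, mul_comm (2 : ℝ)]
    gcongr
    exact abs_sum_xi_add_mul_xi_add_le (hP p hp).two_le (hP q (mem_of_mem_erase hq)).two_le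
      ((Nat.coprime_primes (hP p hp) (hP q (mem_of_mem_erase hq))).2 (ne_of_mem_erase hq).symm)
      i i N

lemma le_sum_xiSum_sq {P : Finset ℕ} (hP : ∀ p ∈ P, p.Prime) (a : ℕ → ℝ) (N : ℕ) :
    N / 2 * sqWt P a - 2 * (∑ p ∈ P, |a p|) ^ 2 ≤ ∑ n ∈ Ioc 0 N, xiSum P a n ^ 2 := by
  have e := sum_xiSum_mul_xiSum P P a a 0 0 N
  simp only [add_zero] at e
  simp only [pow_two (xiSum P a _)]
  rw [e, pow_two, Finset.sum_mul_sum, sqWt, Finset.mul_sum, Finset.mul_sum,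
    ← Finset.sum_sub_distrib]
  refine Finset.sum_le_sum fun p hp => ?_
  rw [← Finset.add_sum_erase P (fun q => a p * a q * _) hp,
    ← Finset.add_sum_erase P (fun j => |a p| * |a j|) hp, mul_add, ← sub_sub, sub_eq_add_neg]
  refine add_le_add ?_ ?_
  · have := mul_le_mul_of_nonneg_left (le_sum_xi_sq (hP p hp).two_le N)
      (mul_self_nonneg (a p))
    refine (le_of_eq ?_).trans this
    rw [← abs_mul, abs_of_nonneg (mul_self_nonneg _)]
    ring
  · rw [Finset.mul_sum, ← Finset.sum_neg_distrib]
    refine Finset.sum_le_sum fun q hq => ?_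
    refine neg_le_of_neg_le ((neg_le_abs _).trans ?_)
    rw [abs_mul, abs_mul, mul_comm (2 : ℝ)]
    gcongr
    have := abs_sum_xi_add_mul_xi_add_le (hP p hp).two_le (hP q (mem_of_mem_erase hq)).two_le
      ((Nat.coprime_primes (hP p hp) (hP q (mem_of_mem_erase hq))).2 (ne_of_mem_erase hq).symm)
      0 0 N
    simpa using this

lemma sum_Ioc_add_right (F : ℕ → ℝ) (j N : ℕ) :
    ∑ n ∈ Ioc 0 N, F (n + j) = ∑ n ∈ Ioc j (N + j), F n := by
  have := Finset.sum_map (Ioc 0 N) (addRightEmbedding j) F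
  rw [Finset.map_add_right_Ioc, zero_add] at this
  exact this.symm

lemma abs_sum_shift_sub_le {F : ℕ → ℝ} {C : ℝ} (hF : ∀ n, |F n| ≤ C) (j N : ℕ) :
    |∑ n ∈ Ioc 0 N, F (n + j) - ∑ n ∈ Ioc 0 N, F n| ≤ 2 * j * C := by
  induction j with
  | zero => simp
  | succ j ih =>
    have h : ∀ M, ∑ n ∈ Ioc 0 M, F (n + (j + 1)) - ∑ n ∈ Ioc 0 M, F (n + j)
        = F (M + j + 1) - F (j + 1) := by
      intro M
      induction M with
      | zero => simp
      | succ M ihM =>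
        rw [Finset.sum_Ioc_succ_top (Nat.zero_le M), Finset.sum_Ioc_succ_top (Nat.zero_le M)]
        have e1 : M + 1 + (j + 1) = M + 1 + j + 1 := by ring
        have e2 : M + 1 + j = M + j + 1 := by ring
        rw [e1, e2]
        linarith
    have h1 := abs_le.1 (hF (N + j + 1))
    have h2 := abs_le.1 (hF (j + 1))
    have h3 := h N
    rw [abs_le] at ih ⊢
    push_cast
    constructor <;> linarith [ih.1, ih.2, h1.1, h1.2, h2.1, h2.2]

lemma sum_abs_shift_sub_le {f : ℕ → ℝ} {V : ℝ} {j N : ℕ} (hj : j ≤ N)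
    (hvar : ∑ n ∈ Ioc 0 (2 * N), |f n - f (n - 1)| ≤ V) :
    ∑ n ∈ Ioc 0 N, |f (n + j) - f n| ≤ j * V := by
  induction j with
  | zero => simp
  | succ j ih =>
    have h1 : ∑ n ∈ Ioc 0 N, |f (n + (j + 1)) - f (n + j)| ≤ V := by
      refine le_trans ?_ hvar
      have := sum_Ioc_add_right (fun n => |f n - f (n - 1)|) (j + 1) N
      have e : ∀ n, n + (j + 1) - 1 = n + j := fun n => by omega
      simp only [e] at this
      rw [this]
      refine Finset.sum_le_sum_of_subset_of_nonneg ?_ fun _ _ _ => abs_nonneg _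
      intro n; simp only [mem_Ioc]; omega
    calc _ ≤ ∑ n ∈ Ioc 0 N, (|f (n + (j + 1)) - f (n + j)| + |f (n + j) - f n|) :=
          Finset.sum_le_sum fun n _ => abs_sub_le _ _ _
      _ ≤ V + j * V := by
          rw [Finset.sum_add_distrib]
          exact add_le_add h1 (ih (by omega))
      _ = _ := by push_cast; ring

lemma abs_mul_le_of_pos {t : ℝ} (ht : 0 < t) (x y : ℝ) :
    |x * y| ≤ x ^ 2 / (2 * t) + t / 2 * y ^ 2 := by
  have h : x ^ 2 / (2 * t) + t / 2 * y ^ 2 - |x| * |y| = (|x| - t * |y|) ^ 2 / (2 * t) := by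
    rw [← sq_abs x, ← sq_abs y]
    field_simp
    ring
  have : 0 ≤ (|x| - t * |y|) ^ 2 / (2 * t) := by positivity
  rw [abs_mul]
  linarith

/-- A bounded slowly varying function is nearly orthogonal to `xiSum P a`, in quantitative form. -/
lemma abs_sum_mul_xiSum_le {P : Finset ℕ} {N H : ℕ} {η ε : ℝ} {f a : ℕ → ℝ} (hε : 0 < ε)
    (hH : 0 < H) (hHN : 4 * (H : ℝ) * √(N : ℝ) ≤ N) (hHN' : H ≤ N)
    (hf : ∀ n, |f n| ≤ 1)
    (hvar : ∑ n ∈ Ioc 0 (2 * N), |f n - f (n - 1)| ≤ η * N)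
    (hP : ∀ p ∈ P, p.Prime) (hN : ∀ p ∈ P, p ^ 4 ≤ N) (hPH : ∀ p ∈ P, H < p)
    (ha : sqWt P a ≤ 1) :
    |∑ n ∈ Ioc 0 N, f n * xiSum P a n| ≤
      2 * H * √(N : ℝ) + (ε + H * η / ε + 2 / (ε * H)) * N := by
  have hH1 : (1 : ℝ) ≤ H := by exact_mod_cast hH
  have hN1 : (1 : ℝ) ≤ N := by exact_mod_cast hH.trans_le hHN'
  set S := √(N : ℝ) with hS
  have hS0 : 0 ≤ S := Real.sqrt_nonneg _
  have hSS : S * S = N := Real.mul_self_sqrt (by positivity)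
  have hS1 : 1 ≤ S := by nlinarith
  set A := (∑ p ∈ P, |a p|) with hA
  have hA0 : 0 ≤ A := Finset.sum_nonneg fun _ _ => abs_nonneg _
  have hA2 : A ^ 2 ≤ S := (sum_abs_sq_le hP hN a).trans (mul_le_of_le_one_right hS0 ha)
  have hAS : A ≤ S := by nlinarith
  have hη : 0 ≤ η * N := (Finset.sum_nonneg fun _ _ => abs_nonneg _).trans hvar
  have hF : ∀ n, |f n * xiSum P a n| ≤ S := by
    intro n
    rw [abs_mul]
    calc _ ≤ 1 * A := mul_le_mul (hf n) (abs_xiSum_le hP a n) (abs_nonneg _) zero_le_one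
      _ ≤ S := by linarith
  have hZ2 : ∀ j, ∑ n ∈ Ioc 0 N, xiSum P a (n + j) ^ 2 ≤ 3 / 2 * N := by
    intro j
    have h1 := sum_xiSum_add_sq_le hP a j N
    have h2 : (N : ℝ) * sqWt P a ≤ N := mul_le_of_le_one_right (by positivity) ha
    nlinarith
  set W : ℕ → ℝ := fun n => ∑ j ∈ range H, xiSum P a (n + j) with hW
  have hW2 : ∑ n ∈ Ioc 0 N, W n ^ 2 ≤ 2 * H * N := by
    have e : ∑ n ∈ Ioc 0 N, W n ^ 2 = ∑ i ∈ range H, ∑ j ∈ range H,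
        ∑ n ∈ Ioc 0 N, xiSum P a (n + i) * xiSum P a (n + j) := by
      simp only [hW, pow_two, Finset.sum_mul_sum]
      rw [Finset.sum_comm]
      exact Finset.sum_congr rfl fun i _ => Finset.sum_comm
    rw [e]
    have hrow : ∀ i ∈ range H, ∑ j ∈ range H,
        ∑ n ∈ Ioc 0 N, xiSum P a (n + i) * xiSum P a (n + j) ≤ 3 / 2 * N + H * (2 * S) := by
      intro i hi
      rw [← Finset.add_sum_erase _ _ hi]
      refine add_le_add ?_ ?_
      · simpa only [pow_two] using hZ2 i
      · calc _ ≤ ∑ j ∈ (range H).erase i, 2 * S := by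
              refine Finset.sum_le_sum fun j hj => ?_
              refine (sum_xiSum_add_mul_xiSum_add_le hP a ?_ N).trans (by linarith)
              intro p hp hmod
              have h1 := hPH p hp
              have h2 := mem_range.1 hi
              have h3 := mem_range.1 (mem_of_mem_erase hj)
              exact ne_of_mem_erase hj (hmod.symm.eq_of_lt_of_lt (by omega) (by omega))
          _ ≤ ∑ j ∈ range H, 2 * S := Finset.sum_le_sum_of_subset_of_nonneg
              (erase_subset _ _) fun _ _ _ => by positivity
          _ = _ := by simp
    calc _ ≤ ∑ i ∈ range H, (3 / 2 * (N : ℝ) + H * (2 * S)) := Finset.sum_le_sum hrow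
      _ = H * (3 / 2 * (N : ℝ) + H * (2 * S)) := by
          rw [Finset.sum_const, card_range, nsmul_eq_mul]
      _ ≤ H * (3 / 2 * (N : ℝ) + N / 2) := by gcongr; linarith
      _ = _ := by ring
  have hfW : |∑ n ∈ Ioc 0 N, f n * W n| ≤ H * (ε / 4 + 2 / (ε * H)) * N := by
    have ht : 0 < 2 / (ε * H) := by positivity
    calc _ ≤ ∑ n ∈ Ioc 0 N, |f n * W n| := Finset.abs_sum_le_sum_abs _ _
      _ ≤ ∑ n ∈ Ioc 0 N, (1 / (2 * (2 / (ε * H))) + (2 / (ε * H)) / 2 * W n ^ 2) := by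
          refine Finset.sum_le_sum fun n _ => (abs_mul_le_of_pos ht _ _).trans ?_
          gcongr
          rw [← sq_abs]
          exact pow_le_one₀ (abs_nonneg _) (hf n)
      _ = N * (1 / (2 * (2 / (ε * H)))) + (2 / (ε * H)) / 2 * ∑ n ∈ Ioc 0 N, W n ^ 2 := by
          rw [Finset.sum_add_distrib, ← Finset.mul_sum]; simp
      _ ≤ N * (1 / (2 * (2 / (ε * H)))) + (2 / (ε * H)) / 2 * (2 * H * N) := by gcongr
      _ = _ := by field_simp; ring
  have hj : ∀ j ∈ range H, |∑ n ∈ Ioc 0 N, f n * xiSum P a n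
      - ∑ n ∈ Ioc 0 N, f n * xiSum P a (n + j)| ≤ 2 * H * S + (3 / 4 * ε + H * η / ε) * N := by
    intro j hj
    have hjH : j < H := mem_range.1 hj
    have hjH' : (j : ℝ) ≤ H := by exact_mod_cast hjH.le
    have h1 := abs_sum_shift_sub_le hF j N
    have h2 := sum_abs_shift_sub_le (hjH.le.trans hHN') hvar
    have h3 : |∑ n ∈ Ioc 0 N, (f (n + j) - f n) * xiSum P a (n + j)| ≤
        (3 / 4 * ε + H * η / ε) * N := by
      calc _ ≤ ∑ n ∈ Ioc 0 N, |(f (n + j) - f n) * xiSum P a (n + j)| :=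
            Finset.abs_sum_le_sum_abs _ _
        _ ≤ ∑ n ∈ Ioc 0 N, (1 / ε * |f (n + j) - f n| + ε / 2 * xiSum P a (n + j) ^ 2) := by
            refine Finset.sum_le_sum fun n _ => (abs_mul_le_of_pos hε _ _).trans ?_
            gcongr
            have : |f (n + j) - f n| ≤ 2 := by
              refine (abs_sub _ _).trans ?_
              linarith [hf (n + j), hf n]
            rw [← sq_abs, div_le_iff₀ (by positivity)]
            field_simp
            nlinarith [abs_nonneg (f (n + j) - f n)]
        _ = 1 / ε * ∑ n ∈ Ioc 0 N, |f (n + j) - f n|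
              + ε / 2 * ∑ n ∈ Ioc 0 N, xiSum P a (n + j) ^ 2 := by
            rw [Finset.sum_add_distrib, ← Finset.mul_sum, ← Finset.mul_sum]
        _ ≤ 1 / ε * (H * (η * N)) + ε / 2 * (3 / 2 * N) := by
            gcongr
            · exact h2.trans (by gcongr)
            · exact hZ2 j
        _ = _ := by field_simp; ring
    have e : ∑ n ∈ Ioc 0 N, (f (n + j) - f n) * xiSum P a (n + j) =
        ∑ n ∈ Ioc 0 N, f (n + j) * xiSum P a (n + j)
        - ∑ n ∈ Ioc 0 N, f n * xiSum P a (n + j) := by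
      rw [← Finset.sum_sub_distrib]
      exact Finset.sum_congr rfl fun n _ => by ring
    rw [e] at h3
    have h4 : 2 * j * S ≤ 2 * H * S := by gcongr
    rw [abs_le] at h1 h3 ⊢
    constructor <;> linarith [h1.1, h1.2, h3.1, h3.2]
  have hsum : (H : ℝ) * ∑ n ∈ Ioc 0 N, f n * xiSum P a n = ∑ j ∈ range H,
      (∑ n ∈ Ioc 0 N, f n * xiSum P a n - ∑ n ∈ Ioc 0 N, f n * xiSum P a (n + j))
      + ∑ n ∈ Ioc 0 N, f n * W n := by
    simp only [hW, Finset.mul_sum]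
    rw [Finset.sum_sub_distrib, Finset.sum_comm (s := Ioc 0 N)]
    simp [Finset.mul_sum]
  have hfin : (H : ℝ) * |∑ n ∈ Ioc 0 N, f n * xiSum P a n| ≤
      H * (2 * H * S + (3 / 4 * ε + H * η / ε) * N) + H * (ε / 4 + 2 / (ε * H)) * N := by
    rw [← abs_of_nonneg (show (0 : ℝ) ≤ H by positivity), ← abs_mul, hsum,
      abs_of_nonneg (show (0 : ℝ) ≤ H by positivity)]
    refine (abs_add_le _ _).trans (add_le_add ?_ hfW)
    refine (Finset.abs_sum_le_sum_abs _ _).trans ((Finset.sum_le_sum hj).trans ?_)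
    rw [Finset.sum_const, card_range, nsmul_eq_mul]
  have : (H : ℝ) * |∑ n ∈ Ioc 0 N, f n * xiSum P a n| ≤
      H * (2 * H * S + (ε + H * η / ε + 2 / (ε * H)) * N) := by
    refine hfin.trans (le_of_eq ?_); ring
  exact le_of_mul_le_mul_left this (by positivity)

/-- The primes in the interval `(a, b]`. -/
def primesIn (a b : ℕ) : Finset ℕ := (Ioc a b).filter Nat.Prime

lemma card_filter_dvd_le_three {P : Finset ℕ} {N n : ℕ} (hP : ∀ p ∈ P, p.Prime)
    (hN : ∀ p ∈ P, N < p ^ 4) (hn : n ∈ Ioc 0 N) : (P.filter (· ∣ n)).card ≤ 3 := by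
  set S := P.filter (· ∣ n) with hS
  have hd : ∏ p ∈ S, p ∣ n := Finset.prod_primes_dvd n
    (fun p hp => (hP p (mem_of_mem_filter p hp)).prime) fun p hp => (mem_filter.1 hp).2
  have h1 : ∏ p ∈ S, p ≤ N := (Nat.le_of_dvd (mem_Ioc.1 hn).1 hd).trans (mem_Ioc.1 hn).2
  have h2 : (N + 1) ^ S.card ≤ ∏ p ∈ S, p ^ 4 := by
    rw [← Finset.prod_const]
    exact Finset.prod_le_prod' fun p hp => hN p (mem_of_mem_filter p hp)
  rw [Finset.prod_pow] at h2
  have hN1 : 1 ≤ N := (mem_Ioc.1 hn).1.trans_le (mem_Ioc.1 hn).2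
  have h3 : (N + 1) ^ S.card < (N + 1) ^ 4 :=
    lt_of_le_of_lt (h2.trans (Nat.pow_le_pow_left h1 4))
      (Nat.pow_lt_pow_left (Nat.lt_succ_self N) (by norm_num))
  have := (Nat.pow_lt_pow_iff_right (by omega)).1 h3
  omega

lemma sum_mul_divInd (P : Finset ℕ) (a : ℕ → ℝ) (n : ℕ) :
    ∑ p ∈ P, a p * divInd p n = ∑ p ∈ P.filter (· ∣ n), a p := by
  rw [Finset.sum_filter]
  exact Finset.sum_congr rfl fun p _ => by unfold divInd; split_ifs <;> simp

lemma xiSum_eq (P : Finset ℕ) (a : ℕ → ℝ) (n : ℕ) :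
    xiSum P a n = ∑ p ∈ P, a p * divInd p n - ∑ p ∈ P, a p / p := by
  rw [← Finset.sum_sub_distrib]
  exact Finset.sum_congr rfl fun p _ => by unfold xi; ring

lemma sum_divInd_le (d N : ℕ) : ∑ n ∈ Ioc 0 N, divInd d n ≤ (N : ℝ) / d := by
  rw [sum_divInd]
  exact Nat.cast_div_le

lemma sum_inv_le_six {P : Finset ℕ} {N : ℕ} (hP : ∀ p ∈ P, p.Prime)
    (hN : ∀ p ∈ P, N < p ^ 4) (hPN : ∀ p ∈ P, p ≤ N) : ∑ p ∈ P, 1 / (p : ℝ) ≤ 6 := by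
  rcases Nat.eq_zero_or_pos N with h0 | h0
  · have : P = ∅ := by
      rw [Finset.eq_empty_iff_forall_notMem]
      intro p hp
      have := hPN p hp
      have := (hP p hp).pos
      omega
    simp [this]
  have h1 : ∑ p ∈ P, ∑ n ∈ Ioc 0 N, divInd p n ≤ 3 * N := by
    rw [Finset.sum_comm]
    calc _ ≤ ∑ n ∈ Ioc 0 N, (3 : ℝ) := by
          refine Finset.sum_le_sum fun n hn => ?_
          have := sum_mul_divInd P (fun _ => 1) n
          simp only [one_mul] at this
          rw [this]
          simpa using card_filter_dvd_le_three hP hN hn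
      _ = _ := by simp; ring
  have h2 : ∑ p ∈ P, (N : ℝ) / (2 * p) ≤ 3 * N := by
    refine le_trans (Finset.sum_le_sum fun p hp => ?_) h1
    rw [sum_divInd]
    have hp0 : (0 : ℝ) < p := by exact_mod_cast (hP p hp).pos
    have ha : 1 ≤ N / p := Nat.div_pos (hPN p hp) (hP p hp).pos
    have hb : N < p * (N / p + 1) := Nat.lt_mul_div_succ N (hP p hp).pos
    have ha' : (1 : ℝ) ≤ (N / p : ℕ) := by exact_mod_cast ha
    have hb' : (N : ℝ) < p * ((N / p : ℕ) + 1) := by exact_mod_cast hb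
    rw [div_le_iff₀ (by positivity)]
    nlinarith
  have hN0 : (0 : ℝ) < N := by exact_mod_cast h0
  have h3 : ∑ p ∈ P, (N : ℝ) / (2 * p) = N / 2 * ∑ p ∈ P, 1 / (p : ℝ) := by
    rw [Finset.mul_sum]
    exact Finset.sum_congr rfl fun p _ => by ring
  rw [h3] at h2
  nlinarith

lemma sum_div_sq_le (P : Finset ℕ) (a : ℕ → ℝ) :
    (∑ p ∈ P, a p / p) ^ 2 ≤ sqWt P a * ∑ p ∈ P, 1 / (p : ℝ) := by
  apply Finset.sum_sq_le_sum_mul_sum_of_sq_le_mul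
  · intro p _; positivity
  · intro p _; positivity
  · intro p _
    apply le_of_eq; ring

/-- A Turán–Kubilius inequality for primes up to `N`. -/
lemma sum_xiSum_sq_le {P : Finset ℕ} {N : ℕ} (hP : ∀ p ∈ P, p.Prime) (hPN : ∀ p ∈ P, p ≤ N)
    (a : ℕ → ℝ) : ∑ n ∈ Ioc 0 N, xiSum P a n ^ 2 ≤ 36 * N * sqWt P a := by
  set Q := P.filter (fun p => p ^ 4 ≤ N) with hQ
  set R := P.filter (fun p => ¬ p ^ 4 ≤ N) with hR
  have hsplit : ∀ F : ℕ → ℝ, ∑ p ∈ P, F p = ∑ p ∈ Q, F p + ∑ p ∈ R, F p := fun F =>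
    (Finset.sum_filter_add_sum_filter_not P _ F).symm
  have hQP : ∀ p ∈ Q, p.Prime := fun p hp => hP p (mem_of_mem_filter p hp)
  have hRP : ∀ p ∈ R, p.Prime := fun p hp => hP p (mem_of_mem_filter p hp)
  have hR4 : ∀ p ∈ R, N < p ^ 4 := fun p hp => not_le.1 (mem_filter.1 hp).2
  have hRN : ∀ p ∈ R, p ≤ N := fun p hp => hPN p (mem_of_mem_filter p hp)
  have hwt : sqWt P a = sqWt Q a + sqWt R a := hsplit _
  have h1 : ∑ n ∈ Ioc 0 N, xiSum Q a n ^ 2 ≤ 3 * N * sqWt Q a := by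
    have h := sum_xiSum_add_sq_le hQP a 0 N
    have h' := sum_abs_sq_le hQP (fun p hp => (mem_filter.1 hp).2) a (N := N)
    simp only [add_zero] at h
    have hs : √(N : ℝ) ≤ N := by
      rcases Nat.eq_zero_or_pos N with h0 | h0
      · simp [h0]
      · rw [Real.sqrt_le_left (by positivity)]
        have : (1 : ℝ) ≤ N := by exact_mod_cast h0
        nlinarith
    have := mul_le_mul_of_nonneg_right hs (sqWt_nonneg Q a)
    linarith
  have h2 : ∑ n ∈ Ioc 0 N, (∑ p ∈ R, a p * divInd p n) ^ 2 ≤ 3 * N * sqWt R a := by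
    calc _ ≤ ∑ n ∈ Ioc 0 N, 3 * ∑ p ∈ R, a p ^ 2 * divInd p n := by
          refine Finset.sum_le_sum fun n hn => ?_
          rw [sum_mul_divInd, sum_mul_divInd R (fun p => a p ^ 2)]
          refine (sq_sum_le_card_mul_sum_sq).trans ?_
          gcongr
          exact_mod_cast card_filter_dvd_le_three hRP hR4 hn
      _ = 3 * ∑ p ∈ R, a p ^ 2 * ∑ n ∈ Ioc 0 N, divInd p n := by
          rw [← Finset.mul_sum, Finset.sum_comm]
          simp only [Finset.mul_sum]
      _ ≤ 3 * ∑ p ∈ R, a p ^ 2 * ((N : ℝ) / p) := by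
          gcongr with p hp
          exact sum_divInd_le p N
      _ = _ := by
          rw [sqWt, Finset.mul_sum, Finset.mul_sum]
          exact Finset.sum_congr rfl fun p _ => by ring
  have h3 : (∑ p ∈ R, a p / p) ^ 2 ≤ 6 * sqWt R a := by
    refine (sum_div_sq_le R a).trans ?_
    rw [mul_comm]
    exact mul_le_mul_of_nonneg_right (sum_inv_le_six hRP hR4 hRN) (sqWt_nonneg R a)
  have hpt : ∀ n, xiSum P a n ^ 2 ≤ 3 * xiSum Q a n ^ 2 + 3 * (∑ p ∈ R, a p * divInd p n) ^ 2
      + 3 * (∑ p ∈ R, a p / p) ^ 2 := by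
    intro n
    have : xiSum P a n = xiSum Q a n + (∑ p ∈ R, a p * divInd p n - ∑ p ∈ R, a p / p) := by
      rw [← xiSum_eq]; exact hsplit _
    rw [this]
    nlinarith [sq_nonneg (xiSum Q a n - ∑ p ∈ R, a p * divInd p n),
      sq_nonneg (xiSum Q a n + ∑ p ∈ R, a p / p),
      sq_nonneg (∑ p ∈ R, a p * divInd p n + ∑ p ∈ R, a p / p)]
  calc _ ≤ ∑ n ∈ Ioc 0 N, (3 * xiSum Q a n ^ 2 + 3 * (∑ p ∈ R, a p * divInd p n) ^ 2
      + 3 * (∑ p ∈ R, a p / p) ^ 2) := Finset.sum_le_sum fun n _ => hpt n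
    _ = 3 * ∑ n ∈ Ioc 0 N, xiSum Q a n ^ 2
        + 3 * ∑ n ∈ Ioc 0 N, (∑ p ∈ R, a p * divInd p n) ^ 2
        + N * (3 * (∑ p ∈ R, a p / p) ^ 2) := by
      rw [Finset.sum_add_distrib, Finset.sum_add_distrib, ← Finset.mul_sum, ← Finset.mul_sum]
      simp
    _ ≤ 3 * (3 * N * sqWt Q a) + 3 * (3 * N * sqWt R a) + N * (3 * (6 * sqWt R a)) := by
      gcongr
    _ ≤ _ := by
      rw [hwt]
      have := mul_nonneg (Nat.cast_nonneg (α := ℝ) N) (sqWt_nonneg Q a)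
      have := mul_nonneg (Nat.cast_nonneg (α := ℝ) N) (sqWt_nonneg R a)
      linarith

lemma abs_sum_xi_mul_divInd_le {p d : ℕ} (hp : p.Prime) (hd : p.Coprime d) (N : ℕ) :
    |∑ n ∈ Ioc 0 N, xi p n * divInd d n| ≤ 1 := by
  have e : ∑ n ∈ Ioc 0 N, xi p n * divInd d n = ((N / d / p : ℕ) : ℝ) - ((N / d : ℕ) : ℝ) / p := by
    rw [Nat.div_div_eq_div_mul, ← sum_divInd, ← sum_divInd, Finset.sum_div,
      ← Finset.sum_sub_distrib]
    refine Finset.sum_congr rfl fun n _ => ?_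
    rw [← hd.symm.lcm_eq_mul, ← divInd_mul, xi]
    ring
  have hp0 : (0 : ℝ) < p := by exact_mod_cast hp.pos
  have h1 : ((N / d / p : ℕ) : ℝ) ≤ ((N / d : ℕ) : ℝ) / p := Nat.cast_div_le
  have h2 : N / d < p * (N / d / p + 1) := Nat.lt_mul_div_succ _ hp.pos
  have h2' : ((N / d : ℕ) : ℝ) < p * (((N / d / p : ℕ) : ℝ) + 1) := by exact_mod_cast h2
  have h3 : ((N / d : ℕ) : ℝ) / p ≤ ((N / d / p : ℕ) : ℝ) + 1 := by
    rw [div_le_iff₀ hp0]; linarith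
  rw [e, abs_le]
  constructor <;> linarith

lemma abs_sum_xi_mul_divInd_mul_xi_mul_le {p q N : ℕ} {C : ℝ} {h : ℕ → ℝ} (hp : p.Prime)
    (hq : q.Prime) (hpq : p ≠ q)
    (hC : ∀ d, p.Coprime d → |∑ n ∈ Ioc 0 N, xi p n * (divInd d n * h n)| ≤ C)
    {d : ℕ} (hd : p.Coprime d) :
    |∑ n ∈ Ioc 0 N, xi p n * (divInd d n * (xi q n * h n))| ≤ 2 * C := by
  have e : ∑ n ∈ Ioc 0 N, xi p n * (divInd d n * (xi q n * h n)) =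
      ∑ n ∈ Ioc 0 N, xi p n * (divInd (d.lcm q) n * h n)
      - 1 / (q : ℝ) * ∑ n ∈ Ioc 0 N, xi p n * (divInd d n * h n) := by
    rw [Finset.mul_sum, ← Finset.sum_sub_distrib]
    refine Finset.sum_congr rfl fun n _ => ?_
    rw [← divInd_mul]
    simp only [xi]
    ring
  have h1 := hC (d.lcm q) (Nat.Coprime.coprime_dvd_right (Nat.lcm_dvd_mul d q)
    (hd.mul_right ((Nat.coprime_primes hp hq).2 hpq)))
  have h2 := hC d hd
  have hq1 : 1 / (q : ℝ) ≤ 1 := by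
    rw [div_le_one (by exact_mod_cast hq.pos)]
    exact_mod_cast hq.one_le
  rw [e]
  refine (abs_sub _ _).trans ?_
  rw [abs_mul, abs_of_nonneg (show 0 ≤ 1 / (q : ℝ) by positivity)]
  have := mul_le_mul hq1 h2 (abs_nonneg _) zero_le_one
  linarith

lemma abs_sum_xi_mul_xi_mul_xi_mul_xi_le {p q r s : ℕ} (hp : p.Prime) (hq : q.Prime)
    (hr : r.Prime) (hs : s.Prime) (hpq : p ≠ q) (hpr : p ≠ r) (hps : p ≠ s) (N : ℕ) :
    |∑ n ∈ Ioc 0 N, xi p n * (xi q n * (xi r n * xi s n))| ≤ 8 := by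
  have h0 : ∀ d, p.Coprime d → |∑ n ∈ Ioc 0 N, xi p n * (divInd d n * 1)| ≤ 1 := by
    intro d hd
    simpa using abs_sum_xi_mul_divInd_le hp hd N
  have h1 := fun d hd => abs_sum_xi_mul_divInd_mul_xi_mul_le (d := d) hp hs hps h0 hd
  have h2 := fun d hd => abs_sum_xi_mul_divInd_mul_xi_mul_le (d := d) hp hr hpr h1 hd
  have h3 := abs_sum_xi_mul_divInd_mul_xi_mul_le hp hq hpq h2 (Nat.coprime_one_right p)
  have hone : ∀ n, divInd 1 n = 1 := fun n => by simp [divInd]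
  simp only [hone, one_mul, mul_one] at h3
  linarith

lemma xi_sq_le (p n : ℕ) : xi p n ^ 2 ≤ divInd p n + 1 / (p : ℝ) ^ 2 := by
  have h := divInd_mul_self p n
  have h1 := divInd_nonneg p n
  have : xi p n ^ 2 = divInd p n * divInd p n + 1 / (p : ℝ) ^ 2 - 2 * divInd p n * (1 / p) := by
    unfold xi; ring
  have h2 : 0 ≤ 2 * divInd p n * (1 / p) := by positivity
  rw [this, h]; linarith

lemma one_div_sq_le {p : ℕ} (hp : p.Prime) : 1 / (p : ℝ) ^ 2 ≤ 1 / p := by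
  have : (1 : ℝ) ≤ p := by exact_mod_cast hp.one_le
  apply one_div_le_one_div_of_le (by linarith)
  nlinarith

lemma sum_xi_sq_mul_xi_sq_le {p q : ℕ} (hp : p.Prime) (hq : q.Prime) (h : p ≠ q) (N : ℕ) :
    ∑ n ∈ Ioc 0 N, xi p n ^ 2 * xi q n ^ 2 ≤ 4 * N / (p * q) := by
  have hp0 : (0 : ℝ) < p := by exact_mod_cast hp.pos
  have hq0 : (0 : ℝ) < q := by exact_mod_cast hq.pos
  have hp2 := one_div_sq_le hp
  have hq2 := one_div_sq_le hq
  have h1 : ∀ n, xi p n ^ 2 * xi q n ^ 2 ≤ divInd (p * q) n + 1 / (q : ℝ) * divInd p n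
      + 1 / (p : ℝ) * divInd q n + 1 / p * (1 / q) := by
    intro n
    have a1 := divInd_nonneg p n
    have a2 := divInd_nonneg q n
    calc _ ≤ (divInd p n + 1 / (p : ℝ)) * (divInd q n + 1 / (q : ℝ)) := by
          gcongr
          · exact (xi_sq_le p n).trans (by linarith)
          · exact (xi_sq_le q n).trans (by linarith)
      _ = _ := by
          rw [← ((Nat.coprime_primes hp hq).2 h).lcm_eq_mul, ← divInd_mul]; ring
  calc _ ≤ _ := Finset.sum_le_sum fun n _ => h1 n
    _ = ∑ n ∈ Ioc 0 N, divInd (p * q) n + 1 / (q : ℝ) * ∑ n ∈ Ioc 0 N, divInd p n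
        + 1 / (p : ℝ) * ∑ n ∈ Ioc 0 N, divInd q n + N * (1 / p * (1 / q)) := by
      simp only [Finset.sum_add_distrib, ← Finset.mul_sum]
      simp
      ring
    _ ≤ (N : ℝ) / (p * q : ℕ) + 1 / (q : ℝ) * (N / p) + 1 / (p : ℝ) * (N / q)
        + N * (1 / p * (1 / q)) := by
      gcongr <;> exact sum_divInd_le _ _
    _ = _ := by push_cast; ring

lemma sum_xi_pow_four_le {p : ℕ} (hp : p.Prime) (N : ℕ) :
    ∑ n ∈ Ioc 0 N, xi p n ^ 2 * xi p n ^ 2 ≤ 2 * N / p := by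
  have hp0 : (0 : ℝ) < p := by exact_mod_cast hp.pos
  calc _ ≤ ∑ n ∈ Ioc 0 N, (divInd p n + 1 / (p : ℝ)) := by
        refine Finset.sum_le_sum fun n _ => ?_
        have h1 : xi p n ^ 2 ≤ 1 := by
          rw [← sq_abs]; exact pow_le_one₀ (abs_nonneg _) (abs_xi_le_one hp.ne_zero n)
        have h2 := (xi_sq_le p n).trans (add_le_add_right (one_div_sq_le hp) _)
        nlinarith [sq_nonneg (xi p n)]
    _ ≤ (N : ℝ) / p + N * (1 / p) := by
        rw [Finset.sum_add_distrib]
        refine add_le_add (sum_divInd_le p N) ?_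
        simp
    _ = _ := by ring

/-- A fourth moment bound for `xiSum`. -/
lemma sum_xiSum_pow_four_le {P : Finset ℕ} {N : ℕ} {a : ℕ → ℝ} {M : ℝ}
    (hP : ∀ p ∈ P, p.Prime) (hN : ∀ p ∈ P, p ^ 4 ≤ N) (hM : ∀ p ∈ P, |a p| ≤ M)
    (ha : sqWt P a ≤ 1) :
    ∑ n ∈ Ioc 0 N, xiSum P a n ^ 4 ≤ (20 + 6 * M ^ 2) * N := by
  set S : ℕ → ℕ → ℕ → ℕ → ℝ := fun p q r s =>
    ∑ n ∈ Ioc 0 N, xi p n * (xi q n * (xi r n * xi s n)) with hS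
  set T : ℕ → ℕ → ℝ := fun p q => ∑ n ∈ Ioc 0 N, xi p n ^ 2 * xi q n ^ 2 with hT
  have hT0 : ∀ p q, 0 ≤ T p q := fun p q => Finset.sum_nonneg fun n _ => by positivity
  set w : ℕ → ℕ → ℝ := fun p q => a p ^ 2 * a q ^ 2 * T p q with hw
  have hw0 : ∀ p q, 0 ≤ w p q := fun p q => mul_nonneg (by positivity) (hT0 p q)
  have hexp : ∑ n ∈ Ioc 0 N, xiSum P a n ^ 4 =
      ∑ p ∈ P, ∑ q ∈ P, ∑ r ∈ P, ∑ s ∈ P, a p * (a q * (a r * a s)) * S p q r s := by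
    have : ∀ n, xiSum P a n ^ 4 = ∑ p ∈ P, ∑ q ∈ P, ∑ r ∈ P, ∑ s ∈ P,
        a p * (a q * (a r * a s)) * (xi p n * (xi q n * (xi r n * xi s n))) := by
      intro n
      have : xiSum P a n ^ 4 = xiSum P a n * (xiSum P a n * (xiSum P a n * xiSum P a n)) := by
        ring
      rw [this]
      simp only [xiSum, Finset.sum_mul, Finset.mul_sum]
      refine Finset.sum_congr rfl fun p _ => Finset.sum_congr rfl fun q _ =>
        Finset.sum_congr rfl fun r _ => Finset.sum_congr rfl fun s _ => by ring
    simp only [this]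
    rw [Finset.sum_comm]
    refine Finset.sum_congr rfl fun p _ => ?_
    rw [Finset.sum_comm]
    refine Finset.sum_congr rfl fun q _ => ?_
    rw [Finset.sum_comm]
    refine Finset.sum_congr rfl fun r _ => ?_
    rw [Finset.sum_comm]
    refine Finset.sum_congr rfl fun s _ => ?_
    rw [Finset.mul_sum]
  have hterm : ∀ p ∈ P, ∀ q ∈ P, ∀ r ∈ P, ∀ s ∈ P, a p * (a q * (a r * a s)) * S p q r s ≤
      8 * (|a p| * (|a q| * (|a r| * |a s|))) + (if p = q ∧ r = s then w p r else 0)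
        + (if p = r ∧ q = s then w p q else 0) + (if p = s ∧ q = r then w p q else 0) := by
    intro p hp q hq r hr s hs
    have hb : 0 ≤ 8 * (|a p| * (|a q| * (|a r| * |a s|))) := by positivity
    have i1 : 0 ≤ (if p = q ∧ r = s then w p r else 0) := by split_ifs <;> simp [hw0]
    have i2 : 0 ≤ (if p = r ∧ q = s then w p q else 0) := by split_ifs <;> simp [hw0]
    have i3 : 0 ≤ (if p = s ∧ q = r then w p q else 0) := by split_ifs <;> simp [hw0]
    have hsmall : |S p q r s| ≤ 8 → a p * (a q * (a r * a s)) * S p q r s ≤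
        8 * (|a p| * (|a q| * (|a r| * |a s|))) := by
      intro h
      refine (le_abs_self _).trans ?_
      rw [abs_mul, abs_mul, abs_mul, abs_mul, mul_comm (8 : ℝ)]
      gcongr
    have hA := hP p hp
    have hB := hP q hq
    have hC := hP r hr
    have hD := hP s hs
    by_cases h1 : p ≠ q ∧ p ≠ r ∧ p ≠ s
    · have := hsmall (abs_sum_xi_mul_xi_mul_xi_mul_xi_le hA hB hC hD h1.1 h1.2.1 h1.2.2 N)
      linarith
    by_cases h2 : q ≠ p ∧ q ≠ r ∧ q ≠ s
    · have := abs_sum_xi_mul_xi_mul_xi_mul_xi_le hB hA hC hD h2.1 h2.2.1 h2.2.2 N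
      have := hsmall (le_of_eq_of_le (by
        congr 1; exact Finset.sum_congr rfl fun n _ => by ring) this)
      linarith
    by_cases h3 : r ≠ p ∧ r ≠ q ∧ r ≠ s
    · have := abs_sum_xi_mul_xi_mul_xi_mul_xi_le hC hA hB hD h3.1 h3.2.1 h3.2.2 N
      have := hsmall (le_of_eq_of_le (by
        congr 1; exact Finset.sum_congr rfl fun n _ => by ring) this)
      linarith
    by_cases h4 : s ≠ p ∧ s ≠ q ∧ s ≠ r
    · have := abs_sum_xi_mul_xi_mul_xi_mul_xi_le hD hA hB hC h4.1 h4.2.1 h4.2.2 N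
      have := hsmall (le_of_eq_of_le (by
        congr 1; exact Finset.sum_congr rfl fun n _ => by ring) this)
      linarith
    have hpair : (p = q ∧ r = s) ∨ (p = r ∧ q = s) ∨ (p = s ∧ q = r) := by grind
    rcases hpair with ⟨rfl, rfl⟩ | ⟨rfl, rfl⟩ | ⟨rfl, rfl⟩
    · have e : a p * (a p * (a r * a r)) * S p p r r = w p r := by
        simp only [hS, hw, hT, Finset.mul_sum]
        exact Finset.sum_congr rfl fun n _ => by ring
      rw [e]
      rw [if_pos (⟨rfl, rfl⟩ : p = p ∧ r = r)]
      linarith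
    · have e : a p * (a q * (a p * a q)) * S p q p q = w p q := by
        simp only [hS, hw, hT, Finset.mul_sum]
        exact Finset.sum_congr rfl fun n _ => by ring
      rw [e]
      rw [if_pos (⟨rfl, rfl⟩ : p = p ∧ q = q)]
      linarith
    · have e : a p * (a q * (a q * a p)) * S p q q p = w p q := by
        simp only [hS, hw, hT, Finset.mul_sum]
        exact Finset.sum_congr rfl fun n _ => by ring
      rw [e]
      rw [if_pos (⟨rfl, rfl⟩ : p = p ∧ q = q)]
      linarith
  have hN0 : (0 : ℝ) ≤ N := Nat.cast_nonneg N
  have hwsum : ∑ p ∈ P, ∑ q ∈ P, w p q ≤ (4 + 2 * M ^ 2) * N := by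
    have hbd : ∀ p ∈ P, ∀ q ∈ P, w p q ≤ 4 * N * (a p ^ 2 / p * (a q ^ 2 / q))
        + if p = q then 2 * N * M ^ 2 * (a p ^ 2 / p) else 0 := by
      intro p hp q hq
      have hp0 : (0 : ℝ) < p := by exact_mod_cast (hP p hp).pos
      have hq0 : (0 : ℝ) < q := by exact_mod_cast (hP q hq).pos
      split_ifs with h
      · subst h
        have h1 := sum_xi_pow_four_le (hP p hp) N
        have h2 : a p ^ 2 ≤ M ^ 2 := by
          rw [← sq_abs]; exact pow_le_pow_left₀ (abs_nonneg _) (hM p hp) 2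
        have h3 : w p p ≤ M ^ 2 * a p ^ 2 * (2 * N / p) := by
          simp only [hw]
          gcongr
        have h4 : 0 ≤ 4 * N * (a p ^ 2 / p * (a p ^ 2 / p)) := by positivity
        have h5 : M ^ 2 * a p ^ 2 * (2 * N / p) = 2 * N * M ^ 2 * (a p ^ 2 / p) := by ring
        linarith
      · have h1 := sum_xi_sq_mul_xi_sq_le (hP p hp) (hP q hq) h N
        have h3 : w p q ≤ a p ^ 2 * a q ^ 2 * (4 * N / (p * q)) := by
          simp only [hw]
          gcongr
        have h5 : a p ^ 2 * a q ^ 2 * (4 * N / (p * q)) =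
            4 * N * (a p ^ 2 / p * (a q ^ 2 / q)) := by field_simp
        linarith
    calc _ ≤ _ := Finset.sum_le_sum fun p hp => Finset.sum_le_sum (hbd p hp)
      _ = 4 * N * (sqWt P a * sqWt P a) + 2 * N * M ^ 2 * sqWt P a := by
        simp only [Finset.sum_add_distrib, ← Finset.mul_sum, sqWt, Finset.sum_mul_sum,
          Finset.sum_ite_eq]
        rw [Finset.mul_sum (a := 2 * (N : ℝ) * M ^ 2)]
        congr 1
        exact Finset.sum_congr rfl fun p hp => by simp [hp]
      _ ≤ 4 * N * (1 * 1) + 2 * N * M ^ 2 * 1 := by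
        have := sqWt_nonneg P a
        gcongr
      _ = _ := by ring
  have hone : (∑ p ∈ P, |a p|) ^ 4 ≤ N := by
    have h := sum_abs_sq_le hP hN a
    have h' : (∑ p ∈ P, |a p|) ^ 2 ≤ √(N : ℝ) :=
      h.trans (mul_le_of_le_one_right (Real.sqrt_nonneg _) ha)
    calc _ = ((∑ p ∈ P, |a p|) ^ 2) ^ 2 := by ring
      _ ≤ √(N : ℝ) ^ 2 := by gcongr
      _ = N := Real.sq_sqrt hN0
  rw [hexp]
  calc _ ≤ _ := Finset.sum_le_sum fun p hp => Finset.sum_le_sum fun q hq =>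
        Finset.sum_le_sum fun r hr => Finset.sum_le_sum fun s hs => hterm p hp q hq r hr s hs
    _ = 8 * (∑ p ∈ P, |a p|) ^ 4 + 3 * ∑ p ∈ P, ∑ q ∈ P, w p q := by
      simp only [Finset.sum_add_distrib, ← Finset.mul_sum]
      have e1 : ∑ p ∈ P, ∑ q ∈ P, ∑ r ∈ P, ∑ s ∈ P, (if p = q ∧ r = s then w p r else 0)
          = ∑ p ∈ P, ∑ q ∈ P, w p q := by
        refine Finset.sum_congr rfl fun p hp => ?_
        rw [Finset.sum_comm]
        refine Finset.sum_congr rfl fun r hr => ?_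
        rw [Finset.sum_eq_single_of_mem p hp (by intro b _ hb; simp [hb.symm]),
          Finset.sum_eq_single_of_mem r hr (by intro b _ hb; simp [hb.symm])]
        simp
      have e2 : ∑ p ∈ P, ∑ q ∈ P, ∑ r ∈ P, ∑ s ∈ P, (if p = r ∧ q = s then w p q else 0)
          = ∑ p ∈ P, ∑ q ∈ P, w p q := by
        refine Finset.sum_congr rfl fun p hp => Finset.sum_congr rfl fun q hq => ?_
        rw [Finset.sum_eq_single_of_mem p hp (by intro b _ hb; simp [hb.symm]),
          Finset.sum_eq_single_of_mem q hq (by intro b _ hb; simp [hb.symm])]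
        simp
      have e3 : ∑ p ∈ P, ∑ q ∈ P, ∑ r ∈ P, ∑ s ∈ P, (if p = s ∧ q = r then w p q else 0)
          = ∑ p ∈ P, ∑ q ∈ P, w p q := by
        refine Finset.sum_congr rfl fun p hp => Finset.sum_congr rfl fun q hq => ?_
        rw [Finset.sum_eq_single_of_mem q hq (by intro b _ hb; simp [hb.symm]),
          Finset.sum_eq_single_of_mem p hp (by intro b _ hb; simp [hb.symm])]
        simp
      rw [e1, e2, e3]
      have e4 : ∑ p ∈ P, |a p| * ∑ q ∈ P, |a q| * ∑ r ∈ P, |a r| * ∑ s ∈ P, |a s|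
          = (∑ p ∈ P, |a p|) ^ 4 := by
        simp only [← Finset.sum_mul]
        ring
      rw [e4]
      ring
    _ ≤ 8 * N + 3 * ((4 + 2 * M ^ 2) * N) := by gcongr
    _ = _ := by ring

lemma mem_primesIn {a b p : ℕ} : p ∈ primesIn a b ↔ (a < p ∧ p ≤ b) ∧ p.Prime := by
  simp [primesIn]

lemma primesIn_subset {a b c d : ℕ} (h1 : c ≤ a) (h2 : b ≤ d) : primesIn a b ⊆ primesIn c d := by
  intro p
  simp only [mem_primesIn]
  exact fun h => ⟨⟨h1.trans_lt h.1.1, h.1.2.trans h2⟩, h.2⟩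

lemma sum_primesIn_add {a b c : ℕ} (h1 : a ≤ b) (h2 : b ≤ c) (F : ℕ → ℝ) :
    ∑ p ∈ primesIn a b, F p + ∑ p ∈ primesIn b c, F p = ∑ p ∈ primesIn a c, F p := by
  rw [← Finset.sum_union]
  · refine Finset.sum_congr ?_ fun _ _ => rfl
    ext p
    simp only [mem_union, mem_primesIn]
    by_cases hp : p.Prime <;> simp only [hp, and_true, and_false, or_self]
    omega
  · rw [Finset.disjoint_left]
    intro p h1 h2
    have := (mem_primesIn.1 h1).1.2
    have := (mem_primesIn.1 h2).1.1
    omega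

lemma log_factorial_eq_sum (N : ℕ) :
    Real.log (N.factorial : ℝ) =
      ∑ p ∈ primesIn 0 N, (padicValNat p N.factorial : ℝ) * Real.log p := by
  rw [Real.log_nat_eq_sum_factorization, Finsupp.sum_of_support_subset (s := primesIn 0 N)]
  · refine Finset.sum_congr rfl fun p hp => ?_
    rw [Nat.factorization_def _ (mem_primesIn.1 hp).2]
  · intro p hp
    rw [Nat.support_factorization, Nat.mem_primeFactors] at hp
    exact mem_primesIn.2 ⟨⟨hp.1.pos, (hp.1.dvd_factorial).1 hp.2.1⟩, hp.1⟩
  · intro p _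
    simp

lemma sum_log_div_le {N : ℕ} (hN : 1 ≤ N) :
    ∑ p ∈ primesIn 0 N, Real.log p / p ≤ Real.log N + Real.log 4 := by
  have hN0 : (0 : ℝ) < N := by exact_mod_cast hN
  have h1 : Real.log (N.factorial : ℝ) ≤ N * Real.log N := by
    rw [← Real.log_pow]
    apply Real.log_le_log (by exact_mod_cast N.factorial_pos)
    exact_mod_cast N.factorial_le_pow
  have h2 : ∑ p ∈ primesIn 0 N, Real.log p ≤ Real.log 4 * N := by
    have h := Chebyshev.theta_le_log4_mul_x hN0.le
    rw [Chebyshev.theta_eq_sum_Icc, Nat.floor_natCast] at h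
    refine le_trans (Finset.sum_le_sum_of_subset_of_nonneg ?_ ?_) h
    · intro p hp
      have := mem_primesIn.1 hp
      simp [this.2, this.1.2]
    · intro p hp _
      exact Real.log_natCast_nonneg p
  have h3 : ∑ p ∈ primesIn 0 N, ((N : ℝ) * (Real.log p / p) - Real.log p) ≤
      Real.log (N.factorial : ℝ) := by
    rw [log_factorial_eq_sum]
    refine Finset.sum_le_sum fun p hp => ?_
    have hpp := (mem_primesIn.1 hp).2
    have := Fact.mk hpp
    have hp0 : (0 : ℝ) < p := by exact_mod_cast hpp.pos
    have hv : N / p ≤ padicValNat p N.factorial := by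
      rw [padicValNat_factorial (b := Nat.log p N + 2) (by omega)]
      have := Finset.single_le_sum (f := fun i => N / p ^ i) (s := Ico 1 (Nat.log p N + 2))
        (fun _ _ => Nat.zero_le _) (a := 1) (by simp)
      simpa using this
    have hv' : ((N / p : ℕ) : ℝ) ≤ padicValNat p N.factorial := by exact_mod_cast hv
    have hlt : N < p * (N / p + 1) := Nat.lt_mul_div_succ N hpp.pos
    have hlt' : (N : ℝ) < p * ((N / p : ℕ) + 1) := by exact_mod_cast hlt
    have hdiv : (N : ℝ) / p - 1 ≤ padicValNat p N.factorial := by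
      have : (N : ℝ) / p ≤ (N / p : ℕ) + 1 := by rw [div_le_iff₀ hp0]; linarith
      linarith
    calc _ = ((N : ℝ) / p - 1) * Real.log p := by ring
      _ ≤ _ := mul_le_mul_of_nonneg_right hdiv (Real.log_natCast_nonneg p)
  rw [Finset.sum_sub_distrib, ← Finset.mul_sum] at h3
  have h4 : (N : ℝ) * ∑ p ∈ primesIn 0 N, Real.log p / p ≤ N * (Real.log N + Real.log 4) := by
    linarith
  exact le_of_mul_le_mul_left h4 hN0

lemma exists_le_sum_log_div :
    ∃ C : ℝ, 0 ≤ C ∧ ∀ N : ℕ, 1 ≤ N → Real.log N - C ≤ ∑ p ∈ primesIn 0 N, Real.log p / p := by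
  have hs : Summable fun n : ℕ => 1 / (n : ℝ) ^ (3 / 2 : ℝ) :=
    Real.summable_one_div_nat_rpow.2 (by norm_num)
  set T := ∑' n : ℕ, 1 / (n : ℝ) ^ (3 / 2 : ℝ) with hT
  have hT0 : 0 ≤ T := tsum_nonneg fun n => by positivity
  refine ⟨1 + 4 * T, by positivity, fun N hN => ?_⟩
  have hN0 : (0 : ℝ) < N := by exact_mod_cast hN
  have h1 : (N : ℝ) * Real.log N - N ≤ Real.log (N.factorial : ℝ) := by
    have h := Stirling.le_log_factorial_stirling (n := N) (by omega)
    have h2 := Real.log_natCast_nonneg N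
    have h3 : 0 ≤ Real.log (2 * Real.pi) := Real.log_nonneg (by linarith [Real.pi_gt_three])
    linarith
  have hterm : ∀ p ∈ primesIn 0 N, (padicValNat p N.factorial : ℝ) * Real.log p ≤
      N * (Real.log p / p) + N * (4 * (1 / (p : ℝ) ^ (3 / 2 : ℝ))) := by
    intro p hp
    have hpp := (mem_primesIn.1 hp).2
    have := Fact.mk hpp
    have hp2 : (2 : ℝ) ≤ p := by exact_mod_cast hpp.two_le
    have hp0 : (0 : ℝ) < p := by linarith
    have hv := sub_one_mul_padicValNat_factorial (p := p) N
    have hv1 : (p - 1) * padicValNat p N.factorial ≤ N := by omega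
    have hv2 : ((p : ℝ) - 1) * padicValNat p N.factorial ≤ N := by
      have : (((p - 1) * padicValNat p N.factorial : ℕ) : ℝ) ≤ N := by exact_mod_cast hv1
      rw [Nat.cast_mul, Nat.cast_sub hpp.one_le] at this
      simpa using this
    have hv3 : (padicValNat p N.factorial : ℝ) ≤ N / p + 2 * N / p ^ 2 := by
      have : (padicValNat p N.factorial : ℝ) ≤ N / (p - 1) := by
        rw [le_div_iff₀ (by linarith)]; linarith
      refine this.trans ?_
      rw [div_add_div _ _ hp0.ne' (by positivity), div_le_div_iff₀ (by linarith) (by positivity)]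
      have : 0 ≤ (N : ℝ) * p * (p - 2) := by
        have : 0 ≤ (p : ℝ) - 2 := by linarith
        positivity
      nlinarith
    have hlog : Real.log p ≤ 2 * √(p : ℝ) := by
      have h := Real.log_le_sub_one_of_pos (Real.sqrt_pos.2 hp0)
      rw [Real.log_sqrt hp0.le] at h
      linarith
    have hrp : (p : ℝ) ^ (3 / 2 : ℝ) * √(p : ℝ) = p ^ 2 := by
      rw [Real.sqrt_eq_rpow, ← Real.rpow_add hp0]
      norm_num
    have hsq : √(p : ℝ) / p ^ 2 = 1 / (p : ℝ) ^ (3 / 2 : ℝ) := by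
      rw [← hrp]
      have := Real.sqrt_pos.2 hp0
      have : (0 : ℝ) < (p : ℝ) ^ (3 / 2 : ℝ) := by positivity
      field_simp
    calc _ ≤ (N / p + 2 * N / p ^ 2) * Real.log p :=
          mul_le_mul_of_nonneg_right hv3 (Real.log_natCast_nonneg p)
      _ = N * (Real.log p / p) + 2 * N / p ^ 2 * Real.log p := by ring
      _ ≤ N * (Real.log p / p) + 2 * N / p ^ 2 * (2 * √(p : ℝ)) := by gcongr
      _ = N * (Real.log p / p) + N * (4 * (√(p : ℝ) / p ^ 2)) := by ring
      _ = _ := by rw [hsq]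
  rw [log_factorial_eq_sum] at h1
  have h2 := h1.trans (Finset.sum_le_sum hterm)
  rw [Finset.sum_add_distrib, ← Finset.mul_sum, ← Finset.mul_sum, ← Finset.mul_sum] at h2
  have h3 : ∑ p ∈ primesIn 0 N, 1 / (p : ℝ) ^ (3 / 2 : ℝ) ≤ T :=
    hs.sum_le_tsum _ fun n _ => by positivity
  have h4 : (N : ℝ) * (Real.log N - (1 + 4 * T)) ≤ N * ∑ p ∈ primesIn 0 N, Real.log p / p := by
    have := mul_le_mul_of_nonneg_left h3 (show (0 : ℝ) ≤ N * 4 by positivity)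
    linarith
  exact le_of_mul_le_mul_left h4 hN0

/-- The primes in `(N^{1/8}, N^{1/4}]`. -/
def midPrimes (N : ℕ) : Finset ℕ := primesIn N.sqrt.sqrt.sqrt N.sqrt.sqrt

lemma le_sqrt_sqrt {p N : ℕ} : p ≤ N.sqrt.sqrt ↔ p ^ 4 ≤ N := by
  rw [Nat.le_sqrt, Nat.le_sqrt]
  ring_nf

lemma mem_midPrimes {N p : ℕ} : p ∈ midPrimes N ↔ (N < p ^ 8 ∧ p ^ 4 ≤ N) ∧ p.Prime := by
  rw [midPrimes, mem_primesIn, le_sqrt_sqrt, Nat.sqrt_lt, Nat.sqrt_lt, Nat.sqrt_lt]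
  ring_nf

lemma log_le_log_add_log_two {x : ℕ} (hx : 1 ≤ x) :
    Real.log ((x : ℝ) + 1) ≤ Real.log x + Real.log 2 := by
  have hx' : (1 : ℝ) ≤ x := by exact_mod_cast hx
  rw [← Real.log_mul (by positivity) (by norm_num)]
  exact Real.log_le_log (by positivity) (by linarith)

lemma exists_forall_le_log (C : ℝ) : ∃ N₀ : ℕ, 1 ≤ N₀ ∧ ∀ N : ℕ, N₀ ≤ N → C ≤ Real.log N := by
  have h := (Real.tendsto_log_atTop.comp tendsto_natCast_atTop_atTop).eventually_ge_atTop C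
  obtain ⟨N₀, h⟩ := Filter.eventually_atTop.1 h
  exact ⟨max N₀ 1, le_max_right _ _, fun N hN => h N ((le_max_left _ _).trans hN)⟩

lemma exists_sum_midPrimes_bounds : ∃ N₀ : ℕ, ∀ N : ℕ, N₀ ≤ N →
    1 / 4 ≤ ∑ p ∈ midPrimes N, 1 / (p : ℝ) ∧ ∑ p ∈ midPrimes N, 1 / (p : ℝ) ≤ 4 := by
  obtain ⟨C, hC0, hC⟩ := exists_le_sum_log_div
  set D := Real.log 2 + C + Real.log 4 with hD
  have hl2 : 0 < Real.log 2 := Real.log_pos (by norm_num)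
  have hl4 : 0 < Real.log 4 := Real.log_pos (by norm_num)
  obtain ⟨N₀, hN1, hN₀⟩ := exists_forall_le_log (16 * D)
  refine ⟨N₀, fun N hN => ?_⟩
  have hlN := hN₀ N hN
  have hlN0 : 0 < Real.log N := by
    have : 0 < D := by rw [hD]; linarith
    linarith
  have hNpos : (0 : ℝ) < N := by exact_mod_cast hN1.trans hN
  set x := N.sqrt.sqrt with hx
  set y := x.sqrt with hy
  have hx1 : 1 ≤ x := by rw [hx, le_sqrt_sqrt]; simpa using hN1.trans hN
  have hy1 : 1 ≤ y := by rw [hy, Nat.le_sqrt]; simpa using hx1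
  have hx0 : (0 : ℝ) < x := by exact_mod_cast hx1
  have hy0 : (0 : ℝ) < y := by exact_mod_cast hy1
  have hyx : y ≤ x := Nat.sqrt_le_self x
  have hxlog : Real.log N / 4 - Real.log 2 ≤ Real.log x := by
    have h1 : N < (x + 1) ^ 4 := by
      by_contra h
      have := le_sqrt_sqrt.2 (not_lt.1 h)
      omega
    have h2 : Real.log N ≤ 4 * Real.log ((x : ℝ) + 1) := by
      rw [← Nat.cast_ofNat, ← Real.log_pow]
      exact Real.log_le_log hNpos (by exact_mod_cast h1.le)
    have := log_le_log_add_log_two hx1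
    linarith
  have hxlog' : Real.log x ≤ Real.log N / 4 := by
    have h1 : x ^ 4 ≤ N := le_sqrt_sqrt.1 le_rfl
    have h2 : 4 * Real.log (x : ℝ) ≤ Real.log N := by
      rw [← Nat.cast_ofNat, ← Real.log_pow]
      exact Real.log_le_log (by positivity) (by exact_mod_cast h1)
    linarith
  have hylog : Real.log y ≤ Real.log N / 8 := by
    have h1 : y * y ≤ x := Nat.sqrt_le x
    have h2 : Real.log y + Real.log y ≤ Real.log x := by
      rw [← Real.log_mul hy0.ne' hy0.ne']
      exact Real.log_le_log (by positivity) (by exact_mod_cast h1)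
    linarith
  have hlow := hC x hx1
  have hupy := sum_log_div_le hy1
  have hupx := sum_log_div_le hx1
  have hadd := sum_primesIn_add (Nat.zero_le y) hyx fun p => Real.log p / p
  have hy_nonneg : 0 ≤ ∑ p ∈ primesIn 0 y, Real.log p / p :=
    Finset.sum_nonneg fun p _ => div_nonneg (Real.log_natCast_nonneg p) (by positivity)
  have hmid : midPrimes N = primesIn y x := rfl
  constructor
  · have h : ∑ p ∈ midPrimes N, Real.log p / p ≤
        Real.log N / 4 * ∑ p ∈ midPrimes N, 1 / (p : ℝ) := by
      rw [Finset.mul_sum]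
      refine Finset.sum_le_sum fun p hp => ?_
      have hp' := mem_midPrimes.1 hp
      have h1 : 4 * Real.log (p : ℝ) ≤ Real.log N := by
        rw [← Nat.cast_ofNat, ← Real.log_pow]
        have := hp'.2.pos
        exact Real.log_le_log (by positivity) (by exact_mod_cast hp'.1.2)
      rw [mul_one_div]
      gcongr
      linarith
    rw [hmid] at h ⊢
    have h5 : Real.log N / 4 * (1 / 4) ≤
        Real.log N / 4 * ∑ p ∈ primesIn y x, 1 / (p : ℝ) := by linarith
    exact le_of_mul_le_mul_left h5 (by positivity)
  · have h : Real.log N / 8 * ∑ p ∈ midPrimes N, 1 / (p : ℝ) ≤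
        ∑ p ∈ midPrimes N, Real.log p / p := by
      rw [Finset.mul_sum]
      refine Finset.sum_le_sum fun p hp => ?_
      have hp' := mem_midPrimes.1 hp
      have h1 : Real.log N ≤ 8 * Real.log (p : ℝ) := by
        rw [← Nat.cast_ofNat, ← Real.log_pow]
        exact Real.log_le_log hNpos (by exact_mod_cast hp'.1.1.le)
      rw [mul_one_div]
      gcongr
      linarith
    rw [hmid] at h ⊢
    have h5 : Real.log N / 8 * ∑ p ∈ primesIn y x, 1 / (p : ℝ) ≤ Real.log N / 8 * 4 := by
      linarith
    exact le_of_mul_le_mul_left h5 (by positivity)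

lemma exists_sum_primesIn_div_le {s : ℝ} (hs : 0 < s) : ∃ δ : ℝ, 0 < δ ∧ δ ≤ 1 / 4 ∧
    ∃ N₀ : ℕ, ∀ N : ℕ, N₀ ≤ N → ∀ z : ℕ, 1 ≤ z → Real.log z ≤ δ * Real.log N →
      ∑ p ∈ primesIn (N / z ^ 2) N, 1 / (p : ℝ) ≤ s := by
  obtain ⟨C, hC0, hC⟩ := exists_le_sum_log_div
  set D := Real.log 2 + C + Real.log 4 with hD
  have hl2 : 0 < Real.log 2 := Real.log_pos (by norm_num)
  have hl4 : 0 < Real.log 4 := Real.log_pos (by norm_num)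
  have hD0 : 0 < D := by rw [hD]; linarith
  refine ⟨min (1 / 4) (s / 8), by positivity, min_le_left _ _, ?_⟩
  set δ := min (1 / 4) (s / 8) with hδ
  obtain ⟨N₀, hN1, hN₀⟩ := exists_forall_le_log (max (4 * D / s) 1)
  refine ⟨N₀, fun N hN z hz hzN => ?_⟩
  have hlN := (le_max_left _ _).trans (hN₀ N hN)
  have hlN1 := (le_max_right _ _).trans (hN₀ N hN)
  have hNpos : (0 : ℝ) < N := by exact_mod_cast hN1.trans hN
  have hz0 : (0 : ℝ) < z := by exact_mod_cast hz
  have hδ1 : δ ≤ 1 / 4 := min_le_left _ _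
  have hδ2 : δ ≤ s / 8 := min_le_right _ _
  have hzN2 : z ^ 2 ≤ N := by
    have : Real.log ((z : ℝ) ^ 2) ≤ Real.log N := by
      rw [Real.log_pow]; push_cast; nlinarith
    have := (Real.log_le_log_iff (by positivity) hNpos).1 this
    exact_mod_cast this
  set y := N / z ^ 2 with hy
  have hy1 : 1 ≤ y := Nat.div_pos hzN2 (by positivity)
  have hyN : y ≤ N := Nat.div_le_self _ _
  have hylog : (1 - 2 * δ) * Real.log N ≤ Real.log ((y : ℝ) + 1) := by
    have h1 : N < z ^ 2 * (y + 1) := Nat.lt_mul_div_succ N (by positivity)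
    have h2 : Real.log N ≤ 2 * Real.log z + Real.log ((y : ℝ) + 1) := by
      rw [← Nat.cast_ofNat, ← Real.log_pow, ← Real.log_mul (by positivity) (by positivity)]
      exact Real.log_le_log hNpos (by exact_mod_cast h1.le)
    linarith
  have hylog' := log_le_log_add_log_two hy1
  have hlow := hC y hy1
  have hup := sum_log_div_le (hN1.trans hN)
  have hadd := sum_primesIn_add (Nat.zero_le y) hyN fun p => Real.log p / p
  have h : Real.log N / 2 * ∑ p ∈ primesIn y N, 1 / (p : ℝ) ≤
      ∑ p ∈ primesIn y N, Real.log p / p := by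
    rw [Finset.mul_sum]
    refine Finset.sum_le_sum fun p hp => ?_
    have hp' := mem_primesIn.1 hp
    have h1 : Real.log ((y : ℝ) + 1) ≤ Real.log p :=
      Real.log_le_log (by positivity) (by exact_mod_cast hp'.1.1)
    rw [mul_one_div]
    gcongr
    nlinarith
  have h6 : D ≤ s / 4 * Real.log N := by
    rw [div_le_iff₀ hs] at hlN; linarith
  have h5 : Real.log N / 2 * ∑ p ∈ primesIn y N, 1 / (p : ℝ) ≤ Real.log N / 2 * s := by
    nlinarith
  exact le_of_mul_le_mul_left h5 (by positivity)

/-- The set of decrease of `g` has natural density zero. -/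
def HasSparseDescents (g : ℕ → ℝ) : Prop :=
  ∀ ε : ℝ, 0 < ε → ∃ N₀ : ℕ, ∀ N : ℕ, N₀ ≤ N →
    (((Ioc 0 N).filter (fun n => g n < g (n - 1))).card : ℝ) ≤ ε * N

lemma sum_Ioc_sub_pred (F : ℕ → ℝ) (M : ℕ) :
    ∑ n ∈ Ioc 0 M, (F n - F (n - 1)) = F M - F 0 := by
  induction M with
  | zero => simp
  | succ k ih =>
    rw [← Finset.insert_Ioc_right_eq_Ioc_add_one (Nat.zero_le k), sum_insert (by simp), ih]
    simp

lemma sum_abs_comp_sub_le (g : ℕ → ℝ) {φ : ℝ → ℝ} (hφ : Monotone φ) (hφ1 : ∀ x, |φ x| ≤ 1)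
    (M : ℕ) : ∑ n ∈ Ioc 0 M, |φ (g n) - φ (g (n - 1))| ≤
      2 + 4 * (((Ioc 0 M).filter (fun n => g n < g (n - 1))).card : ℝ) := by
  have key : ∀ n, |φ (g n) - φ (g (n - 1))| ≤
      (φ (g n) - φ (g (n - 1))) + 4 * (if g n < g (n - 1) then 1 else 0) := by
    intro n
    split_ifs with h
    · have h1 := abs_le.1 (hφ1 (g n))
      have h2 := abs_le.1 (hφ1 (g (n - 1)))
      rw [abs_of_nonpos (by linarith [hφ h.le])]
      linarith
    · rw [abs_of_nonneg (by linarith [hφ (not_lt.1 h)])]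
      linarith
  refine (sum_le_sum fun n _ => key n).trans ?_
  rw [sum_add_distrib, sum_Ioc_sub_pred (fun n => φ (g n)), ← mul_sum, sum_boole]
  have h1 := abs_le.1 (hφ1 (g M))
  have h2 := abs_le.1 (hφ1 (g 0))
  linarith

lemma HasSparseDescents.exists_sum_abs_comp_sub_le {g : ℕ → ℝ} (hg : HasSparseDescents g) {η : ℝ}
    (hη : 0 < η) : ∃ N₀ : ℕ, ∀ N : ℕ, N₀ ≤ N → ∀ φ : ℝ → ℝ, Monotone φ → (∀ x, |φ x| ≤ 1) →
      ∑ n ∈ Ioc 0 N, |φ (g n) - φ (g (n - 1))| ≤ η * N := by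
  obtain ⟨N₀, h⟩ := hg (η / 8) (by positivity)
  refine ⟨max N₀ ⌈4 / η⌉₊, fun N hN φ hφ hφ1 => ?_⟩
  have h1 := h N ((le_max_left _ _).trans hN)
  have h2 : 4 / η ≤ N := Nat.ceil_le.1 ((le_max_right _ _).trans hN)
  rw [div_le_iff₀ hη] at h2
  have h3 := sum_abs_comp_sub_le g hφ hφ1 N
  linarith

lemma exists_forall_le_sqrt (C : ℝ) : ∃ N₀ : ℕ, 1 ≤ N₀ ∧ ∀ N : ℕ, N₀ ≤ N → C ≤ √(N : ℝ) := by
  refine ⟨max ⌈C ^ 2⌉₊ 1, le_max_right _ _, fun N hN => ?_⟩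
  exact Real.le_sqrt_of_sq_le (Nat.ceil_le.1 ((le_max_left _ _).trans hN))

lemma HasSparseDescents.exists_abs_sum_comp_mul_xiSum_le {g : ℕ → ℝ} (hg : HasSparseDescents g)
    {ε : ℝ} (hε : 0 < ε) : ∃ w N₀ : ℕ, ∀ N : ℕ, N₀ ≤ N → ∀ φ : ℝ → ℝ, Monotone φ →
      (∀ x, |φ x| ≤ 1) → ∀ (P : Finset ℕ) (a : ℕ → ℝ), (∀ p ∈ P, p.Prime) → (∀ p ∈ P, w < p) →
        (∀ p ∈ P, p ^ 4 ≤ N) → sqWt P a ≤ 1 →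
          |∑ n ∈ Ioc 0 N, φ (g n) * xiSum P a n| ≤ ε * N := by
  set e := ε / 4 with he
  have he0 : 0 < e := by positivity
  obtain ⟨H, hH⟩ := exists_nat_ge (2 / e ^ 2 + 1)
  have hH1 : (1 : ℝ) ≤ H := le_trans (by have : 0 < 2 / e ^ 2 := by positivity
                                         linarith) hH
  have hH0 : 0 < H := by exact_mod_cast hH1
  have hHe : 2 / (e * H) ≤ e := by
    rw [div_le_iff₀ (by positivity)]
    have : 2 / e ^ 2 ≤ H := by linarith
    rw [div_le_iff₀ (by positivity)] at this
    linarith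
  obtain ⟨N₁, h1⟩ := hg.exists_sum_abs_comp_sub_le (η := e ^ 2 / (2 * H)) (by positivity)
  obtain ⟨N₂, -, h2⟩ := exists_forall_le_sqrt (4 * H + 2 * H / e)
  refine ⟨H, max N₁ N₂, fun N hN φ hφ hφ1 P a hP hw hPN ha => ?_⟩
  have hs := h2 N ((le_max_right _ _).trans hN)
  have hs2 := Real.mul_self_sqrt (Nat.cast_nonneg (α := ℝ) N)
  have h2e : 0 < 2 * H / e := by positivity
  have hs0 := Real.sqrt_nonneg (N : ℝ)
  have hsum := h1 (2 * N) (((le_max_left _ _).trans hN).trans (by omega)) φ hφ hφ1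
  have hHN : 4 * H * √(N : ℝ) ≤ N := by nlinarith
  have hHN' : H ≤ N := by
    have : (H : ℝ) ≤ N := by nlinarith
    exact_mod_cast this
  have h5 : 2 * H * √(N : ℝ) ≤ e * N := by
    have h : 2 * H / e ≤ √(N : ℝ) := by linarith
    rw [div_le_iff₀ he0] at h
    nlinarith
  have h6 := abs_sum_mul_xiSum_le (f := fun n => φ (g n)) (η := e ^ 2 / H) he0 hH0 hHN hHN'
    (fun n => hφ1 _) (by
      refine hsum.trans_eq ?_
      push_cast
      field_simp) hP hPN hw ha
  refine h6.trans ?_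
  have h7 : H * (e ^ 2 / H) / e = e := by field_simp
  rw [h7]
  have hN0 : (0 : ℝ) ≤ N := Nat.cast_nonneg N
  nlinarith

lemma IsAdditiveR.apply_one {g : ℕ → ℝ} (hg : IsAdditiveR g) : g 1 = 0 := by
  simpa using hg 1 1 (by simp)

lemma IsAdditiveR.eq_sum_primeFactors {g : ℕ → ℝ} (hg : IsAdditiveR g) {n : ℕ} (hn : n ≠ 0) :
    g n = ∑ p ∈ n.primeFactors, g (p ^ n.factorization p) := by
  have h := Nat.multiplicative_factorization (fun n => Multiplicative.ofAdd (g n))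
    (fun x y hxy => by rw [hg x y hxy, ofAdd_add]) (by rw [hg.apply_one, ofAdd_zero]) hn
  rw [Finsupp.prod, Nat.support_factorization, ← ofAdd_sum] at h
  exact Multiplicative.ofAdd.injective h

open Classical in
lemma card_powerful_le {w : ℕ} (hw : 1 ≤ w) (N : ℕ) :
    (((Ioc 0 N).filter (fun n => ∃ p : ℕ, p.Prime ∧
      ((w < p ∧ p ^ 2 ∣ n) ∨ (p ≤ w ∧ p ^ (2 * w) ∣ n)))).card : ℝ) ≤ 2 * N / w := by
  have hw0 : (0 : ℝ) < w := by exact_mod_cast hw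
  have hN0 : (0 : ℝ) ≤ N := Nat.cast_nonneg N
  rw [← sum_boole]
  calc _ ≤ ∑ n ∈ Ioc 0 N, (∑ p ∈ Ioc w (w + N), divInd (p ^ 2) n +
        ∑ p ∈ Ioc 1 w, divInd (p ^ (2 * w)) n) := by
        refine sum_le_sum fun n hn => ?_
        have hn := mem_Ioc.1 hn
        have hA : 0 ≤ ∑ p ∈ Ioc w (w + N), divInd (p ^ 2) n :=
          sum_nonneg fun _ _ => divInd_nonneg _ _
        have hB : 0 ≤ ∑ p ∈ Ioc 1 w, divInd (p ^ (2 * w)) n :=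
          sum_nonneg fun _ _ => divInd_nonneg _ _
        split_ifs with h
        · obtain ⟨p, hp, ⟨h1, h2⟩ | ⟨h1, h2⟩⟩ := h
          · have hpn : p ≤ n := (Nat.le_self_pow two_ne_zero p).trans (Nat.le_of_dvd hn.1 h2)
            have := single_le_sum (f := fun p => divInd (p ^ 2) n) (fun _ _ => divInd_nonneg _ _)
              (mem_Ioc.2 ⟨h1, by omega⟩ : p ∈ Ioc w (w + N))
            simp only [divInd, h2, if_true] at this hB ⊢
            linarith
          · have := single_le_sum (f := fun p => divInd (p ^ (2 * w)) n)
              (fun _ _ => divInd_nonneg _ _) (mem_Ioc.2 ⟨hp.one_lt, h1⟩ : p ∈ Ioc 1 w)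
            simp only [divInd, h2, if_true] at this hA ⊢
            linarith
        · linarith
    _ = ∑ p ∈ Ioc w (w + N), ∑ n ∈ Ioc 0 N, divInd (p ^ 2) n +
        ∑ p ∈ Ioc 1 w, ∑ n ∈ Ioc 0 N, divInd (p ^ (2 * w)) n := by
        rw [sum_add_distrib, sum_comm, sum_comm (s := Ioc 0 N) (t := Ioc 1 w)]
    _ ≤ ∑ p ∈ Ioc w (w + N), N * (((p : ℝ) ^ 2)⁻¹) + ∑ p ∈ Ioc 1 w, (N : ℝ) / (w * w) := by
        refine add_le_add (sum_le_sum fun p _ => ?_) (sum_le_sum fun p hp => ?_)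
        · refine (sum_divInd_le _ _).trans_eq ?_
          push_cast
          rw [div_eq_mul_inv]
        · refine (sum_divInd_le _ _).trans ?_
          have h2 : 2 ≤ p := (mem_Ioc.1 hp).1
          have h3 : w * w ≤ p ^ (2 * w) := by
            have h4 : w * w ≤ (2 ^ w) * 2 ^ w :=
              Nat.mul_le_mul Nat.lt_two_pow_self.le Nat.lt_two_pow_self.le
            refine h4.trans ?_
            rw [← pow_add, ← two_mul]
            exact Nat.pow_le_pow_left h2 _
          refine div_le_div_of_nonneg_left hN0 (by positivity) ?_
          exact_mod_cast h3
    _ ≤ N * (1 / w) + w * (N / (w * w)) := by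
        refine add_le_add ?_ ?_
        · rw [← mul_sum]
          refine mul_le_mul_of_nonneg_left ?_ hN0
          refine (sum_Ioc_inv_sq_le_sub (α := ℝ) (by omega) (by omega)).trans ?_
          rw [one_div]
          have : (0 : ℝ) ≤ ((w + N : ℕ) : ℝ)⁻¹ := by positivity
          linarith
        · rw [sum_const, nsmul_eq_mul]
          refine mul_le_mul_of_nonneg_right ?_ (by positivity)
          rw [Nat.card_Ioc]
          exact_mod_cast Nat.sub_le w 1
    _ = 2 * N / w := by field_simp; ring

open Classical in
lemma IsAdditiveR.exists_abs_sub_sum_le {g : ℕ → ℝ} (hg : IsAdditiveR g) {w : ℕ} (hw : 1 ≤ w) :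
    ∃ C : ℝ, 0 ≤ C ∧ ∀ N : ℕ, ∃ E ⊆ Ioc 0 N, (E.card : ℝ) ≤ 2 * N / w ∧
      ∀ n ∈ Ioc 0 N, n ∉ E → |g n - ∑ p ∈ primesIn w N, g p * divInd p n| ≤ C := by
  refine ⟨∑ p ∈ Ioc 0 w, ∑ k ∈ range (2 * w), |g (p ^ k)|,
    sum_nonneg fun _ _ => sum_nonneg fun _ _ => abs_nonneg _,
    fun N => ⟨(Ioc 0 N).filter (fun n => ∃ p : ℕ, p.Prime ∧
      ((w < p ∧ p ^ 2 ∣ n) ∨ (p ≤ w ∧ p ^ (2 * w) ∣ n))), filter_subset _ _,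
    card_powerful_le hw N, fun n hn hE => ?_⟩⟩
  have hn1 := mem_Ioc.1 hn
  have hn0 : n ≠ 0 := by omega
  have hE' : ∀ p : ℕ, p.Prime → (w < p → ¬ p ^ 2 ∣ n) ∧ (p ≤ w → ¬ p ^ (2 * w) ∣ n) := by
    intro p hp
    refine ⟨fun h1 h2 => hE (mem_filter.2 ⟨hn, p, hp, Or.inl ⟨h1, h2⟩⟩),
      fun h1 h2 => hE (mem_filter.2 ⟨hn, p, hp, Or.inr ⟨h1, h2⟩⟩)⟩
  have h1 : ∑ p ∈ primesIn w N, g p * divInd p n =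
      ∑ p ∈ n.primeFactors.filter (fun p => ¬ p ≤ w), g (p ^ n.factorization p) := by
    rw [sum_mul_divInd]
    have hs : (primesIn w N).filter (· ∣ n) = n.primeFactors.filter (fun p => ¬ p ≤ w) := by
      ext p
      simp only [mem_filter, mem_primesIn, Nat.mem_primeFactors]
      constructor
      · rintro ⟨⟨⟨h1, h2⟩, h3⟩, h4⟩
        exact ⟨⟨h3, h4, hn0⟩, by omega⟩
      · rintro ⟨⟨h3, h4, -⟩, h5⟩
        exact ⟨⟨⟨by omega, (Nat.le_of_dvd hn1.1 h4).trans hn1.2⟩, h3⟩, h4⟩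
    rw [hs]
    refine sum_congr rfl fun p hp => ?_
    obtain ⟨hp1, hp2⟩ := mem_filter.1 hp
    obtain ⟨hpp, hpn, -⟩ := Nat.mem_primeFactors.1 hp1
    have hlt : n.factorization p < 2 := by
      by_contra h
      exact (hE' p hpp).1 (by omega) ((hpp.pow_dvd_iff_le_factorization hn0).2 (by omega))
    have hge : 1 ≤ n.factorization p := (hpp.dvd_iff_one_le_factorization hn0).1 hpn
    have : n.factorization p = 1 := by omega
    rw [this, pow_one]
  rw [h1, hg.eq_sum_primeFactors hn0,
    ← sum_filter_add_sum_filter_not n.primeFactors (fun p => p ≤ w), add_sub_cancel_right]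
  refine (abs_sum_le_sum_abs _ _).trans ?_
  calc _ ≤ ∑ p ∈ n.primeFactors.filter (· ≤ w), ∑ k ∈ range (2 * w), |g (p ^ k)| := by
        refine sum_le_sum fun p hp => ?_
        obtain ⟨hp1, hp2⟩ := mem_filter.1 hp
        have hpp := (Nat.mem_primeFactors.1 hp1).1
        have hlt : n.factorization p < 2 * w := by
          by_contra h
          exact (hE' p hpp).2 hp2 ((hpp.pow_dvd_iff_le_factorization hn0).2 (by omega))
        exact single_le_sum (f := fun k => |g (p ^ k)|) (fun _ _ => abs_nonneg _) (mem_range.2 hlt)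
    _ ≤ _ := by
        refine sum_le_sum_of_subset_of_nonneg (fun p hp => ?_)
          fun _ _ _ => sum_nonneg fun _ _ => abs_nonneg _
        obtain ⟨hp1, hp2⟩ := mem_filter.1 hp
        exact mem_Ioc.2 ⟨(Nat.mem_primeFactors.1 hp1).1.pos, hp2⟩

lemma BgR_sq (g : ℕ → ℝ) (X : ℝ) : BgR g X ^ 2 = ∑ q ∈ ppows X, (g q) ^ 2 / (q : ℝ) :=
  Real.sq_sqrt (sum_nonneg fun _ _ => by positivity)

lemma BgR_nonneg (g : ℕ → ℝ) (X : ℝ) : 0 ≤ BgR g X := Real.sqrt_nonneg _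

lemma BgR_mono (g : ℕ → ℝ) {X Y : ℝ} (h : X ≤ Y) : BgR g X ≤ BgR g Y := by
  refine Real.sqrt_le_sqrt (sum_le_sum_of_subset_of_nonneg ?_ fun _ _ _ => by positivity)
  exact filter_subset_filter _ (Icc_subset_Icc_right (Nat.floor_mono h))

lemma BgR_floor (g : ℕ → ℝ) (X : ℝ) : BgR g (⌊X⌋₊ : ℕ) = BgR g X := by
  simp only [BgR, ppows, Nat.floor_natCast]

lemma sqWt_primesIn_le (g : ℕ → ℝ) (w N : ℕ) : sqWt (primesIn w N) g ≤ BgR g N ^ 2 := by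
  rw [BgR_sq]
  refine sum_le_sum_of_subset_of_nonneg (fun p hp => ?_) fun _ _ _ => by positivity
  obtain ⟨⟨h1, h2⟩, h3⟩ := mem_primesIn.1 hp
  rw [ppows, Nat.floor_natCast]
  exact mem_filter.2 ⟨mem_Icc.2 ⟨h3.two_le, h2⟩, h3.isPrimePow⟩

lemma card_filter_lt_abs_mul_sq_le (s : Finset ℕ) (F : ℕ → ℝ) {t : ℝ} (ht : 0 ≤ t) :
    ((s.filter (fun n => t < |F n|)).card : ℝ) * t ^ 2 ≤ ∑ n ∈ s, F n ^ 2 := by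
  rw [← nsmul_eq_mul, ← sum_const]
  calc _ ≤ ∑ n ∈ s.filter (fun n => t < |F n|), F n ^ 2 := by
        refine sum_le_sum fun n hn => ?_
        rw [← sq_abs (F n)]
        exact pow_le_pow_left₀ ht (mem_filter.1 hn).2.le 2
    _ ≤ _ := sum_le_sum_of_subset_of_nonneg (filter_subset _ _) fun _ _ _ => sq_nonneg _

/-- The centring constant `∑ g(p)/p` over primes `w < p ≤ N`. -/
noncomputable def meanIn (g : ℕ → ℝ) (w N : ℕ) : ℝ := ∑ p ∈ primesIn w N, g p / (p : ℝ)

lemma prime_of_mem_primesIn {w N p : ℕ} (h : p ∈ primesIn w N) : p.Prime := (mem_primesIn.1 h).2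

lemma le_of_mem_primesIn {w N p : ℕ} (h : p ∈ primesIn w N) : p ≤ N := (mem_primesIn.1 h).1.2

lemma lt_of_mem_primesIn {w N p : ℕ} (h : p ∈ primesIn w N) : w < p := (mem_primesIn.1 h).1.1

lemma IsAdditiveR.exists_card_lt_abs_sub_le {g : ℕ → ℝ} (hg : IsAdditiveR g) {w : ℕ} (hw : 1 ≤ w) :
    ∃ C : ℝ, 0 ≤ C ∧ ∀ (N : ℕ) (Q : Finset ℕ) (t : ℝ), 0 < t → Q ⊆ primesIn w N →
      (((Ioc 0 N).filter (fun n => C + t < |g n - ∑ p ∈ Q, g p / (p : ℝ)|)).card : ℝ) ≤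
        2 * N / w + N * ∑ p ∈ primesIn w N \ Q, 1 / (p : ℝ) + 36 * N * sqWt Q g / t ^ 2 := by
  obtain ⟨C, hC, h⟩ := hg.exists_abs_sub_sum_le hw
  refine ⟨C, hC, fun N Q t ht hQ => ?_⟩
  obtain ⟨E, hE, hEc, hEn⟩ := h N
  set D := (Ioc 0 N).filter (fun n => ∃ p ∈ primesIn w N \ Q, p ∣ n) with hD
  have hsub : (Ioc 0 N).filter (fun n => C + t < |g n - ∑ p ∈ Q, g p / (p : ℝ)|) ⊆
      E ∪ D ∪ (Ioc 0 N).filter (fun n => t < |xiSum Q g n|) := by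
    intro n hn
    obtain ⟨hn, hlt⟩ := mem_filter.1 hn
    by_contra hcon
    simp only [mem_union, not_or] at hcon
    obtain ⟨⟨h1, h2⟩, h3⟩ := hcon
    have h4 := hEn n hn h1
    have h3' : |xiSum Q g n| ≤ t := by
      by_contra h5
      exact h3 (mem_filter.2 ⟨hn, not_le.1 h5⟩)
    have h5 : ∑ p ∈ primesIn w N, g p * divInd p n = ∑ p ∈ Q, g p * divInd p n := by
      refine (sum_subset hQ fun p hp hpQ => ?_).symm
      have : ¬ p ∣ n := fun hd => h2 (mem_filter.2 ⟨hn, p, mem_sdiff.2 ⟨hp, hpQ⟩, hd⟩)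
      simp [divInd, this]
    rw [h5] at h4
    rw [xiSum_eq] at h3'
    have h6 := abs_add_le (g n - ∑ p ∈ Q, g p * divInd p n)
      (∑ p ∈ Q, g p * divInd p n - ∑ p ∈ Q, g p / (p : ℝ))
    rw [sub_add_sub_cancel] at h6
    linarith
  have hDc : (D.card : ℝ) ≤ N * ∑ p ∈ primesIn w N \ Q, 1 / (p : ℝ) := by
    rw [hD, ← sum_boole]
    calc _ ≤ ∑ n ∈ Ioc 0 N, ∑ p ∈ primesIn w N \ Q, divInd p n := by
          refine sum_le_sum fun n hn => ?_
          split_ifs with hex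
          · obtain ⟨p, hp, hd⟩ := hex
            have := single_le_sum (f := fun p => divInd p n) (fun _ _ => divInd_nonneg _ _) hp
            simpa [divInd, hd] using this
          · exact sum_nonneg fun _ _ => divInd_nonneg _ _
      _ ≤ _ := by
          rw [sum_comm, mul_sum]
          refine sum_le_sum fun p _ => (sum_divInd_le p N).trans_eq (by ring)
  have hX := card_filter_lt_abs_mul_sq_le (Ioc 0 N) (xiSum Q g) ht.le
  have hX2 := sum_xiSum_sq_le (fun p hp => prime_of_mem_primesIn (hQ hp))
    (fun p hp => le_of_mem_primesIn (hQ hp)) g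
  have hX3 := (le_div_iff₀ (by positivity)).2 (hX.trans hX2)
  have hc : (((Ioc 0 N).filter (fun n => C + t < |g n - ∑ p ∈ Q, g p / (p : ℝ)|)).card : ℝ) ≤
      E.card + D.card + ((Ioc 0 N).filter (fun n => t < |xiSum Q g n|)).card := by
    exact_mod_cast (card_le_card hsub).trans
      ((card_union_le _ _).trans (Nat.add_le_add_right (card_union_le _ _) _))
  linarith

lemma abs_meanIn_sub_le {g : ℕ → ℝ} {w Y N : ℕ} (hwY : w ≤ Y) (hYN : Y ≤ N) (hN : N ≤ Y ^ 4) :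
    |meanIn g w N - meanIn g w Y| ≤ 3 * BgR g N := by
  have h1 : meanIn g w N - meanIn g w Y = ∑ p ∈ primesIn Y N, g p / (p : ℝ) := by
    rw [meanIn, meanIn, ← sum_primesIn_add hwY hYN]
    ring
  rw [h1]
  refine abs_le_of_sq_le_sq ?_ (by have := BgR_nonneg g N; positivity)
  refine (sum_div_sq_le _ _).trans ?_
  have h2 : ∑ p ∈ primesIn Y N, 1 / (p : ℝ) ≤ 6 := sum_inv_le_six
    (fun p hp => prime_of_mem_primesIn hp)
    (fun p hp => hN.trans_lt (Nat.pow_lt_pow_left (lt_of_mem_primesIn hp) (by norm_num)))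
    (fun p hp => le_of_mem_primesIn hp)
  have h3 := sqWt_primesIn_le g Y N
  calc _ ≤ BgR g N ^ 2 * 6 := mul_le_mul h3 h2 (sum_nonneg fun _ _ => by positivity) (by positivity)
    _ ≤ _ := by nlinarith [sq_nonneg (BgR g N)]

/-- The number of `n ≤ N` with `g n > c`. -/
noncomputable def cntGt (g : ℕ → ℝ) (c : ℝ) (N : ℕ) : ℝ :=
  ∑ n ∈ Ioc 0 N, if c < g n then 1 else 0

lemma sum_range_divInd_add {r : ℕ} (hr : 0 < r) (n : ℕ) : ∑ i ∈ range r, divInd r (n + i) = 1 := by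
  have hm := Nat.mod_lt n hr
  have hd := Nat.div_add_mod n r
  rw [sum_eq_single ((r - n % r) % r)]
  · have : r ∣ n + (r - n % r) % r := by
      rw [Nat.dvd_iff_mod_eq_zero, Nat.add_mod_mod, show n + (r - n % r) = r * (n / r) + r by omega]
      simp
    simp [divInd, this]
  · intro i hi hne
    have hi := mem_range.1 hi
    have : ¬ r ∣ n + i := by
      rintro ⟨k, hk⟩
      apply hne
      have h1 : r * k = r * (n / r) + (n % r + i) := by omega
      have h2 : r ∣ n % r + i := (Nat.dvd_add_right (Dvd.intro _ rfl)).1 (h1 ▸ Dvd.intro k rfl)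
      obtain ⟨j, hj⟩ := h2
      have hj2 : j < 2 := by
        by_contra h
        have : r * 2 ≤ r * j := Nat.mul_le_mul_left r (by omega)
        omega
      interval_cases j
      · have : n % r = 0 := by omega
        simp [this]; omega
      · rw [Nat.mod_eq_of_lt] <;> omega
    simp [divInd, this]
  · intro h
    exact absurd (mem_range.2 (Nat.mod_lt _ hr)) h

lemma abs_mul_sum_mul_divInd_sub_le {f : ℕ → ℝ} (hf : ∀ n, |f n| ≤ 1) {N : ℕ} {V : ℝ}
    (hV : ∑ n ∈ Ioc 0 N, |f n - f (n - 1)| ≤ V) {r : ℕ} {j : ℕ} (hj : j < r) :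
    |r * ∑ n ∈ Ioc 0 N, f n * divInd r (n + j) - ∑ n ∈ Ioc 0 N, f n| ≤ r ^ 2 * (V + 2) := by
  set T : ℕ → ℝ := fun i => ∑ n ∈ Ioc 0 N, f n * divInd r (n + i) with hT
  have hV0 : 0 ≤ V := (sum_nonneg fun _ _ => abs_nonneg _).trans hV
  have hstep : ∀ i, |T (i + 1) - T i| ≤ V + 2 := by
    intro i
    set F : ℕ → ℝ := fun m => f m * divInd r (m + 1 + i) with hF
    have hF1 : ∀ m, |F m| ≤ 1 := by
      intro m
      rw [hF, abs_mul, abs_of_nonneg (divInd_nonneg _ _)]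
      exact mul_le_one₀ (hf m) (divInd_nonneg _ _) (divInd_le_one _ _)
    have h1 : T (i + 1) = ∑ n ∈ Ioc 0 N, F n :=
      sum_congr rfl fun n _ => by simp only [hF]; rw [add_right_comm, add_assoc]
    have h2 := sum_Ioc_sub_pred F N
    have h3 : ∀ n ∈ Ioc 0 N, F (n - 1) - f n * divInd r (n + i) =
        -((f n - f (n - 1)) * divInd r (n + i)) := by
      intro n hn
      have := (mem_Ioc.1 hn).1
      simp only [hF]
      rw [show n - 1 + 1 = n by omega]
      ring
    have h4 : T (i + 1) - T i = (F N - F 0) +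
        ∑ n ∈ Ioc 0 N, (F (n - 1) - f n * divInd r (n + i)) := by
      rw [h1, ← h2, ← sum_add_distrib, hT, ← sum_sub_distrib]
      exact sum_congr rfl fun _ _ => by ring
    rw [h4, sum_congr rfl h3]
    have h5 : |∑ n ∈ Ioc 0 N, -((f n - f (n - 1)) * divInd r (n + i))| ≤ V := by
      refine ((abs_sum_le_sum_abs _ _).trans (sum_le_sum fun n _ => ?_)).trans hV
      rw [abs_neg, abs_mul, abs_of_nonneg (divInd_nonneg _ _)]
      exact mul_le_of_le_one_right (abs_nonneg _) (divInd_le_one _ _)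
    have h6 := abs_add_le (F N - F 0) (∑ n ∈ Ioc 0 N, -((f n - f (n - 1)) * divInd r (n + i)))
    have h7 := abs_sub (F N) (F 0)
    linarith [hF1 N, hF1 0]
  have hle : ∀ i k, |T (i + k) - T i| ≤ k * (V + 2) := by
    intro i k
    induction k with
    | zero => simp
    | succ k ih =>
      have h1 := hstep (i + k)
      have h2 := abs_add_le (T (i + k + 1) - T (i + k)) (T (i + k) - T i)
      rw [sub_add_sub_cancel] at h2
      rw [← add_assoc]
      push_cast
      linarith
  have hij : ∀ i ∈ range r, |T j - T i| ≤ r * (V + 2) := by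
    intro i hi
    have hi := mem_range.1 hi
    rcases le_total i j with h | h
    · obtain ⟨k, rfl⟩ := Nat.exists_eq_add_of_le h
      refine (hle i k).trans (mul_le_mul_of_nonneg_right ?_ (by linarith))
      exact_mod_cast (by omega : k ≤ r)
    · obtain ⟨k, rfl⟩ := Nat.exists_eq_add_of_le h
      rw [abs_sub_comm]
      refine (hle j k).trans (mul_le_mul_of_nonneg_right ?_ (by linarith))
      exact_mod_cast (by omega : k ≤ r)
  have hsum : ∑ i ∈ range r, T i = ∑ n ∈ Ioc 0 N, f n := by
    simp only [hT]
    rw [sum_comm]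
    refine sum_congr rfl fun n _ => ?_
    rw [← mul_sum, sum_range_divInd_add (by omega), mul_one]
  have hfin : r * T j - ∑ n ∈ Ioc 0 N, f n = ∑ i ∈ range r, (T j - T i) := by
    rw [sum_sub_distrib, hsum]; simp
  rw [hfin]
  refine (abs_sum_le_sum_abs _ _).trans ((sum_le_sum hij).trans_eq ?_)
  simp
  ring

lemma monotone_ite_lt (c : ℝ) : Monotone fun x : ℝ => if c < x then (1 : ℝ) else 0 := by
  intro x y h
  dsimp only
  split_ifs <;> first | (norm_num; done) | (exfalso; linarith)

lemma abs_ite_lt_le_one (c x : ℝ) : |if c < x then (1 : ℝ) else 0| ≤ 1 := by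
  split_ifs <;> norm_num

lemma IsAdditiveR.sum_progression_eq {g : ℕ → ℝ} (hg : IsAdditiveR g) {p k : ℕ} (hp : p.Prime)
    (c : ℝ) (N : ℕ) :
    ∑ n ∈ Ioc 0 N, (if c < g n then (1 : ℝ) else 0) * divInd (p ^ k * p) (n + (p ^ k * p - p ^ k)) =
      ∑ m ∈ Ioc 0 (N / p ^ k), (if c - g (p ^ k) < g m then (1 : ℝ) else 0) *
        divInd p (m + (p - 1)) := by
  have hq : 0 < p ^ k := pow_pos hp.pos k
  set q := p ^ k with hqdef
  have himg : (Ioc 0 (N / q)).image (q * ·) ⊆ Ioc 0 N := by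
    intro n hn
    obtain ⟨m, hm, rfl⟩ := mem_image.1 hn
    have hm := mem_Ioc.1 hm
    have := Nat.mul_le_of_le_div q m N hm.2
    exact mem_Ioc.2 ⟨Nat.mul_pos hq hm.1, by linarith⟩
  have hsub : q * p - q = q * (p - 1) := by rw [Nat.mul_sub, mul_one]
  rw [← sum_subset himg, sum_image]
  · refine sum_congr rfl fun m hm => ?_
    have hdvd : q * p ∣ q * m + (q * p - q) ↔ p ∣ m + (p - 1) := by
      rw [hsub, ← mul_add]
      exact Nat.mul_dvd_mul_iff_left hq
    by_cases h : p ∣ m + (p - 1)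
    · have hcop : p.Coprime m := by
        refine (Nat.Prime.coprime_iff_not_dvd hp).2 fun h2 => ?_
        have h3 := Nat.le_of_dvd (by have := hp.two_le; omega) ((Nat.dvd_add_right h2).1 h)
        have := hp.pos
        omega
      rw [hg q m (Nat.Coprime.pow_left k hcop)]
      simp only [divInd, hdvd, h, if_true, sub_lt_iff_lt_add']
    · simp [divInd, hdvd, h]
  · intro x _ y _ hxy
    exact Nat.eq_of_mul_eq_mul_left hq hxy
  · intro n hn hnot
    have : ¬ q * p ∣ n + (q * p - q) := by
      intro h
      have h1 : q ∣ n := by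
        rw [hsub] at h
        exact (Nat.dvd_add_left (Dvd.intro _ rfl)).1 ((Dvd.intro _ rfl).trans h)
      obtain ⟨m, rfl⟩ := h1
      have hn := mem_Ioc.1 hn
      refine hnot (mem_image.2 ⟨m, mem_Ioc.2 ⟨Nat.pos_of_mul_pos_left hn.1, ?_⟩, rfl⟩)
      rw [Nat.le_div_iff_mul_le hq]
      linarith
    simp [divInd, this]

lemma HasSparseDescents.exists_abs_cntGt_sub_le {g : ℕ → ℝ} (hs : HasSparseDescents g)
    (hg : IsAdditiveR g) {q : ℕ} (hq : IsPrimePow q) {ε : ℝ} (hε : 0 < ε) :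
    ∃ N₀ : ℕ, ∀ N : ℕ, N₀ ≤ N → ∀ c : ℝ,
      |cntGt g c N - q * cntGt g (c - g q) (N / q)| ≤ ε * N := by
  obtain ⟨p, k, hp, hk, rfl⟩ := (isPrimePow_nat_iff q).1 hq
  set q := p ^ k with hqdef
  have hq0 : 0 < q := pow_pos hp.pos k
  have hq1 : (1 : ℝ) ≤ q := by exact_mod_cast hq0
  have hp1 : (1 : ℝ) ≤ p := by exact_mod_cast hp.pos
  set M : ℝ := (q : ℝ) * p with hM
  have hM0 : 0 < M := by positivity
  obtain ⟨N₁, h1⟩ := hs.exists_sum_abs_comp_sub_le (η := ε / (4 * M ^ 2)) (by positivity)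
  refine ⟨max (q * N₁) ⌈8 * M ^ 2 / ε⌉₊, fun N hN c => ?_⟩
  have hN1 := (le_max_left _ _).trans hN
  have hN2 : 8 * M ^ 2 / ε ≤ N := Nat.ceil_le.1 ((le_max_right _ _).trans hN)
  rw [div_le_iff₀ hε] at hN2
  have hdiv : N₁ ≤ N / q := (Nat.le_div_iff_mul_le hq0).2 (by linarith)
  have hdivle : ((N / q : ℕ) : ℝ) ≤ N := by exact_mod_cast Nat.div_le_self N q
  have hη : 0 < ε / (4 * M ^ 2) := by positivity
  have hA := h1 N (by nlinarith) _ (monotone_ite_lt c) (abs_ite_lt_le_one c)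
  have hB := (h1 (N / q) hdiv _ (monotone_ite_lt (c - g q)) (abs_ite_lt_le_one (c - g q))).trans
    (mul_le_mul_of_nonneg_left hdivle hη.le)
  have hA2 := abs_mul_sum_mul_divInd_sub_le (f := fun n => if c < g n then 1 else 0)
    (fun n => abs_ite_lt_le_one _ _) hA
    (r := q * p) (j := q * p - q) (by have := Nat.mul_pos hq0 hp.pos; omega)
  have hB2 := abs_mul_sum_mul_divInd_sub_le (f := fun n => if c - g q < g n then 1 else 0)
    (fun n => abs_ite_lt_le_one _ _) hB
    (r := p) (j := p - 1) (by have := hp.pos; omega)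
  rw [hqdef, hg.sum_progression_eq hp c N, ← hqdef] at hA2
  push_cast at hA2
  rw [← hM] at hA2
  set T := ∑ m ∈ Ioc 0 (N / q), (if c - g q < g m then (1 : ℝ) else 0) * divInd p (m + (p - 1))
    with hT
  set W := ε / (4 * M ^ 2) * N + 2 with hW
  have hWnn : 0 ≤ W := by positivity
  have hWle : 2 * (M ^ 2 * W) ≤ ε * N := by
    have : M ^ 2 * W = ε * N / 4 + 2 * M ^ 2 := by rw [hW]; field_simp
    rw [this]; nlinarith
  have e1 : cntGt g c N - q * cntGt g (c - g q) (N / q) =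
      q * (p * T - cntGt g (c - g q) (N / q)) - (M * T - cntGt g c N) := by rw [hM]; ring
  have e2 : q * ((p : ℝ) ^ 2 * W) ≤ M ^ 2 * W := by
    rw [hM, mul_pow, ← mul_assoc]
    refine mul_le_mul_of_nonneg_right (mul_le_mul_of_nonneg_right ?_ (by positivity)) hWnn
    nlinarith
  rw [e1]
  have e3 := abs_sub (q * (p * T - cntGt g (c - g q) (N / q))) (M * T - cntGt g c N)
  rw [abs_mul, abs_of_nonneg (by positivity : (0 : ℝ) ≤ q)] at e3
  have e4 : (q : ℝ) * |p * T - cntGt g (c - g q) (N / q)| ≤ q * ((p : ℝ) ^ 2 * W) :=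
    mul_le_mul_of_nonneg_left hB2 (by positivity)
  have e5 : |M * T - cntGt g c N| ≤ M ^ 2 * W := hA2
  linarith

lemma HasSparseDescents.exists_abs_cntGt_iterate_sub_le {g : ℕ → ℝ} (hs : HasSparseDescents g)
    (hg : IsAdditiveR g) {q : ℕ} (hq : IsPrimePow q) (K : ℕ) {ε : ℝ} (hε : 0 < ε) :
    ∃ N₀ : ℕ, ∀ N : ℕ, N₀ ≤ N → ∀ c : ℝ,
      |cntGt g c N - q ^ K * cntGt g (c - K * g q) (N / q ^ K)| ≤ ε * N := by
  induction K generalizing ε with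
  | zero => exact ⟨0, fun N _ c => by simp; positivity⟩
  | succ K ih =>
    obtain ⟨N₁, h1⟩ := ih (half_pos hε)
    obtain ⟨N₂, h2⟩ := hs.exists_abs_cntGt_sub_le hg hq (half_pos hε)
    have hq0 : 0 < q ^ K := pow_pos hq.pos K
    refine ⟨max N₁ (N₂ * q ^ K), fun N hN c => ?_⟩
    have e1 := h1 N ((le_max_left _ _).trans hN) c
    have e2 := h2 (N / q ^ K) ((Nat.le_div_iff_mul_le hq0).2 ((le_max_right _ _).trans hN))
      (c - K * g q)
    rw [Nat.div_div_eq_div_mul, ← pow_succ, sub_sub, ← add_one_mul] at e2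
    have e3 := mul_le_mul_of_nonneg_left e2 (by positivity : (0 : ℝ) ≤ (q : ℝ) ^ K)
    rw [← abs_of_nonneg (by positivity : (0 : ℝ) ≤ (q : ℝ) ^ K), ← abs_mul, mul_sub,
      abs_of_nonneg (by positivity : (0 : ℝ) ≤ (q : ℝ) ^ K)] at e3
    have e4 : (q : ℝ) ^ K * (ε / 2 * ((N / q ^ K : ℕ) : ℝ)) ≤ ε / 2 * N := by
      have : (q ^ K : ℝ) * ((N / q ^ K : ℕ) : ℝ) ≤ N := by exact_mod_cast Nat.mul_div_le N (q ^ K)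
      nlinarith
    have e5 := abs_add_le (cntGt g c N - q ^ K * cntGt g (c - K * g q) (N / q ^ K))
      (q ^ K * cntGt g (c - K * g q) (N / q ^ K) -
        q ^ K * (q * cntGt g (c - (K + 1) * g q) (N / q ^ (K + 1))))
    rw [sub_add_sub_cancel] at e5
    rw [pow_succ, mul_assoc]
    push_cast
    linarith

lemma cntGt_eq_card (g : ℕ → ℝ) (c : ℝ) (N : ℕ) :
    cntGt g c N = ((Ioc 0 N).filter (fun n => c < g n)).card := by
  rw [cntGt, sum_boole]

lemma cntGt_le_card {g : ℕ → ℝ} {c m κ : ℝ} {N : ℕ} (h : m + κ ≤ c) :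
    cntGt g c N ≤ ((Ioc 0 N).filter (fun n => κ < |g n - m|)).card := by
  rw [cntGt_eq_card]
  have : (Ioc 0 N).filter (fun n => c < g n) ⊆ (Ioc 0 N).filter (fun n => κ < |g n - m|) := by
    refine monotone_filter_right _ fun n _ hn => ?_
    exact lt_of_lt_of_le (by linarith) (le_abs_self _)
  exact_mod_cast card_le_card this

lemma le_cntGt {g : ℕ → ℝ} {c m κ : ℝ} {N : ℕ} (h : c < m - κ) :
    N - (((Ioc 0 N).filter (fun n => κ < |g n - m|)).card : ℝ) ≤ cntGt g c N := by
  rw [cntGt_eq_card]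
  have hsub : Ioc 0 N ⊆ (Ioc 0 N).filter (fun n => c < g n) ∪
      (Ioc 0 N).filter (fun n => κ < |g n - m|) := by
    intro n hn
    by_cases h1 : κ < |g n - m|
    · exact mem_union_right _ (mem_filter.2 ⟨hn, h1⟩)
    · refine mem_union_left _ (mem_filter.2 ⟨hn, ?_⟩)
      have := (abs_le.1 (not_lt.1 h1)).1
      linarith
  have h1 := (card_le_card hsub).trans (card_union_le _ _)
  rw [Nat.card_Ioc, Nat.sub_zero] at h1
  have h2 : (N : ℝ) ≤ ((Ioc 0 N).filter (fun n => c < g n)).card +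
    ((Ioc 0 N).filter (fun n => κ < |g n - m|)).card := by exact_mod_cast h1
  linarith

lemma HasSparseDescents.eq_zero_of_bounded {g : ℕ → ℝ} (hs : HasSparseDescents g)
    (hg : IsAdditiveR g) {b : ℝ} (hb : ∀ N : ℕ, BgR g N ≤ b) {q : ℕ} (hq : IsPrimePow q) :
    g q = 0 := by
  by_contra hne
  have hb0 : 0 ≤ b := (BgR_nonneg g _).trans (hb 0)
  obtain ⟨C, hC, hbad⟩ := hg.exists_card_lt_abs_sub_le (w := 20) (by norm_num)
  set κ := C + 24 * (b + 1) with hκ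
  have hbad' : ∀ N : ℕ,
      (((Ioc 0 N).filter (fun n => κ < |g n - meanIn g 20 N|)).card : ℝ) ≤ N / 4 := by
    intro N
    have h := hbad N _ (24 * (b + 1)) (by positivity) subset_rfl
    rw [sdiff_self, bot_eq_empty, sum_empty, mul_zero, add_zero] at h
    refine h.trans ?_
    have h1 : sqWt (primesIn 20 N) g ≤ (b + 1) ^ 2 :=
      (sqWt_primesIn_le g 20 N).trans
        (pow_le_pow_left₀ (BgR_nonneg _ _) ((hb N).trans (by linarith)) 2)
    have h2 : 36 * (N : ℝ) * sqWt (primesIn 20 N) g / (24 * (b + 1)) ^ 2 ≤ N / 16 := by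
      rw [div_le_iff₀ (by positivity)]
      nlinarith [mul_le_mul_of_nonneg_left h1 (Nat.cast_nonneg (α := ℝ) N)]
    push_cast
    have : (0 : ℝ) ≤ N := Nat.cast_nonneg N
    linarith
  obtain ⟨K, hK⟩ := exists_nat_gt ((3 * b + 2 * κ + 1) / |g q|)
  rw [div_lt_iff₀ (abs_pos.2 hne)] at hK
  obtain ⟨N₀, hN₀⟩ := hs.exists_abs_cntGt_iterate_sub_le hg hq K (ε := 1 / 8) (by norm_num)
  set r := q ^ K with hr
  have hr0 : 0 < r := pow_pos hq.pos K
  set N := max N₀ (r * (r + 20)) with hN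
  have hNr : r * (r + 20) ≤ N := le_max_right _ _
  have hcnt := hN₀ N (le_max_left _ _)
  set Y := N / r with hY
  have hYge : r + 20 ≤ Y := (Nat.le_div_iff_mul_le hr0).2 (by linarith)
  have hlt : N < r * (Y + 1) := by
    have := Nat.lt_mul_div_succ N hr0
    exact this
  have hYN : Y ≤ N := Nat.div_le_self _ _
  have hNY : N ≤ Y ^ 4 := by
    have h1 : r * (Y + 1) ≤ Y * Y ^ 2 := Nat.mul_le_mul (by omega) (by nlinarith)
    have h2 : Y ^ 3 ≤ Y ^ 4 := Nat.pow_le_pow_right (by omega) (by norm_num)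
    have h3 : Y * Y ^ 2 = Y ^ 3 := by ring
    omega
  have hmean := (abs_meanIn_sub_le (g := g) (w := 20) (by omega : 20 ≤ Y) hYN hNY).trans
    (by linarith [hb N] : 3 * BgR g N ≤ 3 * b)
  have hmean := abs_le.1 hmean
  have hrY : (r : ℝ) * Y ≤ N := by exact_mod_cast Nat.mul_div_le N r
  have hrY2 : (N : ℝ) ≤ r * Y + r := by
    have : (N : ℝ) ≤ r * (Y + 1) := by exact_mod_cast hlt.le
    linarith
  have hr20 : 20 * (r : ℝ) ≤ N := by
    have : (r : ℝ) * (r + 20) ≤ N := by exact_mod_cast hNr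
    nlinarith [sq_nonneg (r : ℝ)]
  have hrpos : (0 : ℝ) < r := by exact_mod_cast hr0
  have hNbad := hbad' N
  have hYbad := hbad' Y
  have hrc : ((q : ℝ) ^ K) = r := by rw [hr]; push_cast; rfl
  rcases lt_or_gt_of_ne hne with h | h
  · rw [abs_of_neg h] at hK
    have h1 := hcnt (meanIn g 20 N - κ - 1)
    rw [hrc] at h1
    have h2 : _ ≤ cntGt g (meanIn g 20 N - κ - 1) N :=
      le_cntGt (m := meanIn g 20 N) (κ := κ) (by linarith)
    have h3 : cntGt g (meanIn g 20 N - κ - 1 - K * g q) Y ≤ _ :=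
      cntGt_le_card (m := meanIn g 20 Y) (κ := κ) (by linarith)
    have h4 := mul_le_mul_of_nonneg_left (h3.trans hYbad) hrpos.le
    have h5 := (abs_le.1 h1).2
    linarith
  · rw [abs_of_pos h] at hK
    have h1 := hcnt (meanIn g 20 N + κ)
    rw [hrc] at h1
    have h2 : cntGt g (meanIn g 20 N + κ) N ≤ _ :=
      cntGt_le_card (m := meanIn g 20 N) (κ := κ) le_rfl
    have h3 : _ ≤ cntGt g (meanIn g 20 N + κ - K * g q) Y :=
      le_cntGt (m := meanIn g 20 Y) (κ := κ) (by linarith)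
    have h4 : (3 * Y / 4 : ℝ) ≤ cntGt g (meanIn g 20 N + κ - K * g q) Y := by linarith
    have h5 := mul_le_mul_of_nonneg_left h4 hrpos.le
    have h6 := (abs_le.1 h1).1
    linarith

lemma IsAdditiveR.eq_zero_of_primePow {g : ℕ → ℝ} (hg : IsAdditiveR g)
    (h : ∀ q, IsPrimePow q → g q = 0) {n : ℕ} (hn : n ≠ 0) : g n = 0 := by
  rw [hg.eq_sum_primeFactors hn]
  refine sum_eq_zero fun p hp => h _ ?_
  obtain ⟨hpp, hpn, -⟩ := Nat.mem_primeFactors.1 hp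
  exact hpp.isPrimePow.pow
    (Nat.one_le_iff_ne_zero.1 ((hpp.dvd_iff_one_le_factorization hn).1 hpn))

/-- Truncation of a real number to `[-K, K]`. -/
noncomputable def clip (K x : ℝ) : ℝ := max (-K) (min K x)

lemma clip_mono (K : ℝ) : Monotone (clip K) := fun _ _ h => max_le_max le_rfl (min_le_min le_rfl h)

lemma abs_clip_le {K : ℝ} (hK : 0 ≤ K) (x : ℝ) : |clip K x| ≤ K :=
  abs_le.2 ⟨le_max_left _ _, max_le (by linarith) (min_le_left _ _)⟩

lemma abs_clip_sub_clip_le (K x y : ℝ) : |clip K x - clip K y| ≤ |x - y| :=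
  by
    rw [clip, clip, max_comm, max_comm (-K), min_comm, min_comm K]
    refine (abs_max_sub_max_le_abs _ _ _).trans ?_
    refine (abs_min_sub_min_le_max _ _ _ _).trans ?_
    simp

lemma clip_of_abs_le {K x : ℝ} (h : |x| ≤ K) : clip K x = x := by
  have := abs_le.1 h
  rw [clip, min_eq_right this.2, max_eq_right this.1]

lemma abs_sub_clip_le_abs {K : ℝ} (hK : 0 ≤ K) (x : ℝ) : |x - clip K x| ≤ |x| := by
  rcases le_or_gt |x| K with h | h
  · rw [clip_of_abs_le h]; simp
  · rcases le_total 0 x with hx | hx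
    · rw [abs_of_nonneg hx] at *
      rw [clip, min_eq_left h.le, max_eq_right (by linarith), abs_of_nonneg] <;> linarith
    · rw [abs_of_nonpos hx] at *
      rw [clip, min_eq_right (by linarith), max_eq_left (by linarith), abs_of_nonpos] <;> linarith

lemma abs_sub_clip_le_sq_div {K : ℝ} (hK : 0 < K) (x : ℝ) : |x - clip K x| ≤ x ^ 2 / K := by
  rcases le_or_gt |x| K with h | h
  · rw [clip_of_abs_le h]; simp; positivity
  · refine (abs_sub_clip_le_abs hK.le x).trans ?_
    rw [le_div_iff₀ hK, ← sq_abs]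
    nlinarith [abs_nonneg x]

lemma abs_mul_sub_clip_le {K M : ℝ} (hK : 0 < K) (hM : 0 < M) (z x : ℝ) :
    |z * (x - clip K x)| ≤ M * (x ^ 2 / K) + (x ^ 2 + z ^ 4) / (2 * M) := by
  rw [abs_mul]
  have h1 := abs_sub_clip_le_sq_div hK x
  have h2 := abs_sub_clip_le_abs hK.le x
  rcases le_or_gt |z| M with h | h
  · have := mul_le_mul h h1 (abs_nonneg _) hM.le
    have : 0 ≤ (x ^ 2 + z ^ 4) / (2 * M) := by positivity
    linarith
  · have h3 : |z| * |x - clip K x| ≤ |z| * |x| := mul_le_mul_of_nonneg_left h2 (abs_nonneg _)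
    have h4 : |z| * |x| ≤ (x ^ 2 + z ^ 4) / (2 * M) := by
      rw [le_div_iff₀ (by positivity), ← sq_abs x, show z ^ 4 = (|z| ^ 2) ^ 2 by rw [sq_abs]; ring]
      nlinarith [sq_nonneg (|x| - |z| ^ 2), abs_nonneg x, abs_nonneg z,
        mul_nonneg (mul_nonneg (abs_nonneg x) (abs_nonneg z)) (by linarith : 0 ≤ |z| - M)]
    have : 0 ≤ M * (x ^ 2 / K) := by positivity
    linarith

lemma sum_abs_le_of_le {P : Finset ℕ} {z : ℕ} (hP : ∀ p ∈ P, p.Prime) (hz : ∀ p ∈ P, p ≤ z)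
    {a : ℕ → ℝ} (ha : sqWt P a ≤ 1) : ∑ p ∈ P, |a p| ≤ z := by
  refine abs_le_of_sq_le_sq' ?_ (Nat.cast_nonneg z) |>.2
  have h1 := sum_sq_le_sum_mul_sum_of_sq_le_mul P (r := fun p => |a p|)
    (f := fun p => a p ^ 2 / (p : ℝ)) (g := fun p => (p : ℝ))
    (fun p _ => by positivity) (fun p _ => by positivity) (fun p hp => by
      have : (p : ℝ) ≠ 0 := by exact_mod_cast (hP p hp).ne_zero
      rw [sq_abs, div_mul_cancel₀ _ this])
  refine h1.trans ?_
  have h2 : ∑ p ∈ P, (p : ℝ) ≤ z * z := by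
    have hsub : P ⊆ Ioc 0 z := fun p hp => mem_Ioc.2 ⟨(hP p hp).pos, hz p hp⟩
    have hc : (P.card : ℝ) ≤ z := by
      have := card_le_card hsub
      rw [Nat.card_Ioc] at this
      exact_mod_cast this
    calc ∑ p ∈ P, (p : ℝ) ≤ ∑ p ∈ P, (z : ℝ) := sum_le_sum fun p hp => by exact_mod_cast hz p hp
      _ = P.card * z := by simp
      _ ≤ z * z := mul_le_mul_of_nonneg_right hc (Nat.cast_nonneg z)
  calc sqWt P a * ∑ p ∈ P, (p : ℝ) ≤ 1 * (z * z) :=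
        mul_le_mul ha h2 (sum_nonneg fun _ _ => by positivity) zero_le_one
    _ = (z : ℝ) ^ 2 := by ring

lemma sum_abs_le_of_sum_sq_le {Z : ℕ → ℝ} {N : ℕ} (h : ∑ n ∈ Ioc 0 N, Z n ^ 2 ≤ 36 * N) :
    ∑ n ∈ Ioc 0 N, |Z n| ≤ 19 * N := by
  have h1 : ∀ n ∈ Ioc 0 N, |Z n| ≤ (1 + Z n ^ 2) / 2 := fun n _ => by
    rw [← sq_abs]; nlinarith [sq_nonneg (|Z n| - 1)]
  refine (sum_le_sum h1).trans ?_
  rw [← sum_div, sum_add_distrib]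
  simp only [sum_const, Nat.card_Ioc, nsmul_eq_mul]
  have : (0 : ℝ) ≤ N := Nat.cast_nonneg N
  simp only [Nat.sub_zero]
  linarith

/-- Sums over primes of large index are nearly orthogonal to any `Z` with bounded fourth moment. -/
lemma abs_sum_mul_xiSum_le_of_sum_inv_le {R : Finset ℕ} {N : ℕ} {a Z : ℕ → ℝ} {s C : ℝ}
    (hs : 0 < s) (hs1 : s ≤ 1) (hR : ∀ p ∈ R, p.Prime) (hRN : ∀ p ∈ R, p ≤ N) (ha : sqWt R a ≤ 1)
    (hinv : ∑ p ∈ R, 1 / (p : ℝ) ≤ s ^ 4) (hZ2 : ∑ n ∈ Ioc 0 N, Z n ^ 2 ≤ 36 * N)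
    (hZ4 : ∑ n ∈ Ioc 0 N, Z n ^ 4 ≤ C * N) :
    |∑ n ∈ Ioc 0 N, Z n * xiSum R a n| ≤ (57 + C / 4) * s * N := by
  have hN0 : (0 : ℝ) ≤ N := Nat.cast_nonneg N
  set α := ∑ p ∈ R, a p / (p : ℝ) with hα
  set V : ℕ → ℝ := fun n => ∑ p ∈ R, a p * divInd p n with hV
  set d : ℕ → ℝ := fun n => ∑ p ∈ R, divInd p n with hd
  have hα2 : |α| ≤ s ^ 2 := by
    refine abs_le_of_sq_le_sq ?_ (by positivity)
    calc α ^ 2 ≤ sqWt R a * ∑ p ∈ R, 1 / (p : ℝ) := sum_div_sq_le R a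
      _ ≤ 1 * s ^ 4 := mul_le_mul ha hinv (sum_nonneg fun _ _ => by positivity) zero_le_one
      _ = (s ^ 2) ^ 2 := by ring
  have hs2 : s ^ 2 ≤ s := by nlinarith
  have hα1 : |α| ≤ 1 := by linarith
  have hU : ∀ n, xiSum R a n = V n - α := fun n => xiSum_eq R a n
  have hU2 : ∑ n ∈ Ioc 0 N, xiSum R a n ^ 2 ≤ 36 * N := by
    refine (sum_xiSum_sq_le hR hRN a).trans ?_
    nlinarith
  have hV2 : ∑ n ∈ Ioc 0 N, V n ^ 2 ≤ 74 * N := by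
    have : ∀ n ∈ Ioc 0 N, V n ^ 2 ≤ 2 * xiSum R a n ^ 2 + 2 := by
      intro n _
      have h1 : V n = xiSum R a n + α := by rw [hU]; ring
      have h2 : α ^ 2 ≤ 1 := by rw [← sq_abs]; nlinarith [abs_nonneg α]
      rw [h1]
      nlinarith [sq_nonneg (xiSum R a n - α)]
    refine (sum_le_sum this).trans ?_
    rw [sum_add_distrib, ← mul_sum]
    simp
    linarith
  have hd1 : ∑ n ∈ Ioc 0 N, d n ≤ s ^ 4 * N := by
    rw [hd, sum_comm]
    calc _ ≤ ∑ p ∈ R, N * (1 / (p : ℝ)) := sum_le_sum fun p _ =>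
          (sum_divInd_le p N).trans_eq (by ring)
      _ ≤ _ := by rw [← mul_sum]; nlinarith
  have hpt : ∀ n, |Z n * V n| ≤ s / 2 * V n ^ 2 + s / 4 * Z n ^ 4 + d n / (4 * s ^ 3) := by
    intro n
    have hd0 : 0 ≤ d n := sum_nonneg fun _ _ => divInd_nonneg _ _
    by_cases h : ∃ p ∈ R, p ∣ n
    · obtain ⟨p, hp, hpn⟩ := h
      have hdn : 1 ≤ d n := by
        have := single_le_sum (f := fun p => divInd p n) (fun _ _ => divInd_nonneg _ _) hp
        exact (if_pos hpn : divInd p n = 1).symm.trans_le this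
      have h1 : d n / (4 * s ^ 3) ≥ 1 / (4 * s ^ 3) := by gcongr
      have h2 : |Z n * V n| ≤ s / 2 * V n ^ 2 + Z n ^ 2 / (2 * s) := by
        have := abs_mul_le_of_pos hs (Z n) (V n)
        linarith
      have h3 : Z n ^ 2 / (2 * s) ≤ s / 4 * Z n ^ 4 + 1 / (4 * s ^ 3) := by
        have h4 : s / 4 * Z n ^ 4 + 1 / (4 * s ^ 3) - Z n ^ 2 / (2 * s) =
            (s ^ 2 * Z n ^ 2 - 1) ^ 2 / (4 * s ^ 3) := by field_simp; ring
        have : 0 ≤ (s ^ 2 * Z n ^ 2 - 1) ^ 2 / (4 * s ^ 3) := by positivity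
        linarith
      linarith
    · have hV0 : V n = 0 := sum_eq_zero fun p hp => by
        have : ¬ p ∣ n := fun hh => h ⟨p, hp, hh⟩
        simp [divInd, this]
      rw [hV0]
      simp
      positivity
  have hmain : |∑ n ∈ Ioc 0 N, Z n * V n| ≤
      s / 2 * (74 * N) + s / 4 * (C * N) + s ^ 4 * N / (4 * s ^ 3) := by
    refine (abs_sum_le_sum_abs _ _).trans ((sum_le_sum fun n _ => hpt n).trans ?_)
    rw [sum_add_distrib, sum_add_distrib, ← mul_sum, ← mul_sum, ← sum_div]
    gcongr
  have hconst : |∑ n ∈ Ioc 0 N, Z n * α| ≤ s * (19 * N) := by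
    rw [← sum_mul, abs_mul, mul_comm]
    refine mul_le_mul (hα2.trans hs2) ?_ (abs_nonneg _) hs.le
    exact (abs_sum_le_sum_abs _ _).trans (sum_abs_le_of_sum_sq_le hZ2)
  have heq : ∑ n ∈ Ioc 0 N, Z n * xiSum R a n =
      ∑ n ∈ Ioc 0 N, Z n * V n - ∑ n ∈ Ioc 0 N, Z n * α := by
    rw [← sum_sub_distrib]
    exact sum_congr rfl fun n _ => by rw [hU]; ring
  rw [heq]
  refine (abs_sub _ _).trans ((add_le_add hmain hconst).trans ?_)
  have : s ^ 4 * N / (4 * s ^ 3) = s * N / 4 := by field_simp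
  rw [this]
  nlinarith [mul_nonneg hs.le hN0]

lemma xiSum_sub_eq {P Q : Finset ℕ} (h : Q ⊆ P) (a : ℕ → ℝ) (y n : ℕ) :
    xiSum P a n - xiSum Q a n =
      xiSum ((P \ Q).filter (· ≤ y)) a n + xiSum ((P \ Q).filter (fun p => ¬ p ≤ y)) a n := by
  unfold xiSum
  rw [sum_filter_add_sum_filter_not, ← sum_sdiff h, add_sub_cancel_right]

lemma sum_xiSum_sq_le_of_approx {P Q E : Finset ℕ} {N z y : ℕ} {a f : ℕ → ℝ}
    {M₀ M K s s₁ e ε : ℝ} (hM : 0 < M) (hK : 0 < K) (hs : 0 < s) (hs1 : s ≤ 1) (hs₁ : 0 < s₁)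
    (he : 0 ≤ e) (hP : ∀ p ∈ P, p.Prime) (hPN : ∀ p ∈ P, p ≤ N) (hQP : Q ⊆ P)
    (hQz : ∀ p ∈ Q, p ≤ z) (hzN : z ^ 4 ≤ N) (hQa : ∀ p ∈ Q, |a p| ≤ M₀) (ha : sqWt P a ≤ 1)
    (hinv : ∑ p ∈ P.filter (fun p => ¬ p ≤ y), 1 / (p : ℝ) ≤ s ^ 4) (hf : ∀ n, |f n| ≤ K)
    (hE : E ⊆ Ioc 0 N)
    (hfG : ∀ n ∈ Ioc 0 N, n ∉ E → |clip K (xiSum P a n) - f n| ≤ e)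
    (hcor : |∑ n ∈ Ioc 0 N, f n * xiSum Q a n| ≤ ε * N) :
    ∑ n ∈ Ioc 0 N, xiSum Q a n ^ 2 ≤
      (ε + 19 * e + 36 * K * s₁ + 36 * M / K + (56 + 6 * M₀ ^ 2) / (2 * M) +
        (62 + 2 * M₀ ^ 2) * s) * N + K * E.card / s₁ + 2 * z * y := by
  have hN0 : (0 : ℝ) ≤ N := Nat.cast_nonneg N
  have hQ : ∀ p ∈ Q, p.Prime := fun p hp => hP p (hQP hp)
  have haQ : sqWt Q a ≤ 1 := (sqWt_mono hQP a).trans ha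
  set C := 20 + 6 * M₀ ^ 2 with hC
  set Z := xiSum Q a with hZ
  set G := xiSum P a with hG
  have hZ2 : ∑ n ∈ Ioc 0 N, Z n ^ 2 ≤ 36 * N := by
    refine (sum_xiSum_sq_le hQ (fun p hp => hPN p (hQP hp)) a).trans ?_
    nlinarith
  have hG2 : ∑ n ∈ Ioc 0 N, G n ^ 2 ≤ 36 * N := by
    refine (sum_xiSum_sq_le hP hPN a).trans ?_
    nlinarith
  have hZ4 : ∑ n ∈ Ioc 0 N, Z n ^ 4 ≤ C * N := sum_xiSum_pow_four_le hQ
    (fun p hp => (Nat.pow_le_pow_left (hQz p hp) 4).trans hzN) hQa haQ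
  have hZ1 := sum_abs_le_of_sum_sq_le hZ2
  have h1 : |∑ n ∈ Ioc 0 N, Z n * (clip K (G n) - f n)| ≤
      e * (19 * N) + (K * s₁ * (36 * N) + K * E.card / s₁) := by
    have hpt : ∀ n ∈ Ioc 0 N, |Z n * (clip K (G n) - f n)| ≤
        e * |Z n| + (K * s₁ * Z n ^ 2 + if n ∈ E then K / s₁ else 0) := by
      intro n hn
      by_cases hnE : n ∈ E
      · rw [if_pos hnE, abs_mul]
        have h2 : |clip K (G n) - f n| ≤ 2 * K :=
          (abs_sub _ _).trans (by linarith [abs_clip_le hK.le (G n), hf n])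
        have h3 : |Z n| * |clip K (G n) - f n| ≤ |Z n| * (2 * K) :=
          mul_le_mul_of_nonneg_left h2 (abs_nonneg _)
        have h4 : |Z n| * (2 * K) ≤ K * s₁ * Z n ^ 2 + K / s₁ := by
          have : K * s₁ * Z n ^ 2 + K / s₁ - |Z n| * (2 * K) = K * (s₁ * |Z n| - 1) ^ 2 / s₁ := by
            rw [← sq_abs (Z n)]; field_simp; ring
          have : 0 ≤ K * (s₁ * |Z n| - 1) ^ 2 / s₁ := by positivity
          linarith
        have : 0 ≤ e * |Z n| := by positivity
        linarith
      · rw [if_neg hnE, abs_mul, mul_comm]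
        have := mul_le_mul_of_nonneg_right (hfG n hn hnE) (abs_nonneg (Z n))
        have : 0 ≤ K * s₁ * Z n ^ 2 := by positivity
        linarith
    refine (abs_sum_le_sum_abs _ _).trans ((sum_le_sum hpt).trans ?_)
    rw [sum_add_distrib, sum_add_distrib, ← mul_sum, ← mul_sum, ← sum_filter, filter_mem_eq_inter,
      inter_eq_right.2 hE, sum_const, nsmul_eq_mul, mul_div_assoc', mul_comm (E.card : ℝ)]
    gcongr
  have h2 : |∑ n ∈ Ioc 0 N, Z n * (G n - clip K (G n))| ≤
      M / K * (36 * N) + (36 * N + C * N) / (2 * M) := by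
    refine (abs_sum_le_sum_abs _ _).trans
      ((sum_le_sum fun n _ => abs_mul_sub_clip_le hK hM (Z n) (G n)).trans ?_)
    rw [sum_add_distrib, ← mul_sum, ← sum_div, ← sum_div, sum_add_distrib, mul_div_assoc',
      div_mul_eq_mul_div]
    gcongr
  set R₁ := (P \ Q).filter (· ≤ y) with hR₁
  set R₂ := (P \ Q).filter (fun p => ¬ p ≤ y) with hR₂
  have hR₁P : R₁ ⊆ P := (filter_subset _ _).trans sdiff_subset
  have hR₂P : R₂ ⊆ P := (filter_subset _ _).trans sdiff_subset
  have h3 : |∑ n ∈ Ioc 0 N, Z n * xiSum R₁ a n| ≤ 2 * z * y := by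
    have hdisj : Disjoint Q R₁ := disjoint_sdiff.mono_right (filter_subset _ _)
    refine (abs_sum_xiSum_mul_xiSum_le_of_disjoint hQ (fun p hp => hP p (hR₁P hp))
      hdisj a a N).trans ?_
    have e1 := sum_abs_le_of_le hQ hQz haQ
    have e2 := sum_abs_le_of_le (fun p hp => hP p (hR₁P hp)) (fun p hp => (mem_filter.1 hp).2)
      ((sqWt_mono hR₁P a).trans ha)
    have := mul_le_mul e1 e2 (sum_nonneg fun _ _ => abs_nonneg _) (Nat.cast_nonneg z)
    linarith
  have h4 : |∑ n ∈ Ioc 0 N, Z n * xiSum R₂ a n| ≤ (57 + C / 4) * s * N := by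
    refine abs_sum_mul_xiSum_le_of_sum_inv_le hs hs1 (fun p hp => hP p (hR₂P hp))
      (fun p hp => hPN p (hR₂P hp)) ((sqWt_mono hR₂P a).trans ha) ?_ hZ2 hZ4
    refine le_trans (sum_le_sum_of_subset_of_nonneg ?_ fun _ _ _ => by positivity) hinv
    exact filter_subset_filter _ sdiff_subset
  have key : ∑ n ∈ Ioc 0 N, Z n ^ 2 = ∑ n ∈ Ioc 0 N, f n * Z n +
      ∑ n ∈ Ioc 0 N, Z n * (clip K (G n) - f n) + ∑ n ∈ Ioc 0 N, Z n * (G n - clip K (G n)) -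
      ∑ n ∈ Ioc 0 N, Z n * xiSum R₁ a n - ∑ n ∈ Ioc 0 N, Z n * xiSum R₂ a n := by
    rw [← sum_add_distrib, ← sum_add_distrib, ← sum_sub_distrib, ← sum_sub_distrib]
    refine sum_congr rfl fun n _ => ?_
    have := xiSum_sub_eq hQP a y n
    rw [← hR₁, ← hR₂] at this
    linear_combination -Z n * this
  have e0 := (abs_le.1 hcor).2
  have e1 := (abs_le.1 h1).2
  have e2 := (abs_le.1 h2).2
  have e3 := (abs_le.1 h3).1
  have e4 := (abs_le.1 h4).1
  have e5 : (36 * N + C * N) / (2 * M) = (56 + 6 * M₀ ^ 2) / (2 * M) * N := by rw [hC]; ring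
  have e6 : M / K * (36 * N) = 36 * M / K * N := by ring
  have e7 : (57 + C / 4) * s * N ≤ (62 + 2 * M₀ ^ 2) * s * N := by
    refine mul_le_mul_of_nonneg_right (mul_le_mul_of_nonneg_right ?_ hs.le) hN0
    rw [hC]; nlinarith [sq_nonneg M₀]
  rw [key]
  rw [e5, e6] at e2
  linarith

lemma sqWt_div (P : Finset ℕ) (g : ℕ → ℝ) (β : ℝ) :
    sqWt P (fun p => g p / β) = sqWt P g / β ^ 2 := by
  rw [sqWt, sqWt, sum_div]
  exact sum_congr rfl fun p _ => by rw [div_pow, div_right_comm]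

set_option maxHeartbeats 1000000 in
/-- Small primes at which `g` is not too large carry a negligible part of the variance. -/
lemma HasSparseDescents.exists_sqWt_le {g : ℕ → ℝ} (hs : HasSparseDescents g)
    (hg : IsAdditiveR g) {τ M₀ : ℝ} (hτ : 0 < τ) :
    ∃ (δ β₀ : ℝ) (w z₀ N₀ : ℕ), 0 < δ ∧ δ ≤ 1 / 4 ∧ ∀ N : ℕ, N₀ ≤ N → ∀ β : ℝ, β₀ ≤ β → 0 < β →
      BgR g N ≤ β → ∀ z : ℕ, z₀ ≤ z → Real.log z ≤ δ * Real.log N → ∀ Q ⊆ primesIn w z,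
        (∀ p ∈ Q, |g p| ≤ M₀ * β) → sqWt Q g ≤ τ * β ^ 2 := by
  set t := τ / 32 with ht
  have ht0 : 0 < t := by positivity
  set M := (56 + 6 * M₀ ^ 2) / (2 * t) with hM
  have hM0 : 0 < M := by positivity
  set K := 36 * M / t with hK
  have hK0 : 0 < K := by positivity
  set s := min 1 (t / (62 + 2 * M₀ ^ 2)) with hsdef
  have hs0 : 0 < s := lt_min one_pos (by positivity)
  have hst : (62 + 2 * M₀ ^ 2) * s ≤ t := by
    have := (le_div_iff₀ (by positivity)).1 (min_le_right 1 (t / (62 + 2 * M₀ ^ 2)))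
    linarith
  set s₁ := t / (36 * K) with hs₁
  have hs₁0 : 0 < s₁ := by positivity
  obtain ⟨w₁, N₁, hcor⟩ := hs.exists_abs_sum_comp_mul_xiSum_le (ε := t / K) (by positivity)
  obtain ⟨w₂, hw₂⟩ := exists_nat_ge (2 * K / (s₁ * t))
  set w := max (max w₁ w₂) 1 with hw
  have hw1 : 1 ≤ w := le_max_right _ _
  have hww₁ : w₁ ≤ w := (le_max_left _ _).trans (le_max_left _ _)
  have hww₂ : 2 * K / (s₁ * t) ≤ w := hw₂.trans (by
    exact_mod_cast (le_max_right w₁ w₂).trans (le_max_left _ _))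
  have hw0 : (0 : ℝ) < w := by exact_mod_cast hw1
  obtain ⟨C, hC, hdec⟩ := hg.exists_abs_sub_sum_le hw1
  obtain ⟨δ, hδ, hδ4, N₂, hδs⟩ := exists_sum_primesIn_div_le (s := s ^ 4) (by positivity)
  obtain ⟨N₃, hN₃1, hN₃⟩ := exists_forall_le_sqrt 8
  obtain ⟨z₀, hz₀⟩ := exists_nat_ge (2 / t)
  refine ⟨δ, 19 * C / t, w, max z₀ 1, max (max N₁ N₂) N₃, hδ, hδ4,
    fun N hN β hβ₀ hβ hBβ z hz hzN Q hQ hQM => ?_⟩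
  have hNN₁ : N₁ ≤ N := (le_max_left _ _).trans ((le_max_left _ _).trans hN)
  have hNN₂ : N₂ ≤ N := (le_max_right _ _).trans ((le_max_left _ _).trans hN)
  have hNN₃ : N₃ ≤ N := (le_max_right _ _).trans hN
  have hN1 : 1 ≤ N := hN₃1.trans hNN₃
  have hNpos : (0 : ℝ) < N := by exact_mod_cast hN1
  have hz1 : 1 ≤ z := (le_max_right _ _).trans hz
  have hzpos : (0 : ℝ) < z := by exact_mod_cast hz1
  have hz4 : z ^ 4 ≤ N := by
    have h1 : Real.log ((z : ℝ) ^ 4) ≤ Real.log N := by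
      rw [Real.log_pow]
      have : 0 ≤ Real.log N := Real.log_nonneg (by exact_mod_cast hN1)
      push_cast
      nlinarith
    have := (Real.log_le_log_iff (by positivity) hNpos).1 h1
    exact_mod_cast this
  have hzN' : z ≤ N := (Nat.le_self_pow (by norm_num) z).trans hz4
  obtain ⟨E, hE, hEc, hEn⟩ := hdec N
  set P := primesIn w N with hP
  set a : ℕ → ℝ := fun p => g p / β with ha
  set α := ∑ p ∈ P, a p / (p : ℝ) with hα
  set y := N / z ^ 2 with hy
  have hQP : Q ⊆ P := hQ.trans (primesIn_subset le_rfl hzN')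
  have hPa : sqWt P a ≤ 1 := by
    rw [ha, sqWt_div, div_le_one (by positivity)]
    exact (sqWt_primesIn_le g w N).trans (pow_le_pow_left₀ (BgR_nonneg _ _) hBβ 2)
  have hmono : Monotone fun x => clip K (x / β - α) / K := by
    intro x x' h
    exact div_le_div_of_nonneg_right (clip_mono K (by gcongr)) hK0.le
  have hφ1 : ∀ x, |clip K (x / β - α) / K| ≤ 1 := fun x => by
    rw [abs_div, abs_of_pos hK0, div_le_one hK0]
    exact abs_clip_le hK0.le _
  have hcorN := hcor N hNN₁ _ hmono hφ1 Q a (fun p hp => prime_of_mem_primesIn (hQ hp))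
    (fun p hp => hww₁.trans_lt (lt_of_mem_primesIn (hQ hp)))
    (fun p hp => (Nat.pow_le_pow_left (le_of_mem_primesIn (hQ hp)) 4).trans hz4)
    ((sqWt_mono hQP a).trans hPa)
  have hcor' : |∑ n ∈ Ioc 0 N, clip K (g n / β - α) * xiSum Q a n| ≤ t * N := by
    have h1 : ∑ n ∈ Ioc 0 N, clip K (g n / β - α) * xiSum Q a n =
        K * ∑ n ∈ Ioc 0 N, clip K (g n / β - α) / K * xiSum Q a n := by
      rw [mul_sum]
      exact sum_congr rfl fun n _ => by field_simp
    rw [h1, abs_mul, abs_of_pos hK0]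
    calc _ ≤ K * (t / K * N) := mul_le_mul_of_nonneg_left hcorN hK0.le
      _ = t * N := by field_simp
  have hinv : ∑ p ∈ P.filter (fun p => ¬ p ≤ y), 1 / (p : ℝ) ≤ s ^ 4 := by
    refine le_trans (sum_le_sum_of_subset_of_nonneg (fun p hp => ?_) fun _ _ _ => by positivity)
      (hδs N hNN₂ z hz1 hzN)
    obtain ⟨h1, h2⟩ := mem_filter.1 hp
    exact mem_primesIn.2 ⟨⟨not_le.1 h2, le_of_mem_primesIn h1⟩, prime_of_mem_primesIn h1⟩
  have happ : ∀ n ∈ Ioc 0 N, n ∉ E →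
      |clip K (xiSum P a n) - clip K (g n / β - α)| ≤ C / β := by
    intro n hn hnE
    refine (abs_clip_sub_clip_le _ _ _).trans ?_
    have h1 := hEn n hn hnE
    have h2 : xiSum P a n - (g n / β - α) = -(g n - ∑ p ∈ P, g p * divInd p n) / β := by
      rw [xiSum_eq, neg_sub, sub_div, sum_div]
      simp only [ha, hα, div_mul_eq_mul_div]
      ring
    rw [h2, abs_div, abs_neg, abs_of_pos hβ]
    gcongr
  have hmain := sum_xiSum_sq_le_of_approx (M₀ := M₀) (s := s) (s₁ := s₁) (e := C / β) (ε := t)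
    (f := fun n => clip K (g n / β - α))
    (y := y) hM0 hK0 hs0 (min_le_left _ _) hs₁0 (by positivity)
    (fun p hp => prime_of_mem_primesIn hp) (fun p hp => le_of_mem_primesIn hp) hQP
    (fun p hp => le_of_mem_primesIn (hQ hp)) hz4
    (fun p hp => by rw [ha]; simp only; rw [abs_div, abs_of_pos hβ, div_le_iff₀ hβ]; exact hQM p hp)
    hPa hinv (fun n => abs_clip_le hK0.le _) hE happ hcor'
  have hQpr : ∀ p ∈ Q, p.Prime := fun p hp => prime_of_mem_primesIn (hQ hp)
  have hQ4 : ∀ p ∈ Q, p ^ 4 ≤ N := fun p hp =>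
    (Nat.pow_le_pow_left (le_of_mem_primesIn (hQ hp)) 4).trans hz4
  have hlow := le_sum_xiSum_sq hQpr a N
  have habs := sum_abs_sq_le hQpr hQ4 a
  have b1 : 19 * (C / β) ≤ t := by
    rw [div_le_iff₀ ht0] at hβ₀
    rw [mul_div_assoc', div_le_iff₀ hβ]
    linarith
  have b2 : 36 * K * s₁ = t := by rw [hs₁]; field_simp
  have b3 : 36 * M / K = t := by rw [hK]; field_simp
  have b4 : (56 + 6 * M₀ ^ 2) / (2 * M) = t := by rw [hM]; field_simp
  have b5 : K * E.card / s₁ ≤ t * N := by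
    rw [div_le_iff₀ hs₁0]
    have h1 : K * E.card ≤ K * (2 * N / w) := mul_le_mul_of_nonneg_left hEc hK0.le
    have h2 : K * (2 * N / w) ≤ t * N * s₁ := by
      rw [div_le_iff₀ (by positivity)] at hww₂
      rw [mul_div_assoc', div_le_iff₀ hw0]
      have := mul_le_mul_of_nonneg_left hww₂ hNpos.le
      linarith
    linarith
  have b6 : 2 * (z : ℝ) * y ≤ t * N := by
    have h1 : (z : ℝ) ^ 2 * y ≤ N := by exact_mod_cast Nat.mul_div_le N (z ^ 2)
    have h2 : 2 / t ≤ z := hz₀.trans (by exact_mod_cast (le_max_left _ _).trans hz)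
    rw [div_le_iff₀ ht0] at h2
    have h3 : (0 : ℝ) ≤ z * y := by positivity
    have h4 : 2 * ((z : ℝ) * y) ≤ z * t * (z * y) := mul_le_mul_of_nonneg_right h2 h3
    have h5 := mul_le_mul_of_nonneg_left h1 ht0.le
    linarith
  have b7 : ∑ n ∈ Ioc 0 N, xiSum Q a n ^ 2 ≤ 8 * t * N := by
    refine hmain.trans ?_
    rw [b2, b3, b4]
    have : (t + 19 * (C / β) + t + t + t + (62 + 2 * M₀ ^ 2) * s) * N ≤
        (t + t + t + t + t + t) * N := by gcongr
    linarith
  have hsq := hN₃ N hNN₃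
  have hsq2 := Real.mul_self_sqrt (Nat.cast_nonneg (α := ℝ) N)
  have hw_nn := sqWt_nonneg Q a
  have b8 : N / 4 * sqWt Q a ≤ 8 * t * N := by
    have h1 : 2 * √(N : ℝ) ≤ N / 4 := by nlinarith
    have h2 : 2 * √(N : ℝ) * sqWt Q a ≤ N / 4 * sqWt Q a := mul_le_mul_of_nonneg_right h1 hw_nn
    linarith
  have b9 : sqWt Q a ≤ τ := by
    have : τ = 32 * t := by rw [ht]; ring
    rw [this]
    by_contra h
    have := mul_lt_mul_of_pos_left (not_le.1 h) (by positivity : (0 : ℝ) < N / 4)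
    linarith
  rwa [ha, sqWt_div, div_le_iff₀ (by positivity)] at b9

/-- On short initial segments `g` concentrates at the scale of the long one. -/
lemma HasSparseDescents.exists_card_lt_abs_sub_le {g : ℕ → ℝ} (hs : HasSparseDescents g)
    (hg : IsAdditiveR g) {κ : ℝ} (hκ : 0 < κ) :
    ∃ (δ β₀ : ℝ) (Y₀ N₀ : ℕ), 0 < δ ∧ ∀ N : ℕ, N₀ ≤ N → ∀ β : ℝ, β₀ ≤ β → 0 < β →
      BgR g N ≤ β → ∀ Y : ℕ, Y₀ ≤ Y → Real.log Y ≤ δ * Real.log N → ∃ m : ℝ,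
        (((Ioc 0 Y).filter (fun n => κ * β < |g n - m|)).card : ℝ) ≤ κ * Y := by
  set M₀ := 1 + 3 / κ with hM₀
  have hM₀0 : 0 < M₀ := by positivity
  have hM₀2 : 1 / M₀ ^ 2 ≤ κ / 3 := by
    have h1 : 3 / κ ≤ M₀ ^ 2 := by
      have : 0 < 3 / κ := by positivity
      nlinarith
    rw [div_le_iff₀ hκ] at h1
    rw [div_le_iff₀ (by positivity)]
    linarith
  obtain ⟨δ, β₁, w₁, z₀, N₀, hδ, hδ4, hB⟩ :=
    hs.exists_sqWt_le hg (τ := κ ^ 3 / 432) (M₀ := M₀) (by positivity)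
  obtain ⟨w₂, hw₂⟩ := exists_nat_ge (6 / κ)
  set w := max (max w₁ w₂) 1 with hw
  have hw1 : 1 ≤ w := le_max_right _ _
  have hww₁ : w₁ ≤ w := (le_max_left _ _).trans (le_max_left _ _)
  have hww₂ : 6 / κ ≤ w := hw₂.trans (by
    exact_mod_cast (le_max_right w₁ w₂).trans (le_max_left _ _))
  have hw0 : (0 : ℝ) < w := by exact_mod_cast hw1
  obtain ⟨C, hC, hcard⟩ := hg.exists_card_lt_abs_sub_le hw1
  refine ⟨δ, max β₁ (2 * C / κ), max z₀ 1, max N₀ 1, hδ, fun N hN β hβ hβ0 hBβ Y hY hYN => ?_⟩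
  have hN1 : 1 ≤ N := (le_max_right _ _).trans hN
  have hY1 : 1 ≤ Y := (le_max_right _ _).trans hY
  have hNpos : (0 : ℝ) < N := by exact_mod_cast hN1
  have hYpos : (0 : ℝ) < Y := by exact_mod_cast hY1
  have hYN' : (Y : ℝ) ≤ N := by
    rw [← Real.log_le_log_iff hYpos hNpos]
    have : 0 ≤ Real.log N := Real.log_nonneg (by exact_mod_cast hN1)
    nlinarith
  set Q := (primesIn w Y).filter (fun p => |g p| ≤ M₀ * β) with hQ
  have hQsub : Q ⊆ primesIn w Y := filter_subset _ _
  have hQwt := hB N ((le_max_left _ _).trans hN) β ((le_max_left _ _).trans hβ) hβ0 hBβ Y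
    ((le_max_left _ _).trans hY) hYN Q (hQsub.trans (primesIn_subset hww₁ le_rfl))
    (fun p hp => (mem_filter.1 hp).2)
  have hBY : BgR g Y ≤ β := (BgR_mono g hYN').trans hBβ
  have hsd : ∑ p ∈ primesIn w Y \ Q, 1 / (p : ℝ) ≤ κ / 3 := by
    refine le_trans ?_ hM₀2
    rw [le_div_iff₀ (by positivity)]
    have h1 : (∑ p ∈ primesIn w Y \ Q, 1 / (p : ℝ)) * (M₀ ^ 2 * β ^ 2) ≤ sqWt (primesIn w Y) g := by
      refine le_trans ?_ (sum_le_sum_of_subset_of_nonneg sdiff_subset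
        fun _ _ _ => by positivity : sqWt (primesIn w Y \ Q) g ≤ _)
      rw [sum_mul]
      refine sum_le_sum fun p hp => ?_
      obtain ⟨hp1, hp2⟩ := mem_sdiff.1 hp
      have h3 : M₀ * β < |g p| := by
        by_contra h
        exact hp2 (mem_filter.2 ⟨hp1, not_lt.1 h⟩)
      have h4 : (M₀ * β) ^ 2 ≤ g p ^ 2 := by
        rw [← sq_abs (g p)]
        exact pow_le_pow_left₀ (by positivity) h3.le 2
      rw [div_mul_eq_mul_div, one_mul, ← mul_pow]
      exact div_le_div_of_nonneg_right h4 (Nat.cast_nonneg p)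
    have h2 := h1.trans ((sqWt_primesIn_le g w Y).trans
      (pow_le_pow_left₀ (BgR_nonneg _ _) hBY 2))
    rw [← mul_assoc] at h2
    have hβ2 : 0 < β ^ 2 := by positivity
    by_contra h
    have := mul_lt_mul_of_pos_right (not_le.1 h) hβ2
    linarith
  have hc := hcard Y Q (κ * β / 2) (by positivity) hQsub
  refine ⟨∑ p ∈ Q, g p / (p : ℝ), ?_⟩
  have hCβ : C + κ * β / 2 ≤ κ * β := by
    have := (le_max_right _ _).trans hβ
    rw [div_le_iff₀ hκ] at this
    linarith
  have hmono : (((Ioc 0 Y).filter (fun n => κ * β < |g n - ∑ p ∈ Q, g p / (p : ℝ)|)).card : ℝ) ≤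
      ((Ioc 0 Y).filter (fun n => C + κ * β / 2 < |g n - ∑ p ∈ Q, g p / (p : ℝ)|)).card := by
    exact_mod_cast card_le_card (monotone_filter_right _ fun n _ h => hCβ.trans_lt h)
  have b1 : 2 * (Y : ℝ) / w ≤ κ / 3 * Y := by
    rw [div_le_iff₀ hκ] at hww₂
    rw [div_le_iff₀ hw0]
    have := mul_le_mul_of_nonneg_left hww₂ hYpos.le
    linarith
  have b2 : Y * ∑ p ∈ primesIn w Y \ Q, 1 / (p : ℝ) ≤ κ / 3 * Y := by
    rw [mul_comm]
    exact mul_le_mul_of_nonneg_right hsd hYpos.le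
  have b3 : 36 * Y * sqWt Q g / (κ * β / 2) ^ 2 ≤ κ / 3 * Y := by
    rw [div_le_iff₀ (by positivity)]
    have := mul_le_mul_of_nonneg_left hQwt hYpos.le
    have h2 : κ / 3 * Y * (κ * β / 2) ^ 2 = 36 * (Y * (κ ^ 3 / 432 * β ^ 2)) := by ring
    rw [h2]
    linarith
  linarith

lemma HasSparseDescents.exists_sum_midPrimes_abs_le {g : ℕ → ℝ} (hs : HasSparseDescents g)
    {ε : ℝ} (hε : 0 < ε) : ∃ N₀ : ℕ, ∀ N : ℕ, N₀ ≤ N → ∀ φ : ℝ → ℝ, Monotone φ →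
      (∀ x, |φ x| ≤ 1) →
      ∑ p ∈ midPrimes N, |∑ n ∈ Ioc 0 N, φ (g n) * xi p n| ≤ 2 * (ε * N) := by
  obtain ⟨w, N₁, h1⟩ := hs.exists_abs_sum_comp_mul_xiSum_le hε
  obtain ⟨N₂, h2⟩ := exists_sum_midPrimes_bounds
  refine ⟨max (max N₁ N₂) (w ^ 8), fun N hN φ hφ hφ1 => ?_⟩
  have hN1 : N₁ ≤ N := by omega
  have hN2 : N₂ ≤ N := by omega
  have hN3 : w ^ 8 ≤ N := by omega
  set U : ℕ → ℝ := fun p => ∑ n ∈ Ioc 0 N, φ (g n) * xi p n with hU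
  set a : ℕ → ℝ := fun p => if 0 ≤ U p then 1 / 2 else -(1 / 2) with ha
  have ha2 : ∀ p, a p ^ 2 = 1 / 4 := fun p => by simp only [ha]; split_ifs <;> norm_num
  have haU : ∀ p, a p * U p = |U p| / 2 := fun p => by
    simp only [ha]
    split_ifs with h
    · rw [abs_of_nonneg h]; ring
    · rw [abs_of_neg (not_le.1 h)]; ring
  have hsq : sqWt (midPrimes N) a ≤ 1 := by
    have : sqWt (midPrimes N) a = 1 / 4 * ∑ p ∈ midPrimes N, 1 / (p : ℝ) := by
      rw [sqWt, mul_sum]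
      exact sum_congr rfl fun p _ => by rw [ha2]; ring
    rw [this]
    linarith [(h2 N hN2).2]
  have h := h1 N hN1 φ hφ hφ1 (midPrimes N) a (fun p hp => (mem_midPrimes.1 hp).2)
    (fun p hp => lt_of_pow_lt_pow_left' 8 (hN3.trans_lt (mem_midPrimes.1 hp).1.1))
    (fun p hp => (mem_midPrimes.1 hp).1.2) hsq
  have e : ∑ n ∈ Ioc 0 N, φ (g n) * xiSum (midPrimes N) a n =
      ∑ p ∈ midPrimes N, |U p| / 2 := by
    simp only [xiSum, mul_sum]
    rw [sum_comm]
    refine sum_congr rfl fun p _ => ?_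
    rw [← haU, hU, mul_sum]
    exact sum_congr rfl fun n _ => by ring
  rw [e, ← sum_div] at h
  linarith [le_abs_self ((∑ p ∈ midPrimes N, |U p|) / 2)]

lemma HasSparseDescents.exists_mem_midPrimes_abs_le {g : ℕ → ℝ} (hs : HasSparseDescents g)
    {ε : ℝ} (hε : 0 < ε) : ∃ N₀ : ℕ, ∀ N : ℕ, N₀ ≤ N → ∀ φ ψ : ℝ → ℝ, Monotone φ →
      (∀ x, |φ x| ≤ 1) → Monotone ψ → (∀ x, |ψ x| ≤ 1) → ∃ p ∈ midPrimes N,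
        |∑ n ∈ Ioc 0 N, φ (g n) * xi p n| ≤ ε * N / p ∧
        |∑ n ∈ Ioc 0 N, ψ (g n) * xi p n| ≤ ε * N / p := by
  obtain ⟨N₁, h1⟩ := hs.exists_sum_midPrimes_abs_le (ε := ε / 16) (by positivity)
  obtain ⟨N₂, h2⟩ := exists_sum_midPrimes_bounds
  refine ⟨max N₁ N₂, fun N hN φ ψ hφ hφ1 hψ hψ1 => ?_⟩
  have hlow := (h2 N ((le_max_right _ _).trans hN)).1
  have hne : (midPrimes N).Nonempty := by
    rw [nonempty_iff_ne_empty]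
    intro h
    rw [h, sum_empty] at hlow
    norm_num at hlow
  have e1 := h1 N ((le_max_left _ _).trans hN) φ hφ hφ1
  have e2 := h1 N ((le_max_left _ _).trans hN) ψ hψ hψ1
  have hle : ∑ p ∈ midPrimes N, (|∑ n ∈ Ioc 0 N, φ (g n) * xi p n| +
      |∑ n ∈ Ioc 0 N, ψ (g n) * xi p n|) ≤ ∑ p ∈ midPrimes N, ε * N / p := by
    have e3 : ∑ p ∈ midPrimes N, ε * N / p = ε * N * ∑ p ∈ midPrimes N, 1 / (p : ℝ) := by
      rw [mul_sum]
      exact sum_congr rfl fun p _ => by ring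
    have e4 : ε * N * (1 / 4) ≤ ε * N * ∑ p ∈ midPrimes N, 1 / (p : ℝ) := by gcongr
    rw [sum_add_distrib, e3]
    linarith
  obtain ⟨p, hp, h⟩ := exists_le_of_sum_le hne hle
  have := abs_nonneg (∑ n ∈ Ioc 0 N, φ (g n) * xi p n)
  have := abs_nonneg (∑ n ∈ Ioc 0 N, ψ (g n) * xi p n)
  exact ⟨p, hp, by linarith, by linarith⟩

lemma IsAdditiveR.abs_sum_mul_divInd_sub_cntGt_le {g : ℕ → ℝ} (hg : IsAdditiveR g) {p : ℕ}
    (hp : p.Prime) (c : ℝ) (N : ℕ) :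
    |∑ n ∈ Ioc 0 N, (if c < g n then (1 : ℝ) else 0) * divInd p n - cntGt g (c - g p) (N / p)| ≤
      ((N / p : ℕ) : ℝ) / p := by
  have himg : (Ioc 0 (N / p)).image (p * ·) ⊆ Ioc 0 N := by
    intro n hn
    obtain ⟨m, hm, rfl⟩ := mem_image.1 hn
    have hm := mem_Ioc.1 hm
    have := Nat.mul_le_of_le_div p m N hm.2
    exact mem_Ioc.2 ⟨Nat.mul_pos hp.pos hm.1, by linarith⟩
  have e : ∑ n ∈ Ioc 0 N, (if c < g n then (1 : ℝ) else 0) * divInd p n =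
      ∑ m ∈ Ioc 0 (N / p), (if c < g (p * m) then (1 : ℝ) else 0) := by
    rw [← sum_subset himg, sum_image]
    · exact sum_congr rfl fun m _ => by simp [divInd]
    · intro x _ y _ hxy
      exact Nat.eq_of_mul_eq_mul_left hp.pos hxy
    · intro n hn hnot
      have : ¬ p ∣ n := by
        rintro ⟨m, rfl⟩
        have hn := mem_Ioc.1 hn
        refine hnot (mem_image.2 ⟨m, mem_Ioc.2 ⟨Nat.pos_of_mul_pos_left hn.1, ?_⟩, rfl⟩)
        rw [Nat.le_div_iff_mul_le hp.pos]
        linarith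
      simp [divInd, this]
  rw [e, cntGt, ← sum_sub_distrib]
  refine (abs_sum_le_sum_abs _ _).trans (le_trans (sum_le_sum fun m _ => ?_)
    (sum_divInd_le p (N / p)))
  by_cases h : p ∣ m
  · simp only [divInd, h, if_true]
    split_ifs <;> norm_num
  · rw [hg p m ((Nat.Prime.coprime_iff_not_dvd hp).2 h)]
    simp [divInd, h, sub_lt_iff_lt_add']

/-- The proportion of `n ≤ N` with `c < g n`. -/
noncomputable def densGt (g : ℕ → ℝ) (c : ℝ) (N : ℕ) : ℝ := cntGt g c N / N

lemma cntGt_nonneg (g : ℕ → ℝ) (c : ℝ) (N : ℕ) : 0 ≤ cntGt g c N := by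
  rw [cntGt_eq_card]; positivity

lemma cntGt_le (g : ℕ → ℝ) (c : ℝ) (N : ℕ) : cntGt g c N ≤ N := by
  rw [cntGt_eq_card]
  have := card_filter_le (Ioc 0 N) (fun n => c < g n)
  rw [Nat.card_Ioc, Nat.sub_zero] at this
  exact_mod_cast this

lemma densGt_nonneg (g : ℕ → ℝ) (c : ℝ) (N : ℕ) : 0 ≤ densGt g c N :=
  div_nonneg (cntGt_nonneg g c N) (Nat.cast_nonneg N)

lemma densGt_le_one (g : ℕ → ℝ) (c : ℝ) (N : ℕ) : densGt g c N ≤ 1 :=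
  div_le_one_of_le₀ (cntGt_le g c N) (Nat.cast_nonneg N)

lemma IsAdditiveR.abs_densGt_sub_densGt_div_le {g : ℕ → ℝ} (hg : IsAdditiveR g) {p N : ℕ}
    (hp : p.Prime) (hpN : p ^ 2 ≤ N) {c ε : ℝ}
    (h : |∑ n ∈ Ioc 0 N, (if c < g n then (1 : ℝ) else 0) * xi p n| ≤ ε * N / p) :
    |densGt g c N - densGt g (c - g p) (N / p)| ≤ ε + 2 / p := by
  have hp0 : (0 : ℝ) < p := by exact_mod_cast hp.pos
  have hNpos : 0 < N := (pow_pos hp.pos 2).trans_le hpN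
  have hN0 : (0 : ℝ) < N := by exact_mod_cast hNpos
  set Y := N / p with hY
  have hYpos : 0 < Y := Nat.div_pos (by nlinarith [hp.two_le]) hp.pos
  have hY0 : (0 : ℝ) < Y := by exact_mod_cast hYpos
  have hYle : (p : ℝ) * Y ≤ N := by exact_mod_cast Nat.mul_div_le N p
  have hYlt : (N : ℝ) ≤ p * Y + p := by
    have : N < p * (Y + 1) := Nat.lt_mul_div_succ N hp.pos
    have : (N : ℝ) ≤ p * (Y + 1) := by exact_mod_cast this.le
    linarith
  have h1 := hg.abs_sum_mul_divInd_sub_cntGt_le hp c N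
  have e : ∑ n ∈ Ioc 0 N, (if c < g n then (1 : ℝ) else 0) * xi p n =
      ∑ n ∈ Ioc 0 N, (if c < g n then (1 : ℝ) else 0) * divInd p n - cntGt g c N / p := by
    simp only [xi, mul_sub, sum_sub_distrib, ← sum_mul]
    rw [cntGt]; ring
  rw [e] at h
  set S := ∑ n ∈ Ioc 0 N, (if c < g n then (1 : ℝ) else 0) * divInd p n
  set C := cntGt g c N
  set D := cntGt g (c - g p) Y with hD
  have hD0 : 0 ≤ D := cntGt_nonneg _ _ _
  have hDY : D ≤ Y := cntGt_le _ _ _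
  have hmain : |C / p - D| ≤ ε * N / p + Y / p := by
    have := abs_sub_le (C / p) S D
    rw [abs_sub_comm (C / p) S] at this
    linarith
  have e1 : C / N - D / Y = (p / N) * (C / p - D) - D / Y * ((N - p * Y) / N) := by
    field_simp; ring
  have e2 : |(p / N : ℝ) * (C / p - D)| ≤ ε + 1 / p := by
    rw [abs_mul, abs_of_pos (by positivity : (0 : ℝ) < p / N)]
    calc _ ≤ (p / N : ℝ) * (ε * N / p + Y / p) := by gcongr
      _ = ε + p * Y / N * (1 / p) := by field_simp
      _ ≤ ε + 1 * (1 / p) := by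
        gcongr
        exact (div_le_one hN0).2 hYle
      _ = _ := by ring
  have e3 : |D / Y * ((N - p * Y) / N)| ≤ 1 / p := by
    rw [abs_of_nonneg (mul_nonneg (by positivity) (div_nonneg (by linarith) hN0.le))]
    have a1 : D / Y ≤ 1 := (div_le_one hY0).2 hDY
    have a2 : (N - p * Y) / N ≤ 1 / (p : ℝ) := by
      rw [div_le_div_iff₀ hN0 hp0]
      have : (p : ℝ) ^ 2 ≤ N := by exact_mod_cast hpN
      nlinarith
    calc _ ≤ 1 * (1 / (p : ℝ)) :=
          mul_le_mul a1 a2 (div_nonneg (by linarith) hN0.le) zero_le_one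
      _ = _ := one_mul _
  rw [densGt, densGt, e1]
  refine (abs_sub _ _).trans ?_
  have : 2 / (p : ℝ) = 1 / p + 1 / p := by ring
  linarith

lemma HasSparseDescents.exists_abs_densGt_sub_le {g : ℕ → ℝ} (hs : HasSparseDescents g)
    (hg : IsAdditiveR g) {ε : ℝ} (hε : 0 < ε) :
    ∃ N₀ : ℕ, ∀ N : ℕ, N₀ ≤ N → ∀ c d : ℝ, ∃ (Y : ℕ) (s : ℝ), N ≤ Y ^ 2 ∧
      Real.log Y ≤ 7 / 8 * Real.log N ∧ |densGt g c N - densGt g (c - s) Y| ≤ ε ∧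
      |densGt g d N - densGt g (d - s) Y| ≤ ε := by
  obtain ⟨N₁, h1⟩ := hs.exists_mem_midPrimes_abs_le (half_pos hε)
  refine ⟨max N₁ (⌈4 / ε⌉₊ ^ 8), fun N hN c d => ?_⟩
  obtain ⟨p, hp, hc, hd⟩ := h1 N ((le_max_left _ _).trans hN) _ _ (monotone_ite_lt c)
    (abs_ite_lt_le_one c) (monotone_ite_lt d) (abs_ite_lt_le_one d)
  obtain ⟨⟨hp8, hp4⟩, hpp⟩ := mem_midPrimes.1 hp
  have hp2 := hpp.two_le
  have hp0 : (0 : ℝ) < p := by exact_mod_cast hpp.pos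
  have hpN : p ^ 2 ≤ N := (Nat.pow_le_pow_right hpp.pos (by norm_num)).trans hp4
  have hpε : 2 / (p : ℝ) ≤ ε / 2 := by
    have h : ⌈4 / ε⌉₊ < p :=
      lt_of_pow_lt_pow_left' 8 (((le_max_right _ _).trans hN).trans_lt hp8)
    have h' : 4 / ε < p := (Nat.lt_of_ceil_lt h)
    rw [div_lt_iff₀ hε] at h'
    rw [div_le_div_iff₀ hp0 (by norm_num)]
    linarith
  have hY3 : p ^ 3 ≤ N / p := by
    rw [Nat.le_div_iff_mul_le hpp.pos, ← pow_succ]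
    exact hp4
  have hYN : N < p * (N / p + 1) := Nat.lt_mul_div_succ N hpp.pos
  have hYle : p * (N / p) ≤ N := Nat.mul_div_le N p
  refine ⟨N / p, g p, ?_, ?_, ?_, ?_⟩
  · set Y := N / p
    have : 2 * p ≤ Y := by nlinarith [Nat.mul_le_mul hp2 hp2]
    nlinarith
  · set Y := N / p
    have hYpos : 0 < Y := (pow_pos hpp.pos 3).trans_le hY3
    have hN0 : 0 < N := (Nat.mul_pos hpp.pos hYpos).trans_le hYle
    have a1 : Real.log N ≤ 8 * Real.log p := by
      rw [← Nat.cast_ofNat, ← Real.log_pow]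
      exact Real.log_le_log (by positivity) (by exact_mod_cast hp8.le)
    have a2 : Real.log p + Real.log Y ≤ Real.log N := by
      rw [← Real.log_mul (by positivity) (by positivity)]
      exact Real.log_le_log (by positivity) (by exact_mod_cast hYle)
    linarith
  · exact (hg.abs_densGt_sub_densGt_div_le hpp hpN hc).trans (by linarith)
  · exact (hg.abs_densGt_sub_densGt_div_le hpp hpN hd).trans (by linarith)

lemma HasSparseDescents.exists_abs_densGt_sub_le_iterate {g : ℕ → ℝ} (hs : HasSparseDescents g)
    (hg : IsAdditiveR g) (k : ℕ) {ε : ℝ} (hε : 0 < ε) :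
    ∃ N₀ : ℕ, ∀ N : ℕ, N₀ ≤ N → ∀ c d : ℝ, ∃ (Y : ℕ) (s : ℝ), N ≤ Y ^ 2 ^ k ∧
      Real.log Y ≤ (7 / 8) ^ k * Real.log N ∧ |densGt g c N - densGt g (c - s) Y| ≤ ε ∧
      |densGt g d N - densGt g (d - s) Y| ≤ ε := by
  induction k generalizing ε with
  | zero => exact ⟨0, fun N _ c d => ⟨N, 0, by simp, by simp, by simp [hε.le], by simp [hε.le]⟩⟩
  | succ k ih =>
    obtain ⟨N₁, h1⟩ := ih (half_pos hε)
    obtain ⟨N₂, h2⟩ := hs.exists_abs_densGt_sub_le hg (half_pos hε)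
    refine ⟨max N₁ (N₂ ^ 2 ^ k), fun N hN c d => ?_⟩
    obtain ⟨Y, s, hY, hl, hc, hd⟩ := h1 N ((le_max_left _ _).trans hN) c d
    have hY2 : N₂ ≤ Y := by
      refine (Nat.pow_le_pow_iff_left (n := 2 ^ k) (by positivity)).1 ?_
      exact ((le_max_right _ _).trans hN).trans hY
    obtain ⟨Z, t, hZ, hl', hc', hd'⟩ := h2 Y hY2 (c - s) (d - s)
    refine ⟨Z, s + t, ?_, ?_, ?_, ?_⟩
    · rw [pow_succ', pow_mul]
      exact hY.trans (Nat.pow_le_pow_left hZ _)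
    · rw [pow_succ']
      linarith
    · rw [← sub_sub]
      linarith [abs_sub_le (densGt g c N) (densGt g (c - s) Y) (densGt g (c - s - t) Z)]
    · rw [← sub_sub]
      linarith [abs_sub_le (densGt g d N) (densGt g (d - s) Y) (densGt g (d - s - t) Z)]

lemma HasSparseDescents.exists_densGt_mul_le {g : ℕ → ℝ} (hs : HasSparseDescents g)
    (hg : IsAdditiveR g) (hB : ∀ b : ℝ, ∃ N₀ : ℕ, ∀ N : ℕ, N₀ ≤ N → b ≤ BgR g N)
    {ε : ℝ} (hε : 0 < ε) : ∃ N₀ : ℕ, ∀ N : ℕ, N₀ ≤ N → ∀ c : ℝ,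
      densGt g (c + ε * BgR g N) N * (1 - densGt g c N) ≤ ε := by
  obtain ⟨δ, β₀, Y₀, N₁, hδ, h1⟩ := hs.exists_card_lt_abs_sub_le hg (κ := ε / 4) (by positivity)
  obtain ⟨k, hk⟩ := exists_pow_lt_of_lt_one hδ (by norm_num : (7 / 8 : ℝ) < 1)
  obtain ⟨N₂, h2⟩ := hs.exists_abs_densGt_sub_le_iterate hg k (ε := ε / 4) (by positivity)
  obtain ⟨N₃, h3⟩ := hB (max β₀ 1)
  refine ⟨max (max N₁ N₂) (max N₃ ((max Y₀ 1) ^ 2 ^ k)), fun N hN c => ?_⟩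
  simp only [max_le_iff] at hN
  obtain ⟨⟨hN1, hN2⟩, hN3, hN4⟩ := hN
  have hβ := max_le_iff.1 (h3 N hN3)
  set B := BgR g N
  have hB0 : 0 < B := zero_lt_one.trans_le hβ.2
  obtain ⟨Y, s, hY, hl, hc, hd⟩ := h2 N hN2 c (c + ε * B)
  have hYmax : max Y₀ 1 ≤ Y :=
    (Nat.pow_le_pow_iff_left (n := 2 ^ k) (by positivity)).1 (hN4.trans hY)
  have hY1 : 1 ≤ Y := (le_max_right _ _).trans hYmax
  have hYpos : (0 : ℝ) < Y := by exact_mod_cast hY1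
  obtain ⟨m, hm⟩ := h1 N hN1 B hβ.1 hB0 le_rfl Y ((le_max_left _ _).trans hYmax)
    (hl.trans (mul_le_mul_of_nonneg_right hk.le (Real.log_natCast_nonneg N)))
  have hεB : 0 < ε * B := mul_pos hε hB0
  have p1 := densGt_nonneg g (c + ε * B) N
  have p2 := densGt_le_one g (c + ε * B) N
  have p3 := densGt_nonneg g c N
  have p4 := densGt_le_one g c N
  by_cases h : m + ε / 4 * B ≤ c + ε * B - s
  · have h4 : densGt g (c + ε * B - s) Y ≤ ε / 4 :=
      (div_le_iff₀ hYpos).2 ((cntGt_le_card h).trans hm)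
    have h5 := (abs_le.1 hd).2
    nlinarith
  · have h4 : 1 - ε / 4 ≤ densGt g (c - s) Y := by
      rw [densGt, le_div_iff₀ hYpos]
      have := le_cntGt (g := g) (c := c - s) (m := m) (κ := ε / 4 * B) (N := Y) (by linarith)
      linarith
    have h5 := (abs_le.1 hc).1
    nlinarith

lemma cntGt_antitone (g : ℕ → ℝ) (N : ℕ) {c d : ℝ} (h : c ≤ d) : cntGt g d N ≤ cntGt g c N := by
  refine sum_le_sum fun n _ => ?_
  split_ifs <;> first | (norm_num; done) | (exfalso; linarith)

lemma exists_median (g : ℕ → ℝ) {N : ℕ} (hN : 1 ≤ N) :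
    ∃ m : ℝ, (∀ c, m < c → densGt g c N ≤ 1 / 2) ∧ ∀ c, c < m → 1 / 2 ≤ densGt g c N := by
  have hN0 : (0 : ℝ) < N := by exact_mod_cast hN
  set M := ∑ n ∈ Ioc 0 N, |g n|
  have hM : ∀ n ∈ Ioc 0 N, |g n| ≤ M := fun n hn =>
    single_le_sum (f := fun n => |g n|) (fun _ _ => abs_nonneg _) hn
  set S : Set ℝ := {c | cntGt g c N ≤ N / 2}
  have hne : S.Nonempty := by
    refine ⟨M, ?_⟩
    have : cntGt g M N = 0 := sum_eq_zero fun n hn =>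
      if_neg (not_lt.2 ((le_abs_self _).trans (hM n hn)))
    change cntGt g M N ≤ N / 2
    rw [this]
    positivity
  have hbdd : BddBelow S := by
    refine ⟨-M - 1, fun c hc => ?_⟩
    by_contra! h
    have : cntGt g c N = N := by
      rw [cntGt, sum_congr rfl fun n hn => if_pos ?_]
      · simp
      · have := neg_abs_le (g n)
        have := hM n hn
        linarith
    have hc : cntGt g c N ≤ N / 2 := hc
    linarith
  refine ⟨sInf S, fun c hc => ?_, fun c hc => ?_⟩
  · obtain ⟨d, hd, hdc⟩ := exists_lt_of_csInf_lt hne hc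
    rw [densGt, div_le_iff₀ hN0]
    have hd : cntGt g d N ≤ N / 2 := hd
    linarith [cntGt_antitone g N hdc.le]
  · have h : ¬ cntGt g c N ≤ N / 2 := fun h => not_le.2 hc (csInf_le hbdd h)
    rw [densGt, le_div_iff₀ hN0]
    linarith

lemma card_lt_abs_sub_le (g : ℕ → ℝ) (m : ℝ) {t u : ℝ} (h : t < u) (N : ℕ) :
    (((Ioc 0 N).filter (fun n => u < |g n - m|)).card : ℝ) ≤
      N * densGt g (m + t) N + N * (1 - densGt g (m - t) N) := by
  rcases Nat.eq_zero_or_pos N with rfl | hN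
  · simp
  have hN0 : (N : ℝ) ≠ 0 := by positivity
  have e1 : N * densGt g (m + t) N = ∑ n ∈ Ioc 0 N, if m + t < g n then (1 : ℝ) else 0 := by
    rw [densGt, mul_div_cancel₀ _ hN0, cntGt]
  have e2 : N * (1 - densGt g (m - t) N) =
      ∑ n ∈ Ioc 0 N, (1 - if m - t < g n then (1 : ℝ) else 0) := by
    rw [mul_sub, densGt, mul_div_cancel₀ _ hN0, cntGt, sum_sub_distrib]
    simp
  rw [e1, e2, ← sum_add_distrib, ← sum_boole]
  refine sum_le_sum fun n _ => ?_
  by_cases h1 : u < |g n - m|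
  · rcases lt_abs.1 h1 with h2 | h2
    · rw [if_pos h1, if_pos (by linarith)]
      split_ifs <;> norm_num
    · rw [if_pos h1, if_neg (by linarith : ¬ m - t < g n)]
      split_ifs <;> norm_num
  · rw [if_neg h1]
    split_ifs <;> norm_num

lemma HasSparseDescents.exists_center {g : ℕ → ℝ} (hs : HasSparseDescents g)
    (hg : IsAdditiveR g) : ∃ m : ℕ → ℝ, ∀ ε : ℝ, 0 < ε → ∃ N₀ : ℕ, ∀ N : ℕ, N₀ ≤ N →
      (((Ioc 0 N).filter (fun n => ε * BgR g N < |g n - m N|)).card : ℝ) ≤ ε * N := by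
  by_cases hb : ∃ b : ℝ, ∀ N : ℕ, BgR g N ≤ b
  · obtain ⟨b, hb⟩ := hb
    refine ⟨fun _ => 0, fun ε hε => ⟨0, fun N _ => ?_⟩⟩
    rw [filter_false_of_mem, card_empty]
    · simpa using by positivity
    · intro n hn
      rw [hg.eq_zero_of_primePow (fun q hq => hs.eq_zero_of_bounded hg hb hq)
        (mem_Ioc.1 hn).1.ne', sub_zero, abs_zero, not_lt]
      exact mul_nonneg hε.le (BgR_nonneg _ _)
  · push Not at hb
    have hB : ∀ b : ℝ, ∃ N₀ : ℕ, ∀ N : ℕ, N₀ ≤ N → b ≤ BgR g N := by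
      intro b
      obtain ⟨N₀, h⟩ := hb b
      exact ⟨N₀, fun N hN => h.le.trans (BgR_mono g (by exact_mod_cast hN))⟩
    choose! m hm using fun (N : ℕ) (hN : 1 ≤ N) => exists_median g hN
    refine ⟨m, fun ε hε => ?_⟩
    obtain ⟨N₁, h1⟩ := hs.exists_densGt_mul_le hg hB (ε := ε / 4) (by positivity)
    obtain ⟨N₂, h2⟩ := hB 1
    refine ⟨max (max N₁ N₂) 1, fun N hN => ?_⟩
    obtain ⟨hup, hlow⟩ := hm N (by omega)
    have hB1 := h2 N (by omega)
    have hM := h1 N (by omega)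
    set B := BgR g N
    have ht : 0 < ε / 4 * B := by positivity
    refine (card_lt_abs_sub_le g (m N) (t := 2 * (ε / 4 * B)) (by linarith) N).trans ?_
    have a1 := hup (m N + ε / 4 * B) (by linarith)
    have a2 := hM (m N + ε / 4 * B)
    have a3 := hlow (m N - ε / 4 * B) (by linarith)
    have a4 := hM (m N - 2 * (ε / 4 * B))
    rw [show m N + ε / 4 * B + ε / 4 * B = m N + 2 * (ε / 4 * B) by ring] at a2
    rw [show m N - 2 * (ε / 4 * B) + ε / 4 * B = m N - ε / 4 * B by ring] at a4
    have p1 := densGt_nonneg g (m N + 2 * (ε / 4 * B)) N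
    have p2 := densGt_le_one g (m N - 2 * (ε / 4 * B)) N
    have b1 : densGt g (m N + 2 * (ε / 4 * B)) N ≤ ε / 2 := by nlinarith
    have b2 : 1 - densGt g (m N - 2 * (ε / 4 * B)) N ≤ ε / 2 := by nlinarith
    have hN0 : (0 : ℝ) ≤ N := Nat.cast_nonneg N
    nlinarith [mul_le_mul_of_nonneg_left b1 hN0, mul_le_mul_of_nonneg_left b2 hN0]

/-- Theorem 1.6: if the set of decrease `{n : g(n) < g(n-1)}` has density zero, then
there are `λ(X), η(X)` with `g(n) = λ(X) log n - η(X) + o(B_g(X))` for all but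
`o(X)` integers `n ≤ X`. -/
theorem stmt17 (g : ℕ → ℝ) (hg : IsAdditiveR g) (hg0 : g 0 = 0)
    (hB : ∀ ε : ℝ, 0 < ε → ∃ X₀ : ℝ, ∀ X : ℝ, X₀ ≤ X →
      ((((Finset.Icc 1 ⌊X⌋₊).filter (fun n => g n < g (n - 1))).card : ℝ)) ≤ ε * X) :
    ∃ lam eta : ℝ → ℝ, ∀ ε : ℝ, 0 < ε → ∃ X₀ : ℝ, ∀ X : ℝ, X₀ ≤ X →
      ((((Finset.Icc 1 ⌊X⌋₊).filter
          (fun n => ¬ |g n - (lam X * Real.log n - eta X)| ≤ ε * BgR g X)).card : ℝ))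
        ≤ ε * X := by
  have hs : HasSparseDescents g := by
    intro ε hε
    obtain ⟨X₀, h⟩ := hB ε hε
    refine ⟨⌈X₀⌉₊, fun N hN => ?_⟩
    have := h N (Nat.ceil_le.1 hN)
    rwa [Nat.floor_natCast] at this
  obtain ⟨m, hm⟩ := hs.exists_center hg
  refine ⟨fun _ => 0, fun X => -m ⌊X⌋₊, fun ε hε => ?_⟩
  obtain ⟨N₀, h⟩ := hm ε hε
  refine ⟨N₀, fun X hX => ?_⟩
  have hX0 : 0 ≤ X := (Nat.cast_nonneg N₀).trans hX
  have h1 := h ⌊X⌋₊ (Nat.le_floor hX)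
  rw [BgR_floor] at h1
  simp only [zero_mul, zero_sub, neg_neg, not_le]
  exact h1.trans (mul_le_mul_of_nonneg_left (Nat.floor_le hX0) hε.le)
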